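/- The Verblunsky coefficients α_n of the weight W satisfy α_n = −(1/n) Σ_{k=1}^m (β_k / ϑ_k) a_k^{−(n+1)} + O(1/n²) as n → ∞. -/

import Mathlib

open scoped Real
open Filter MeasureTheory Metric Set Polynomial

set_option linter.unusedSectionVars false

namespace OPUC

/-- The parametrisation of the unit circle by the angle. -/
noncomputable def circ (θ : ℝ) : ℂ := Complex.exp (θ * Complex.I)

@[simp] lemma norm_circ (θ : ℝ) : ‖circ θ‖ = 1 := Complex.norm_exp_ofReal_mul_I θ

@[simp] lemma circ_ne_zero (θ : ℝ) : circ θ ≠ 0 := Complex.exp_ne_zero _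

lemma continuous_circ : Continuous circ := by unfold circ; fun_prop

lemma conj_circ (θ : ℝ) : (starRingEnd ℂ) (circ θ) = (circ θ)⁻¹ :=
  (Complex.inv_eq_conj (norm_circ θ)).symm

lemma conj_circ_mul (θ : ℝ) : (starRingEnd ℂ) (circ θ) * circ θ = 1 := by
  rw [conj_circ, inv_mul_cancel₀ (circ_ne_zero θ)]

lemma circ_mul_conj (θ : ℝ) : circ θ * (starRingEnd ℂ) (circ θ) = 1 := by
  rw [mul_comm, conj_circ_mul]

lemma circ_mem_sphere (θ : ℝ) : circ θ ∈ sphere (0 : ℂ) 1 := by simp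

lemma exists_bound_circ {F : ℂ → ℂ} (hF : ContinuousOn F (sphere 0 1)) :
    ∃ C : ℝ, 0 ≤ C ∧ ∀ θ, ‖F (circ θ)‖ ≤ C := by
  obtain ⟨C, hC⟩ := (isCompact_sphere (0 : ℂ) 1).exists_bound_of_continuousOn hF
  exact ⟨C, (norm_nonneg _).trans (hC _ (circ_mem_sphere 0)), fun θ => hC _ (circ_mem_sphere θ)⟩

lemma continuous_comp_circ {F : ℂ → ℂ} (hF : ContinuousOn F (sphere 0 1)) :
    Continuous fun θ => F (circ θ) :=
  hF.comp_continuous continuous_circ circ_mem_sphere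

lemma integrable_comp_circ {F : ℂ → ℂ} (hF : ContinuousOn F (sphere 0 1)) (μ : Measure ℝ)
    [IsFiniteMeasure μ] : Integrable (fun θ => F (circ θ)) μ := by
  obtain ⟨C, -, hC⟩ := exists_bound_circ hF
  exact Integrable.of_bound (continuous_comp_circ hF).aestronglyMeasurable C (ae_of_all _ hC)

lemma integrable_eval_mul_conj (p q : ℂ[X]) (μ : Measure ℝ) [IsFiniteMeasure μ] :
    Integrable (fun θ => p.eval (circ θ) * (starRingEnd ℂ) (q.eval (circ θ))) μ :=
  integrable_comp_circ (F := fun z => p.eval z * (starRingEnd ℂ) (q.eval z))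
    (by fun_prop) μ

/-- The Cauchy–Schwarz inequality for complex functions. -/
lemma norm_integral_mul_sq_le {Ω : Type*} [MeasurableSpace Ω] {μ : Measure Ω} {f g : Ω → ℂ}
    (hf : MemLp f 2 μ) (hg : MemLp g 2 μ) :
    ‖∫ x, f x * g x ∂μ‖ ^ 2 ≤ (∫ x, ‖f x‖ ^ 2 ∂μ) * ∫ x, ‖g x‖ ^ 2 ∂μ := by
  have h1 : ‖∫ x, f x * g x ∂μ‖ ≤ ∫ x, ‖f x‖ * ‖g x‖ ∂μ := by
    refine (norm_integral_le_integral_norm _).trans_eq ?_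
    simp
  have h2 := integral_mul_norm_le_Lp_mul_Lq (μ := μ) (f := f) (g := g) (p := 2) (q := 2)
    Real.HolderConjugate.two_two (by simpa using hf) (by simpa using hg)
  have h3 := h1.trans h2
  have hA : 0 ≤ ∫ x, ‖f x‖ ^ 2 ∂μ := integral_nonneg fun x => by positivity
  have hB : 0 ≤ ∫ x, ‖g x‖ ^ 2 ∂μ := integral_nonneg fun x => by positivity
  simp only [Real.rpow_two, ← Real.sqrt_eq_rpow] at h3
  calc ‖∫ x, f x * g x ∂μ‖ ^ 2 ≤ (√(∫ x, ‖f x‖ ^ 2 ∂μ) * √(∫ x, ‖g x‖ ^ 2 ∂μ)) ^ 2 := by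
        gcongr
    _ = _ := by rw [mul_pow, Real.sq_sqrt hA, Real.sq_sqrt hB]

/-- The sesquilinear pairing of polynomials induced by a measure on the circle. -/
noncomputable def ip (μ : Measure ℝ) (p q : ℂ[X]) : ℂ :=
  ∫ θ, p.eval (circ θ) * (starRingEnd ℂ) (q.eval (circ θ)) ∂μ

section Pairing

variable (μ : Measure ℝ) [IsFiniteMeasure μ]

lemma ip_add_left (p p' q : ℂ[X]) : ip μ (p + p') q = ip μ p q + ip μ p' q := by
  unfold ip
  rw [← integral_add (integrable_eval_mul_conj _ _ _) (integrable_eval_mul_conj _ _ _)]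
  simp [add_mul]

omit [IsFiniteMeasure μ] in
lemma ip_smul_left (c : ℂ) (p q : ℂ[X]) : ip μ (c • p) q = c * ip μ p q := by
  unfold ip
  rw [← integral_const_mul]
  simp [mul_assoc]

omit [IsFiniteMeasure μ] in
lemma conj_ip (p q : ℂ[X]) : (starRingEnd ℂ) (ip μ p q) = ip μ q p := by
  unfold ip
  rw [← integral_conj]
  simp [mul_comm]

/-- The pairing as a linear map in its first argument. -/
noncomputable def ipl (q : ℂ[X]) : ℂ[X] →ₗ[ℂ] ℂ where
  toFun p := ip μ p q
  map_add' p p' := ip_add_left μ p p' q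
  map_smul' c p := ip_smul_left μ c p q

lemma ip_sub_left (p p' q : ℂ[X]) : ip μ (p - p') q = ip μ p q - ip μ p' q :=
  map_sub (ipl μ q) p p'

lemma ip_sum_left {ι : Type*} (s : Finset ι) (f : ι → ℂ[X]) (q : ℂ[X]) :
    ip μ (∑ i ∈ s, f i) q = ∑ i ∈ s, ip μ (f i) q :=
  map_sum (ipl μ q) f s

lemma ip_add_right (p q q' : ℂ[X]) : ip μ p (q + q') = ip μ p q + ip μ p q' := by
  rw [← conj_ip, ip_add_left, map_add, conj_ip, conj_ip]

lemma ip_sub_right (p q q' : ℂ[X]) : ip μ p (q - q') = ip μ p q - ip μ p q' := by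
  rw [← conj_ip, ip_sub_left, map_sub, conj_ip, conj_ip]

omit [IsFiniteMeasure μ] in
lemma ip_smul_right (c : ℂ) (p q : ℂ[X]) : ip μ p (c • q) = (starRingEnd ℂ) c * ip μ p q := by
  rw [← conj_ip, ip_smul_left, map_mul, conj_ip]

lemma ip_sum_right {ι : Type*} (s : Finset ι) (p : ℂ[X]) (f : ι → ℂ[X]) :
    ip μ p (∑ i ∈ s, f i) = ∑ i ∈ s, ip μ p (f i) := by
  rw [← conj_ip, ip_sum_left, map_sum]
  simp only [conj_ip]

omit [IsFiniteMeasure μ] in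
lemma ip_X_mul (p q : ℂ[X]) : ip μ (X * p) (X * q) = ip μ p q := by
  unfold ip
  congr 1
  ext θ
  simp only [eval_mul, eval_X, map_mul]
  linear_combination (eval (circ θ) p * (starRingEnd ℂ) (eval (circ θ) q)) * circ_mul_conj θ

omit [IsFiniteMeasure μ] in
lemma ip_X_pow_mul (k : ℕ) (p q : ℂ[X]) : ip μ (X ^ k * p) (X ^ k * q) = ip μ p q := by
  induction k with
  | zero => simp
  | succ k ih => rw [pow_succ', mul_assoc, mul_assoc, ip_X_mul, ih]

/-- The squared norm of a polynomial for the pairing. -/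
noncomputable def nsq (p : ℂ[X]) : ℝ := ∫ θ, ‖p.eval (circ θ)‖ ^ 2 ∂μ

omit [IsFiniteMeasure μ] in
lemma ip_self (p : ℂ[X]) : ip μ p p = nsq μ p := by
  unfold ip nsq
  rw [← integral_complex_ofReal]
  congr 1
  ext θ
  rw [Complex.mul_conj, Complex.normSq_eq_norm_sq]

omit [IsFiniteMeasure μ] in
lemma nsq_nonneg (p : ℂ[X]) : 0 ≤ nsq μ p := integral_nonneg fun _ => by positivity

omit [IsFiniteMeasure μ] in
lemma nsq_X_mul (p : ℂ[X]) : nsq μ (X * p) = nsq μ p := by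
  unfold nsq; simp

omit [IsFiniteMeasure μ] in
lemma nsq_X_pow_mul (k : ℕ) (p : ℂ[X]) : nsq μ (X ^ k * p) = nsq μ p := by
  unfold nsq; simp

lemma memLp_eval (p : ℂ[X]) : MemLp (fun θ => p.eval (circ θ)) 2 μ := by
  obtain ⟨C, -, hC⟩ := exists_bound_circ (F := fun z => p.eval z) (by fun_prop)
  exact MemLp.of_bound (continuous_comp_circ (F := fun z => p.eval z)
    (by fun_prop)).aestronglyMeasurable C (ae_of_all _ hC)

lemma norm_ip_sq_le (p q : ℂ[X]) : ‖ip μ p q‖ ^ 2 ≤ nsq μ p * nsq μ q := by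
  have := norm_integral_mul_sq_le (memLp_eval μ p) (g := fun θ => (starRingEnd ℂ) (q.eval (circ θ)))
    (memLp_eval μ q).star
  simpa [ip, nsq] using this

lemma norm_ip_le {p q : ℂ[X]} {A : ℝ} (hA : 0 ≤ A) (hp : nsq μ p ≤ A) (hq : nsq μ q ≤ A) :
    ‖ip μ p q‖ ≤ A := by
  refine abs_le_of_sq_le_sq' ?_ hA |>.2
  calc _ ≤ _ := norm_ip_sq_le μ p q
    _ ≤ A * A := by gcongr; exact nsq_nonneg _ _
    _ = _ := by ring

/-- The reversed polynomial of formal degree `n` with conjugated coefficients. -/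
noncomputable def rev (n : ℕ) (p : ℂ[X]) : ℂ[X] := (p.map (starRingEnd ℂ)).reflect n

lemma coeff_rev {n i : ℕ} (hi : i ≤ n) (p : ℂ[X]) :
    (rev n p).coeff i = (starRingEnd ℂ) (p.coeff (n - i)) := by
  rw [rev, coeff_reflect, revAt_le hi, coeff_map]

lemma natDegree_rev {n : ℕ} {p : ℂ[X]} (hp : p.natDegree ≤ n) : (rev n p).natDegree ≤ n := by
  rw [natDegree_le_iff_coeff_eq_zero]
  intro i hi
  rw [rev, coeff_reflect, revAt_eq_self_of_lt hi, coeff_map,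
    coeff_eq_zero_of_natDegree_lt (hp.trans_lt hi), map_zero]

lemma eval_rev_of_norm_one {n : ℕ} {p : ℂ[X]} (hp : p.natDegree ≤ n) {z : ℂ} (hz : ‖z‖ = 1) :
    (rev n p).eval z = z ^ n * (starRingEnd ℂ) (p.eval z) := by
  have hz0 : z ≠ 0 := by rintro rfl; simp at hz
  have hzz : z * (starRingEnd ℂ) z = 1 := by
    rw [Complex.mul_conj, Complex.normSq_eq_norm_sq, hz]; simp
  rw [eval_eq_sum_range' (Nat.lt_succ_of_le (natDegree_rev hp)),
    eval_eq_sum_range' (Nat.lt_succ_of_le hp), map_sum, Finset.mul_sum,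
    ← Finset.sum_range_reflect]
  refine Finset.sum_congr rfl fun i hi => ?_
  have hi' : i ≤ n := Nat.lt_succ_iff.1 (Finset.mem_range.1 hi)
  have : n.succ - 1 - i = n - i := by omega
  rw [this, coeff_rev (Nat.sub_le _ _), Nat.sub_sub_self hi', map_mul, map_pow]
  have h2 : z ^ n = z ^ (n - i) * z ^ i := by rw [← pow_add, Nat.sub_add_cancel hi']
  rw [h2]
  have h3 : z ^ i * (starRingEnd ℂ) z ^ i = 1 := by rw [← mul_pow, hzz, one_pow]
  linear_combination (-((starRingEnd ℂ) (p.coeff i) * z ^ (n - i))) * h3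

omit [IsFiniteMeasure μ] in
lemma ip_rev {n : ℕ} {p q : ℂ[X]} (hp : p.natDegree ≤ n) (hq : q.natDegree ≤ n) :
    ip μ (rev n p) (rev n q) = ip μ q p := by
  unfold ip
  congr 1
  ext θ
  rw [eval_rev_of_norm_one hp (norm_circ θ), eval_rev_of_norm_one hq (norm_circ θ)]
  have h3 : circ θ ^ n * (starRingEnd ℂ) (circ θ) ^ n = 1 := by
    rw [← mul_pow, circ_mul_conj, one_pow]
  simp only [map_mul, map_pow, Complex.conj_conj]
  linear_combination ((starRingEnd ℂ) (eval (circ θ) p) * eval (circ θ) q) * h3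

omit [IsFiniteMeasure μ] in
lemma nsq_rev {n : ℕ} {p : ℂ[X]} (hp : p.natDegree ≤ n) : nsq μ (rev n p) = nsq μ p := by
  have := ip_rev μ hp hp
  rw [ip_self, ip_self] at this
  exact_mod_cast this

lemma rev_X_pow {n j : ℕ} (hj : j ≤ n) : rev n (X ^ j) = X ^ (n - j) := by
  rw [rev, Polynomial.map_pow, map_X, reflect_monomial, revAt_le hj]

/-- A polynomial is orthogonal to `q` as soon as the monomials in its support are. -/
lemma ip_eq_zero_of_coeff {p q : ℂ[X]} (h : ∀ i, p.coeff i ≠ 0 → ip μ (X ^ i) q = 0) :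
    ip μ p q = 0 := by
  rw [p.as_sum_support_C_mul_X_pow, ip_sum_left]
  refine Finset.sum_eq_zero fun i hi => ?_
  rw [← smul_eq_C_mul, ip_smul_left, h i (mem_support_iff.1 hi), mul_zero]

end Pairing

lemma rev_sub (n : ℕ) (p q : ℂ[X]) : rev n (p - q) = rev n p - rev n q := by
  simp [rev, reflect_sub]

lemma rev_smul (n : ℕ) (c : ℂ) (p : ℂ[X]) : rev n (c • p) = (starRingEnd ℂ) c • rev n p := by
  simp [rev, smul_eq_C_mul, reflect_C_mul]

lemma rev_rev {n : ℕ} {p : ℂ[X]} (hp : p.natDegree ≤ n) : rev n (rev n p) = p := by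
  ext i
  by_cases hi : i ≤ n
  · rw [coeff_rev hi, coeff_rev (Nat.sub_le _ _), Nat.sub_sub_self hi, Complex.conj_conj]
  · rw [coeff_eq_zero_of_natDegree_lt ((natDegree_rev (natDegree_rev hp)).trans_lt (by omega)),
      coeff_eq_zero_of_natDegree_lt (by omega)]

lemma rev_succ_X_mul {n : ℕ} {p : ℂ[X]} (hp : p.natDegree ≤ n) :
    rev (n + 1) (X * p) = rev n p := by
  have := reflect_mul (X : ℂ[X]) (p.map (starRingEnd ℂ)) (F := 1) (G := n) natDegree_X_le
    ((natDegree_map_le).trans hp)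
  rw [rev, Polynomial.map_mul, map_X, add_comm, this, rev]
  have h1 : reflect 1 (X : ℂ[X]) = 1 := by
    simpa only [pow_one, revAt_le le_rfl, Nat.sub_self, pow_zero] using
      reflect_monomial (R := ℂ) 1 1
  rw [h1, one_mul]

lemma rev_succ_rev {n : ℕ} {p : ℂ[X]} (hp : p.natDegree ≤ n) :
    rev (n + 1) (rev n p) = X * p := by
  rw [← rev_succ_X_mul hp, rev_rev]
  exact natDegree_mul_le_of_le natDegree_X_le hp |>.trans (by omega)

/-- Monic orthogonal polynomials `Φ` on the unit circle with Verblunsky coefficients `α`, for a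
measure which controls point evaluation at the origin. -/
structure System (μ : Measure ℝ) (D₀ : ℝ) (Φ : ℕ → ℂ[X]) (α : ℕ → ℂ) : Prop where
  pos : 0 < D₀
  low : ∀ p : ℂ[X], D₀ ^ 2 * ‖p.coeff 0‖ ^ 2 ≤ nsq μ p
  monic : ∀ n, (Φ n).Monic
  deg : ∀ n, (Φ n).natDegree = n
  orth : ∀ n, ∀ j < n, ip μ (Φ n) (X ^ j) = 0
  coeff_zero : ∀ n, α n = -(starRingEnd ℂ) ((Φ (n + 1)).coeff 0)

/-- The reversed orthogonal polynomials. -/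
noncomputable def star (Φ : ℕ → ℂ[X]) (n : ℕ) : ℂ[X] := rev n (Φ n)

namespace System

variable {μ : Measure ℝ} [IsFiniteMeasure μ] {D₀ : ℝ} {Φ : ℕ → ℂ[X]} {α : ℕ → ℂ}

lemma eq_zero_of_nsq (S : System μ D₀ Φ α) {p : ℂ[X]} (hp : nsq μ p = 0) : p = 0 := by
  have key : ∀ n : ℕ, ∀ p : ℂ[X], p.natDegree < n → nsq μ p = 0 → p = 0 := by
    intro n
    induction n with
    | zero => intro p hp; omega
    | succ n ih =>
      intro p hpn hp
      have h0 : p.coeff 0 = 0 := by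
        have h1 := S.low p
        rw [hp] at h1
        have h2 : D₀ ^ 2 * ‖p.coeff 0‖ ^ 2 = 0 := le_antisymm h1 (by positivity)
        have h3 := S.pos
        simpa [h3.ne'] using h2
      obtain ⟨q, rfl⟩ := X_dvd_iff.2 h0
      rw [nsq_X_mul] at hp
      by_cases hq : q = 0
      · simp [hq]
      · rw [natDegree_X_mul hq] at hpn
        rw [ih q (by omega) hp, mul_zero]
  exact key _ p (Nat.lt_succ_self _) hp

lemma natDegree_star (S : System μ D₀ Φ α) (n : ℕ) : (star Φ n).natDegree ≤ n :=
  natDegree_rev (S.deg n).le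

lemma coeff_zero_star (S : System μ D₀ Φ α) (n : ℕ) : (star Φ n).coeff 0 = 1 := by
  have h := S.monic n
  rw [Monic, leadingCoeff, S.deg] at h
  rw [star, coeff_rev (Nat.zero_le _), Nat.sub_zero, h, map_one]

lemma ip_right (S : System μ D₀ Φ α) {n : ℕ} {p : ℂ[X]} (hp : ∀ i, p.coeff i ≠ 0 → i < n) :
    ip μ p (Φ n) = 0 :=
  ip_eq_zero_of_coeff μ fun i hi => by rw [← conj_ip, S.orth n i (hp i hi), map_zero]

lemma ip_X_pow_star (S : System μ D₀ Φ α) {n j : ℕ} (h1 : 1 ≤ j) (h2 : j ≤ n) :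
    ip μ (X ^ j) (star Φ n) = 0 := by
  have h3 : (X : ℂ[X]) ^ j = rev n (X ^ (n - j)) := by
    rw [rev_X_pow (Nat.sub_le _ _), Nat.sub_sub_self h2]
  rw [h3, star, ip_rev μ (by simp) (S.deg n).le, S.orth n _ (by omega)]

lemma ip_star (S : System μ D₀ Φ α) {n : ℕ} {p : ℂ[X]}
    (hp : ∀ i, p.coeff i ≠ 0 → 1 ≤ i ∧ i ≤ n) : ip μ p (star Φ n) = 0 :=
  ip_eq_zero_of_coeff μ fun i hi => S.ip_X_pow_star (hp i hi).1 (hp i hi).2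

lemma ip_X_mul_right (S : System μ D₀ Φ α) {n : ℕ} {p : ℂ[X]}
    (hp : ∀ i, p.coeff i ≠ 0 → 1 ≤ i ∧ i ≤ n) : ip μ p (X * Φ n) = 0 := by
  refine ip_eq_zero_of_coeff μ fun i hi => ?_
  obtain ⟨k, rfl⟩ := Nat.exists_eq_add_of_le' (hp i hi).1
  have := (hp _ hi).2
  rw [pow_succ', ip_X_mul, ← conj_ip, S.orth n k (by omega), map_zero]

omit [IsFiniteMeasure μ] in
lemma nsq_star (S : System μ D₀ Φ α) (n : ℕ) : nsq μ (star Φ n) = nsq μ (Φ n) :=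
  nsq_rev μ (S.deg n).le

lemma ip_star_of_natDegree_le (S : System μ D₀ Φ α) {n : ℕ} {p : ℂ[X]} (hp : p.natDegree ≤ n) :
    ip μ p (star Φ n) = p.coeff 0 * nsq μ (Φ n) := by
  have h1 : ip μ (p - p.coeff 0 • star Φ n) (star Φ n) = 0 := by
    refine S.ip_star fun i hi => ⟨?_, ?_⟩
    · rw [Nat.one_le_iff_ne_zero]
      rintro rfl
      simp [S.coeff_zero_star] at hi
    · by_contra! h
      have h2 := S.natDegree_star n
      rw [coeff_sub, coeff_smul, coeff_eq_zero_of_natDegree_lt (hp.trans_lt h),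
        coeff_eq_zero_of_natDegree_lt (h2.trans_lt h)] at hi
      simp at hi
  rw [ip_sub_left, ip_smul_left, ip_self, S.nsq_star] at h1
  linear_combination h1

/-- The Szegő recurrence. -/
lemma rec_left (S : System μ D₀ Φ α) (n : ℕ) :
    Φ (n + 1) = X * Φ n - (starRingEnd ℂ) (α n) • star Φ n := by
  set r := Φ (n + 1) - (X * Φ n - (starRingEnd ℂ) (α n) • star Φ n) with hr
  have hXd : (X * Φ n).natDegree = n + 1 := by
    rw [natDegree_X_mul (S.monic n).ne_zero, S.deg]
  have hc : ∀ i, r.coeff i ≠ 0 → 1 ≤ i ∧ i ≤ n := by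
    intro i hi
    refine ⟨?_, ?_⟩
    · rw [Nat.one_le_iff_ne_zero]
      rintro rfl
      apply hi
      simp [hr, S.coeff_zero_star, S.coeff_zero]
    · by_contra! h
      apply hi
      rcases Nat.lt_or_ge (n + 1) i with h' | h'
      · have h2 := S.natDegree_star n
        have h3 := S.deg (n + 1)
        simp only [hr, coeff_sub, coeff_smul]
        rw [coeff_eq_zero_of_natDegree_lt (by omega), coeff_eq_zero_of_natDegree_lt (by omega),
          coeff_eq_zero_of_natDegree_lt (by omega)]
        simp
      · obtain rfl : i = n + 1 := by omega
        have h2 := S.natDegree_star n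
        have h3 := S.monic (n + 1)
        have h4 := S.monic n
        rw [Monic, leadingCoeff, S.deg] at h3 h4
        simp only [hr, coeff_sub, coeff_smul, coeff_X_mul, h3, h4]
        rw [coeff_eq_zero_of_natDegree_lt (by omega)]
        simp
  have h0 : ip μ r r = 0 := by
    have e1 : ip μ r (Φ (n + 1)) = 0 := S.ip_right fun i hi => by have := hc i hi; omega
    have e2 : ip μ r (X * Φ n) = 0 := S.ip_X_mul_right hc
    have e3 : ip μ r (star Φ n) = 0 := S.ip_star hc
    nth_rewrite 2 [hr]
    rw [ip_sub_right, ip_sub_right, ip_smul_right, e1, e2, e3]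
    simp
  rw [ip_self] at h0
  exact sub_eq_zero.1 (S.eq_zero_of_nsq (by exact_mod_cast h0))

lemma rec_star (S : System μ D₀ Φ α) (n : ℕ) :
    star Φ (n + 1) = star Φ n - α n • (X * Φ n) := by
  conv_lhs => rw [star, S.rec_left n, rev_sub, rev_smul, rev_succ_X_mul (S.deg n).le, star,
    rev_succ_rev (S.deg n).le, Complex.conj_conj]
  rfl

lemma ip_X_mul_star (S : System μ D₀ Φ α) (n : ℕ) :
    ip μ (X * Φ n) (star Φ n) = (starRingEnd ℂ) (α n) * nsq μ (Φ n) := by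
  have h0 : ip μ (Φ (n + 1)) (star Φ n) = 0 := by
    rw [← conj_ip, S.ip_right (n := n + 1), map_zero]
    intro i hi
    exact Nat.lt_succ_of_le ((le_natDegree_of_ne_zero hi).trans (S.natDegree_star n))
  rw [S.rec_left n, ip_sub_left, ip_smul_left, ip_self, S.nsq_star] at h0
  linear_combination h0

lemma ip_star_X_mul (S : System μ D₀ Φ α) (n : ℕ) :
    ip μ (star Φ n) (X * Φ n) = α n * nsq μ (Φ n) := by
  rw [← conj_ip, S.ip_X_mul_star]; simp

lemma nsq_succ (S : System μ D₀ Φ α) (n : ℕ) :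
    nsq μ (Φ (n + 1)) = nsq μ (Φ n) * (1 - ‖α n‖ ^ 2) := by
  have h0 : ip μ (star Φ n) (Φ (n + 1)) = 0 := by
    refine S.ip_right fun i hi => ?_
    exact Nat.lt_succ_of_le ((le_natDegree_of_ne_zero hi).trans (S.natDegree_star n))
  have h1 : ip μ (Φ (n + 1)) (Φ (n + 1)) = ip μ (X * Φ n) (Φ (n + 1)) := by
    nth_rewrite 1 [S.rec_left n]
    rw [ip_sub_left, ip_smul_left, h0]; simp
  have h4 : ip μ (X * Φ n) (Φ (n + 1)) =
      nsq μ (Φ n) - α n * ((starRingEnd ℂ) (α n) * nsq μ (Φ n)) := by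
    rw [S.rec_left n, ip_sub_right, ip_smul_right, ip_X_mul, ip_self,
      S.ip_X_mul_star, Complex.conj_conj]
  rw [h4, ip_self] at h1
  have h2 : α n * (starRingEnd ℂ) (α n) = ((‖α n‖ ^ 2 : ℝ) : ℂ) := by
    rw [Complex.mul_conj, Complex.normSq_eq_norm_sq]
  have h3 : ((nsq μ (Φ (n + 1)) : ℝ) : ℂ) = ((nsq μ (Φ n) * (1 - ‖α n‖ ^ 2) : ℝ) : ℂ) := by
    push_cast at h2 ⊢
    linear_combination h1 - (nsq μ (Φ n) : ℂ) * h2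
  exact_mod_cast h3

lemma le_nsq (S : System μ D₀ Φ α) (n : ℕ) : D₀ ^ 2 ≤ nsq μ (Φ n) := by
  have := S.low (star Φ n)
  rwa [S.coeff_zero_star, norm_one, one_pow, mul_one, S.nsq_star] at this

lemma nsq_pos (S : System μ D₀ Φ α) (n : ℕ) : 0 < nsq μ (Φ n) :=
  lt_of_lt_of_le (pow_pos S.pos 2) (S.le_nsq n)

lemma norm_alpha_lt_one (S : System μ D₀ Φ α) (n : ℕ) : ‖α n‖ < 1 := by
  have h1 := S.nsq_succ n
  have h2 := S.nsq_pos n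
  have h3 := S.nsq_pos (n + 1)
  rw [h1] at h3
  have h4 : 0 < 1 - ‖α n‖ ^ 2 := by
    by_contra! h
    nlinarith
  nlinarith [norm_nonneg (α n)]

lemma nsq_antitone (S : System μ D₀ Φ α) : Antitone fun n => nsq μ (Φ n) := by
  refine antitone_nat_of_succ_le fun n => ?_
  rw [S.nsq_succ n]
  have := (S.nsq_pos n).le
  nlinarith [sq_nonneg ‖α n‖]

lemma summable_sq (S : System μ D₀ Φ α) : Summable fun n => ‖α n‖ ^ 2 := by
  refine summable_of_sum_range_le (c := nsq μ (Φ 0) / D₀ ^ 2) (fun n => by positivity) fun n => ?_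
  have hD : 0 < D₀ ^ 2 := pow_pos S.pos 2
  rw [le_div_iff₀ hD]
  have key : ∀ n, (∑ i ∈ Finset.range n, ‖α i‖ ^ 2) * D₀ ^ 2 ≤ nsq μ (Φ 0) - nsq μ (Φ n) := by
    intro n
    induction n with
    | zero => simp
    | succ n ih =>
      rw [Finset.sum_range_succ, S.nsq_succ n]
      nlinarith [S.le_nsq n, sq_nonneg ‖α n‖]
  linarith [key n, S.nsq_pos n]

lemma tendsto_alpha (S : System μ D₀ Φ α) : Tendsto α atTop (nhds 0) := by
  have h := S.summable_sq.tendsto_atTop_zero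
  rw [tendsto_zero_iff_norm_tendsto_zero]
  have h2 := h.sqrt
  simpa [Real.sqrt_sq] using h2

/-- Every coefficient of a polynomial is controlled by its norm. -/
lemma exists_norm_coeff_sq_le (S : System μ D₀ Φ α) (i : ℕ) :
    ∃ K : ℝ, 0 ≤ K ∧ ∀ p : ℂ[X], ‖p.coeff i‖ ^ 2 ≤ K * nsq μ p := by
  have hD : 0 < D₀ ^ 2 := pow_pos S.pos 2
  have hlow : ∀ p : ℂ[X], ‖p.coeff 0‖ ^ 2 ≤ (D₀ ^ 2)⁻¹ * nsq μ p := by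
    intro p
    rw [inv_mul_eq_div, le_div_iff₀ hD, mul_comm]
    exact S.low p
  induction i with
  | zero => exact ⟨(D₀ ^ 2)⁻¹, by positivity, hlow⟩
  | succ i ih =>
    obtain ⟨K, hK, h⟩ := ih
    have hM : 0 ≤ nsq μ 1 := nsq_nonneg _ _
    refine ⟨K * (2 + 2 * nsq μ 1 * (D₀ ^ 2)⁻¹), by positivity, fun p => ?_⟩
    have h1 : ‖p.coeff (i + 1)‖ ^ 2 ≤ K * nsq μ p.divX := by
      simpa [coeff_divX] using h p.divX
    have h2 : nsq μ p.divX ≤ 2 * nsq μ p + 2 * (‖p.coeff 0‖ ^ 2 * nsq μ 1) := by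
      rw [← nsq_X_mul, nsq, nsq, nsq, ← integral_const_mul, ← integral_const_mul,
        ← integral_const_mul, ← integral_add]
      · refine integral_mono ?_ ?_ fun θ => ?_
        · exact (memLp_eval μ (X * p.divX)).integrable_norm_pow (by simp)
        · exact (((memLp_eval μ p).integrable_norm_pow (by simp)).const_mul 2).add
            ((((memLp_eval μ 1).integrable_norm_pow (by simp)).const_mul _).const_mul 2)
        · have h3 : eval (circ θ) (X * p.divX) = eval (circ θ) p - p.coeff 0 := by
            have h4 := congrArg (eval (circ θ)) (X_mul_divX_add p)
            rw [eval_add, eval_C] at h4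
            linear_combination h4
          simp only [h3, eval_one, norm_one, one_pow, mul_one]
          have h4 := norm_sub_le (eval (circ θ) p) (p.coeff 0)
          have h5 := sq_nonneg (‖eval (circ θ) p‖ - ‖p.coeff 0‖)
          have h6 := norm_nonneg (eval (circ θ) p - p.coeff 0)
          nlinarith
      · exact ((memLp_eval μ p).integrable_norm_pow (by simp)).const_mul 2
      · exact ((((memLp_eval μ 1).integrable_norm_pow (by simp)).const_mul _).const_mul 2)
    calc ‖p.coeff (i + 1)‖ ^ 2 ≤ K * nsq μ p.divX := h1
      _ ≤ K * (2 * nsq μ p + 2 * ((D₀ ^ 2)⁻¹ * nsq μ p * nsq μ 1)) := by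
        gcongr
        exact h2.trans (by gcongr; exact hlow p)
      _ = _ := by ring

lemma exists_coeff_star_bound (S : System μ D₀ Φ α) (i : ℕ) :
    ∃ K : ℝ, 0 ≤ K ∧ ∀ n, ‖(star Φ n).coeff i‖ ≤ K := by
  obtain ⟨K, hK, h⟩ := S.exists_norm_coeff_sq_le i
  refine ⟨√(K * nsq μ (Φ 0)), Real.sqrt_nonneg _, fun n => Real.le_sqrt_of_sq_le ?_⟩
  refine (h _).trans ?_
  rw [S.nsq_star]
  gcongr
  exact S.nsq_antitone (Nat.zero_le n)

/-- The reversed polynomials do not vanish on the circle. -/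
lemma eval_star_ne_zero (S : System μ D₀ Φ α) (n : ℕ) {z : ℂ} (hz : ‖z‖ = 1) :
    (star Φ n).eval z ≠ 0 := by
  induction n with
  | zero =>
    have h1 := S.natDegree_star 0
    rw [eq_C_of_natDegree_le_zero h1, S.coeff_zero_star]
    simp
  | succ n ih =>
    rw [S.rec_star n]
    have h1 : ‖(Φ n).eval z‖ = ‖(star Φ n).eval z‖ := by
      rw [star, eval_rev_of_norm_one (S.deg n).le hz]; simp [hz]
    have h2 := S.norm_alpha_lt_one n
    intro h
    have h3 : (star Φ n).eval z = α n * (z * (Φ n).eval z) := by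
      simp only [eval_sub, eval_smul, eval_mul, eval_X, smul_eq_mul] at h
      linear_combination h
    have h4 := congrArg norm h3
    rw [norm_mul, norm_mul, hz, one_mul, h1] at h4
    have h5 : 0 < ‖(star Φ n).eval z‖ := norm_pos_iff.2 ih
    nlinarith

end System

/-- Integration by parts against a measure on the circle whose density has logarithmic derivative
`l + ∑ k, β k * (z + a k) / (z - a k)` with respect to `z`, for functions vanishing at the `a k`. -/
structure PartsFormula {m : ℕ} (μ : Measure ℝ) (l : ℂ → ℂ) (a : Fin m → ℂ) (β : Fin m → ℝ) :
    Prop where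
  cont : ContinuousOn l (sphere 0 1)
  parts : ∀ (p₁ q₁ p₂ q₂ : ℂ[X]) (F : Fin m → ℂ → ℂ), (∀ k, Continuous (F k)) →
    (∀ k θ, p₁.eval (circ θ) * (starRingEnd ℂ) (q₁.eval (circ θ)) -
      p₂.eval (circ θ) * (starRingEnd ℂ) (q₂.eval (circ θ)) =
        (circ θ - a k) * F k (circ θ)) →
    ip μ (X * derivative p₁) q₁ - ip μ p₁ (X * derivative q₁) -
      (ip μ (X * derivative p₂) q₂ - ip μ p₂ (X * derivative q₂)) +
      ∫ θ, l (circ θ) * (p₁.eval (circ θ) * (starRingEnd ℂ) (q₁.eval (circ θ)) -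
        p₂.eval (circ θ) * (starRingEnd ℂ) (q₂.eval (circ θ))) ∂μ +
      ∑ k, (β k : ℂ) * ∫ θ, (circ θ + a k) * F k (circ θ) ∂μ = 0

/-- The pairing with an additional factor `l`. -/
noncomputable def ipw (μ : Measure ℝ) (l : ℂ → ℂ) (p q : ℂ[X]) : ℂ :=
  ∫ θ, l (circ θ) * (p.eval (circ θ) * (starRingEnd ℂ) (q.eval (circ θ))) ∂μ

lemma integrable_ipw {μ : Measure ℝ} [IsFiniteMeasure μ] {l : ℂ → ℂ}
    (hl : ContinuousOn l (sphere 0 1)) (p q : ℂ[X]) :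
    Integrable (fun θ => l (circ θ) * (p.eval (circ θ) * (starRingEnd ℂ) (q.eval (circ θ)))) μ :=
  integrable_comp_circ (F := fun z => l z * (p.eval z * (starRingEnd ℂ) (q.eval z)))
    (hl.mul (by fun_prop)) μ

lemma coeff_X_mul_derivative (p : ℂ[X]) (i : ℕ) :
    (X * derivative p).coeff i = i * p.coeff i := by
  cases i with
  | zero => simp
  | succ i => rw [coeff_X_mul, coeff_derivative]; push_cast; ring

namespace System

variable {μ : Measure ℝ} [IsFiniteMeasure μ] {D₀ : ℝ} {Φ : ℕ → ℂ[X]} {α : ℕ → ℂ}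

lemma coeff_X_mul_derivative_star (S : System μ D₀ Φ α) {n i : ℕ}
    (h : (X * derivative (star Φ n)).coeff i ≠ 0) : 1 ≤ i ∧ i ≤ n := by
  rw [coeff_X_mul_derivative] at h
  refine ⟨Nat.one_le_iff_ne_zero.2 (by rintro rfl; simp at h), ?_⟩
  by_contra! h2
  rw [coeff_eq_zero_of_natDegree_lt ((S.natDegree_star n).trans_lt h2)] at h
  simp at h

lemma ip_star_X_mul_derivative (S : System μ D₀ Φ α) (n : ℕ) :
    ip μ (star Φ n) (X * derivative (X * Φ n)) = (n + 1) * (α n * nsq μ (Φ n)) := by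
  have h1 : ip μ (X * derivative (X * Φ n) - ((n : ℂ) + 1) • (X * Φ n)) (star Φ n) = 0 := by
    refine S.ip_star fun i hi => ?_
    rw [coeff_sub, coeff_X_mul_derivative, coeff_smul, smul_eq_mul, ← sub_mul] at hi
    have h2 := left_ne_zero_of_mul hi
    have h3 := right_ne_zero_of_mul hi
    have h4 : i ≠ n + 1 := by rintro rfl; simp at h2
    have h5 := le_natDegree_of_ne_zero h3
    rw [natDegree_X_mul (S.monic n).ne_zero, S.deg] at h5
    refine ⟨Nat.one_le_iff_ne_zero.2 ?_, by omega⟩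
    rintro rfl
    simp at h3
  have h2 := congrArg (starRingEnd ℂ) h1
  rw [conj_ip, ip_sub_right, ip_smul_right, S.ip_star_X_mul, map_zero] at h2
  simp only [map_add, Complex.conj_natCast, map_one] at h2
  linear_combination h2

lemma ip_star_mul_divided (S : System μ D₀ Φ α) {n : ℕ} {a c : ℂ} {V : ℂ[X]}
    (hV : X * Φ n = c • star Φ n + (X - C a) * V) :
    ip μ (star Φ n) ((X + C a) * V) = (α n + (starRingEnd ℂ) c) * nsq μ (Φ n) := by
  have hdeg : V.natDegree ≤ n := by
    by_cases hV0 : V = 0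
    · simp [hV0]
    have h1 : ((X - C a) * V).natDegree ≤ n + 1 := by
      have : (X - C a) * V = X * Φ n - c • star Φ n := by rw [hV]; ring
      rw [this]
      refine (natDegree_sub_le _ _).trans (max_le ?_ ?_)
      · rw [natDegree_X_mul (S.monic n).ne_zero, S.deg]
      · exact (natDegree_smul_le _ _).trans ((S.natDegree_star n).trans (Nat.le_succ n))
    rw [natDegree_mul (X_sub_C_ne_zero a) hV0, natDegree_X_sub_C] at h1
    omega
  have h0 : a * V.coeff 0 = c := by
    have := congrArg (fun p => p.coeff 0) hV
    simp [sub_mul, S.coeff_zero_star] at this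
    linear_combination this
  have h1 : (X + C a) * V = X * Φ n - c • star Φ n + (2 * a) • V := by
    rw [hV, smul_eq_C_mul (2 * a), C_mul, show (C 2 : ℂ[X]) = 2 from rfl]; ring
  have h2 : ip μ (star Φ n) V = (starRingEnd ℂ) (V.coeff 0) * nsq μ (Φ n) := by
    rw [← conj_ip, S.ip_star_of_natDegree_le hdeg]; simp
  rw [h1, ip_add_right, ip_sub_right, ip_smul_right, ip_smul_right, S.ip_star_X_mul, ip_self,
    S.nsq_star, h2, ← h0]
  simp only [map_mul, Complex.conj_ofNat]
  ring

/-- The phase attached to the point `a` of the circle. -/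
noncomputable def phase (Φ : ℕ → ℂ[X]) (a : ℂ) (n : ℕ) : ℂ :=
  (a ^ (n + 1))⁻¹ * ((star Φ n).eval a / (starRingEnd ℂ) ((star Φ n).eval a))

lemma norm_phase (S : System μ D₀ Φ α) {a : ℂ} (ha : ‖a‖ = 1) (n : ℕ) : ‖phase Φ a n‖ = 1 := by
  have h := S.eval_star_ne_zero n ha
  simp [phase, ha, div_self (norm_ne_zero_iff.2 h)]

lemma eval_X_mul (S : System μ D₀ Φ α) {a : ℂ} (ha : ‖a‖ = 1) (n : ℕ) :
    (X * Φ n).eval a = (starRingEnd ℂ) (phase Φ a n) * (star Φ n).eval a := by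
  have h := S.eval_star_ne_zero n ha
  have h2 := (map_ne_zero (starRingEnd ℂ)).2 h
  have h3 : (starRingEnd ℂ) a = a⁻¹ := (Complex.inv_eq_conj ha).symm
  have ha0 : a ≠ 0 := by rintro rfl; simp at ha
  have h4 : (starRingEnd ℂ) ((star Φ n).eval a) = a⁻¹ ^ n * (Φ n).eval a := by
    rw [star, eval_rev_of_norm_one (S.deg n).le ha]
    simp [h3]
  simp only [phase, map_mul, map_inv₀, map_pow, h3, map_div₀, Complex.conj_conj, eval_mul, eval_X]
  rw [h4, inv_pow, inv_pow, inv_inv, pow_succ]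
  field_simp

/-- The differential identity satisfied by the Verblunsky coefficients. -/
lemma alpha_identity (S : System μ D₀ Φ α) {m : ℕ} {l : ℂ → ℂ} {a : Fin m → ℂ} {β : Fin m → ℝ}
    (hP : PartsFormula μ l a β) (ha : ∀ k, ‖a k‖ = 1) (n : ℕ) (Λ : ℂ[X]) (Λ' : Fin m → ℂ[X])
    (hΛ : ∀ k, Λ = C (phase Φ (a k) n) + (X - C (a k)) * Λ' k) :
    (n + 1 + ∑ k, (β k : ℂ)) * α n * nsq μ (Φ n) +
      (∑ k, (β k : ℂ) * phase Φ (a k) n) * nsq μ (Φ n) =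
    ipw μ l (star Φ n) (X * Φ n) -
      (ip μ (X * derivative (Λ * star Φ n)) (star Φ n) -
        ip μ (Λ * star Φ n) (X * derivative (star Φ n)) +
        ipw μ l (Λ * star Φ n) (star Φ n) +
        ∑ k, (β k : ℂ) * ip μ ((X + C (a k)) * Λ' k * star Φ n) (star Φ n)) := by
  have hVex : ∀ k, ∃ V : ℂ[X], X * Φ n =
      (starRingEnd ℂ) (phase Φ (a k) n) • star Φ n + (X - C (a k)) * V := by
    intro k
    have h1 : (X * Φ n - (starRingEnd ℂ) (phase Φ (a k) n) • star Φ n).IsRoot (a k) := by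
      rw [IsRoot, eval_sub, S.eval_X_mul (ha k), eval_smul, smul_eq_mul, sub_self]
    obtain ⟨V, hV⟩ := dvd_iff_isRoot.2 h1
    exact ⟨V, by rw [← hV]; ring⟩
  choose V hV using hVex
  have hconj : ∀ k θ, (starRingEnd ℂ) (circ θ - a k) =
      -((circ θ - a k) * ((starRingEnd ℂ) (circ θ) * (starRingEnd ℂ) (a k))) := by
    intro k θ
    have h1 : a k * (starRingEnd ℂ) (a k) = 1 := by
      rw [Complex.mul_conj, Complex.normSq_eq_norm_sq, ha k]; simp
    have h2 := circ_mul_conj θ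
    rw [map_sub]
    linear_combination (-(starRingEnd ℂ) (circ θ)) * h1 + (starRingEnd ℂ) (a k) * h2
  have h := hP.parts (star Φ n) (X * Φ n) (Λ * star Φ n) (star Φ n)
    (fun k z => (star Φ n).eval z * (-((starRingEnd ℂ) z * (starRingEnd ℂ) (a k) *
      (starRingEnd ℂ) ((V k).eval z)) - (Λ' k).eval z * (starRingEnd ℂ) ((star Φ n).eval z)))
    (fun k => by fun_prop) (fun k θ => by
      have e1 := congrArg (eval (circ θ)) (hΛ k)
      have e2 := congrArg (fun p => (starRingEnd ℂ) (eval (circ θ) p)) (hV k)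
      simp only [eval_add, eval_mul, eval_sub, eval_C, eval_X, eval_smul, smul_eq_mul, map_add,
        map_mul, Complex.conj_conj, hconj] at e1 e2
      simp only [eval_mul, eval_X, map_mul]
      rw [e1]
      linear_combination ((star Φ n).eval (circ θ)) * e2)
  have hF : ∀ k, ∫ θ, (circ θ + a k) * ((star Φ n).eval (circ θ) *
      (-((starRingEnd ℂ) (circ θ) * (starRingEnd ℂ) (a k) *
      (starRingEnd ℂ) ((V k).eval (circ θ))) -
        (Λ' k).eval (circ θ) * (starRingEnd ℂ) ((star Φ n).eval (circ θ)))) ∂μ =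
      -ip μ (star Φ n) ((X + C (a k)) * V k) -
        ip μ ((X + C (a k)) * Λ' k * star Φ n) (star Φ n) := by
    intro k
    unfold ip
    rw [← integral_neg, ← integral_sub]
    · congr 1
      ext θ
      have h1 : a k * (starRingEnd ℂ) (a k) = 1 := by
        rw [Complex.mul_conj, Complex.normSq_eq_norm_sq, ha k]; simp
      have h2 := circ_mul_conj θ
      simp only [eval_mul, eval_add, eval_X, eval_C, map_mul, map_add]
      linear_combination (-(star Φ n).eval (circ θ) * (starRingEnd ℂ) ((V k).eval (circ θ))) *
        ((starRingEnd ℂ) (a k) * h2 + (starRingEnd ℂ) (circ θ) * h1)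
    · exact (integrable_eval_mul_conj _ _ _).neg
    · exact integrable_eval_mul_conj _ _ _
  have hl : ∫ θ, l (circ θ) * ((star Φ n).eval (circ θ) *
      (starRingEnd ℂ) ((X * Φ n).eval (circ θ)) - (Λ * star Φ n).eval (circ θ) *
        (starRingEnd ℂ) ((star Φ n).eval (circ θ))) ∂μ =
      ipw μ l (star Φ n) (X * Φ n) - ipw μ l (Λ * star Φ n) (star Φ n) := by
    unfold ipw
    rw [← integral_sub (integrable_ipw hP.cont _ _) (integrable_ipw hP.cont _ _)]
    simp only [mul_sub]
  have e3 : ip μ (X * derivative (star Φ n)) (X * Φ n) = 0 :=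
    S.ip_X_mul_right fun i hi => S.coeff_X_mul_derivative_star hi
  simp only [hF] at h
  rw [hl, e3, S.ip_star_X_mul_derivative] at h
  simp only [S.ip_star_mul_divided (hV _), Complex.conj_conj] at h
  have e4 : ∑ k, (β k : ℂ) * (-((α n + phase Φ (a k) n) * (nsq μ (Φ n) : ℂ)) -
      ip μ ((X + C (a k)) * Λ' k * star Φ n) (star Φ n)) =
      -(∑ k, (β k : ℂ)) * (α n * nsq μ (Φ n)) - (∑ k, (β k : ℂ) * phase Φ (a k) n) * nsq μ (Φ n) -
      ∑ k, (β k : ℂ) * ip μ ((X + C (a k)) * Λ' k * star Φ n) (star Φ n) := by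
    rw [Finset.sum_mul, neg_mul, Finset.sum_mul, ← Finset.sum_neg_distrib,
      ← Finset.sum_sub_distrib, ← Finset.sum_sub_distrib]
    refine Finset.sum_congr rfl fun k _ => ?_
    ring
  rw [e4] at h
  linear_combination -h

end System

namespace System

variable {μ : Measure ℝ} [IsFiniteMeasure μ] {D₀ : ℝ} {Φ : ℕ → ℂ[X]} {α : ℕ → ℂ}

lemma star_eq_add_sum (S : System μ D₀ Φ α) (n j : ℕ) :
    star Φ n = star Φ (n + j) + ∑ i ∈ Finset.range j, α (n + i) • (X * Φ (n + i)) := by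
  induction j with
  | zero => simp
  | succ j ih =>
    rw [Finset.sum_range_succ, ← add_assoc n j 1, S.rec_star (n + j), ih]
    ring

lemma nsq_le (S : System μ D₀ Φ α) (n : ℕ) : nsq μ (Φ n) ≤ nsq μ (Φ 0) :=
  S.nsq_antitone (Nat.zero_le n)

lemma nsq_star_le (S : System μ D₀ Φ α) (n : ℕ) : nsq μ (star Φ n) ≤ nsq μ (Φ 0) := by
  rw [S.nsq_star]; exact S.nsq_le n

lemma zero_eq_one (S : System μ D₀ Φ α) : Φ 0 = 1 :=
  (S.monic 0).natDegree_eq_zero.1 (S.deg 0)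

/-- Pairings with `X ^ j * star Φ n` are small. -/
lemma norm_ip_X_pow_mul_star (S : System μ D₀ Φ α) {n j : ℕ} (h1 : 1 ≤ j) (hj : j ≤ n) {q : ℂ[X]}
    (hq : nsq μ q ≤ nsq μ (Φ 0))
    (ho : ∀ p : ℂ[X], (∀ i, p.coeff i ≠ 0 → 1 ≤ i ∧ i ≤ n) → ip μ p q = 0) :
    ‖ip μ (X ^ j * star Φ n) q‖ ≤ nsq μ (Φ 0) * ∑ i ∈ Finset.range j, ‖α (n - j + i)‖ := by
  have h2 := S.star_eq_add_sum (n - j) j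
  rw [Nat.sub_add_cancel hj] at h2
  have h3 : X ^ j * star Φ n = X ^ j * star Φ (n - j) -
      ∑ i ∈ Finset.range j, α (n - j + i) • (X ^ j * (X * Φ (n - j + i))) := by
    rw [h2, mul_add, Finset.mul_sum]
    simp only [mul_smul_comm]
    ring
  have h4 : ip μ (X ^ j * star Φ (n - j)) q = 0 := by
    refine ho _ fun i hi => ?_
    rw [coeff_X_pow_mul'] at hi
    split_ifs at hi with hij
    · have := (le_natDegree_of_ne_zero hi).trans (S.natDegree_star (n - j))
      omega
    · simp at hi
  rw [h3, ip_sub_left, h4, zero_sub, norm_neg, ip_sum_left, Finset.mul_sum]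
  refine (norm_sum_le _ _).trans (Finset.sum_le_sum fun i _ => ?_)
  rw [ip_smul_left, norm_mul, mul_comm]
  gcongr
  exact norm_ip_le μ (nsq_nonneg _ _)
    (by rw [nsq_X_pow_mul, nsq_X_mul]; exact S.nsq_le _) hq

/-- Pairings of `star Φ n` with polynomials of degree larger than `n` are small. -/
lemma norm_ip_star_le (S : System μ D₀ Φ α) {n j : ℕ} {p : ℂ[X]} (hp : nsq μ p ≤ nsq μ (Φ 0))
    (hc : ∀ i, p.coeff i ≠ 0 → 1 ≤ i ∧ i ≤ n + j) :
    ‖ip μ p (star Φ n)‖ ≤ nsq μ (Φ 0) * ∑ i ∈ Finset.range j, ‖α (n + i)‖ := by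
  rw [S.star_eq_add_sum n j, ip_add_right, S.ip_star hc, zero_add, ip_sum_right, Finset.mul_sum]
  refine (norm_sum_le _ _).trans (Finset.sum_le_sum fun i _ => ?_)
  rw [ip_smul_right, norm_mul, mul_comm, RCLike.norm_conj]
  gcongr
  exact norm_ip_le μ (nsq_nonneg _ _) hp (by rw [nsq_X_mul]; exact S.nsq_le _)

lemma norm_ip_X_pow_star_le (S : System μ D₀ Φ α) {n j : ℕ} (hn : 1 ≤ n) :
    ‖ip μ (X ^ (n + j)) (star Φ n)‖ ≤ nsq μ (Φ 0) * ∑ i ∈ Finset.range j, ‖α (n + i)‖ := by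
  refine S.norm_ip_star_le ?_ fun i hi => ?_
  · have := nsq_X_pow_mul μ (n + j) 1
    rw [mul_one] at this
    rw [this, S.zero_eq_one]
  · rw [coeff_X_pow] at hi
    have : i = n + j := by by_contra h; simp [h] at hi
    omega

lemma norm_ip_X_pow_mul_le (S : System μ D₀ Φ α) {n j : ℕ} :
    ‖ip μ (X ^ j * (X * Φ n)) (star Φ n)‖ ≤
      nsq μ (Φ 0) * ∑ i ∈ Finset.range (j + 1), ‖α (n + i)‖ := by
  refine S.norm_ip_star_le ?_ fun i hi => ?_
  · rw [nsq_X_pow_mul, nsq_X_mul]; exact S.nsq_le _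
  · rw [← mul_assoc, ← pow_succ, coeff_X_pow_mul'] at hi
    split_ifs at hi with hij
    · have := le_natDegree_of_ne_zero hi
      rw [S.deg] at this
      omega
    · simp at hi

/-- The low order coefficients of `Φ n` are small. -/
lemma norm_coeff_le (S : System μ D₀ Φ α) {K : ℝ} {m : ℕ}
    (hK : ∀ n, ∀ i ≤ m, ‖(star Φ n).coeff i‖ ≤ K) {r n : ℕ} (hr : r ≤ m) (hn : r < n) :
    ‖(Φ n).coeff r‖ ≤ K * ∑ j ∈ Finset.range (r + 1), ‖α (n - 1 - j)‖ := by
  induction r generalizing n with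
  | zero =>
    obtain ⟨n, rfl⟩ := Nat.exists_eq_add_of_le' hn
    rw [S.rec_left]
    have := S.coeff_zero_star n
    have h2 := hK n 0 (Nat.zero_le _)
    simp [this] at h2 ⊢
    nlinarith [norm_nonneg (α n)]
  | succ r ih =>
    obtain ⟨n, rfl⟩ := Nat.exists_eq_add_of_le' (show 1 ≤ n by omega)
    rw [S.rec_left, coeff_sub, coeff_X_mul, coeff_smul, smul_eq_mul, Finset.sum_range_succ']
    refine (norm_sub_le _ _).trans ?_
    have h1 := ih (n := n) (by omega) (by omega)
    have h2 := hK n (r + 1) hr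
    have h3 : ∀ j ∈ Finset.range (r + 1), ‖α (n + 1 - 1 - (j + 1))‖ = ‖α (n - 1 - j)‖ := by
      intro j _
      congr 2
      omega
    rw [Finset.sum_congr rfl h3, norm_mul, RCLike.norm_conj]
    simp only [Nat.add_sub_cancel, Nat.sub_zero]
    nlinarith [norm_nonneg (α n)]

lemma norm_ip_X_pow_mul_one (S : System μ D₀ Φ α) {t n : ℕ} (hn : 1 ≤ n) :
    ‖ip μ (X ^ t * Φ n) 1‖ ≤ nsq μ (Φ 0) * ∑ i ∈ Finset.range t, ‖α (n + i)‖ := by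
  induction t generalizing n with
  | zero =>
    have := S.orth n 0 (by omega)
    simpa using this
  | succ t ih =>
    have h1 : X ^ (t + 1) * Φ n = X ^ t * Φ (n + 1) +
        (starRingEnd ℂ) (α n) • (X ^ t * star Φ n) := by
      rw [S.rec_left n, pow_succ, mul_sub, mul_smul_comm]
      ring
    rw [h1, ip_add_left, ip_smul_left, Finset.sum_range_succ']
    refine (norm_add_le _ _).trans ?_
    rw [norm_mul, RCLike.norm_conj, mul_add, mul_comm ‖α n‖]
    have h2 := ih (n := n + 1) (by omega)
    have h3 : ∀ i ∈ Finset.range t, ‖α (n + 1 + i)‖ = ‖α (n + (i + 1))‖ := by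
      intro i _; congr 2; omega
    rw [Finset.sum_congr rfl h3] at h2
    refine add_le_add h2 ?_
    rw [add_zero]
    gcongr
    refine norm_ip_le μ (nsq_nonneg _ _) ?_ ?_
    · rw [nsq_X_pow_mul]; exact S.nsq_star_le n
    · rw [S.zero_eq_one]

end System

/-- The contribution of the monomial `X ^ s` to the correction term in the differential identity. -/
noncomputable def corr {m : ℕ} (μ : Measure ℝ) (Φ : ℕ → ℂ[X]) (l : ℂ → ℂ) (a : Fin m → ℂ)
    (β : Fin m → ℝ) (n s : ℕ) : ℂ :=
  ip μ (X * derivative (X ^ s * star Φ n)) (star Φ n) -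
    ip μ (X ^ s * star Φ n) (X * derivative (star Φ n)) +
    ipw μ l (X ^ s * star Φ n) (star Φ n) +
    ∑ k, (β k : ℂ) * ip μ ((X + C (a k)) *
      (∑ i ∈ Finset.range s, X ^ i * C (a k) ^ (s - 1 - i)) * star Φ n) (star Φ n)

/-- The sum of the sizes of the coefficients with index at distance at most `M` from `n`. -/
noncomputable def win (α : ℕ → ℂ) (M n : ℕ) : ℝ := ∑ N ∈ Finset.Icc (n - M) (n + M), ‖α N‖

lemma win_nonneg (α : ℕ → ℂ) (M n : ℕ) : 0 ≤ win α M n := Finset.sum_nonneg fun _ _ => norm_nonneg _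

lemma norm_le_win {α : ℕ → ℂ} {M n N : ℕ} (h1 : n ≤ N + M) (h2 : N ≤ n + M) :
    ‖α N‖ ≤ win α M n :=
  Finset.single_le_sum (f := fun N => ‖α N‖) (fun _ _ => norm_nonneg _)
    (Finset.mem_Icc.2 ⟨by omega, h2⟩)

lemma sum_norm_le_win {α : ℕ → ℂ} {M n j : ℕ} {f : ℕ → ℕ}
    (h : ∀ i < j, n ≤ f i + M ∧ f i ≤ n + M) :
    ∑ i ∈ Finset.range j, ‖α (f i)‖ ≤ j * win α M n := by
  refine (Finset.sum_le_card_nsmul _ _ (win α M n) fun i hi => ?_).trans_eq (by simp)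
  have := h i (Finset.mem_range.1 hi)
  exact norm_le_win this.1 this.2

lemma norm_ipw_le {μ : Measure ℝ} [IsFiniteMeasure μ] {l : ℂ → ℂ} {L A : ℝ} (hL0 : 0 ≤ L)
    (hL : ∀ θ, ‖l (circ θ)‖ ≤ L) {p q : ℂ[X]} (hp : nsq μ p ≤ A) (hq : nsq μ q ≤ A) :
    ‖ipw μ l p q‖ ≤ L * A := by
  have h_int : ∀ p : ℂ[X], Integrable (fun θ => ‖p.eval (circ θ)‖ ^ 2) μ := fun p =>
    (memLp_eval μ p).integrable_norm_pow (by simp)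
  have h1 : ‖ipw μ l p q‖ ≤
      ∫ θ, L / 2 * (‖p.eval (circ θ)‖ ^ 2 + ‖q.eval (circ θ)‖ ^ 2) ∂μ := by
    refine norm_integral_le_of_norm_le (((h_int p).add (h_int q)).const_mul _) (ae_of_all _ fun θ => ?_)
    rw [norm_mul, norm_mul, RCLike.norm_conj]
    have h2 := hL θ
    have h3 : ‖p.eval (circ θ)‖ * ‖q.eval (circ θ)‖ ≤
        1 / 2 * (‖p.eval (circ θ)‖ ^ 2 + ‖q.eval (circ θ)‖ ^ 2) := by
      nlinarith [sq_nonneg (‖p.eval (circ θ)‖ - ‖q.eval (circ θ)‖)]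
    calc _ ≤ L * (1 / 2 * (‖p.eval (circ θ)‖ ^ 2 + ‖q.eval (circ θ)‖ ^ 2)) := by gcongr
      _ = _ := by ring
  rw [integral_const_mul, integral_add (h_int p) (h_int q)] at h1
  unfold nsq at hp hq
  nlinarith

namespace System

variable {μ : Measure ℝ} [IsFiniteMeasure μ] {D₀ : ℝ} {Φ : ℕ → ℂ[X]} {α : ℕ → ℂ}

lemma alpha_identity_sum (S : System μ D₀ Φ α) {m : ℕ} {l : ℂ → ℂ} {a : Fin m → ℂ}
    {β : Fin m → ℝ} (hP : PartsFormula μ l a β) (ha : ∀ k, ‖a k‖ = 1) (n : ℕ) (M : ℕ) (c : ℕ → ℂ)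
    (hΛ : ∀ k, ∑ s ∈ Finset.range M, c s * a k ^ s = phase Φ (a k) n) :
    (n + 1 + ∑ k, (β k : ℂ)) * α n * nsq μ (Φ n) +
      (∑ k, (β k : ℂ) * phase Φ (a k) n) * nsq μ (Φ n) =
    ipw μ l (star Φ n) (X * Φ n) - ∑ s ∈ Finset.range M, c s * corr μ Φ l a β n s := by
  rw [S.alpha_identity hP ha n (∑ s ∈ Finset.range M, c s • X ^ s)
    (fun k => ∑ s ∈ Finset.range M, c s • ∑ i ∈ Finset.range s, X ^ i * C (a k) ^ (s - 1 - i))]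
  · congr 1
    have e1 : ip μ (X * derivative ((∑ s ∈ Finset.range M, c s • X ^ s) * star Φ n)) (star Φ n) =
        ∑ s ∈ Finset.range M, c s * ip μ (X * derivative (X ^ s * star Φ n)) (star Φ n) := by
      simp only [Finset.sum_mul, derivative_sum, Finset.mul_sum, ip_sum_left, smul_mul_assoc,
        derivative_smul, mul_smul_comm, ip_smul_left]
    have e2 : ip μ ((∑ s ∈ Finset.range M, c s • X ^ s) * star Φ n) (X * derivative (star Φ n)) =
        ∑ s ∈ Finset.range M, c s * ip μ (X ^ s * star Φ n) (X * derivative (star Φ n)) := by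
      simp only [Finset.sum_mul, ip_sum_left, smul_mul_assoc, ip_smul_left]
    have e3 : ipw μ l ((∑ s ∈ Finset.range M, c s • X ^ s) * star Φ n) (star Φ n) =
        ∑ s ∈ Finset.range M, c s * ipw μ l (X ^ s * star Φ n) (star Φ n) := by
      unfold ipw
      simp only [← integral_const_mul]
      rw [← integral_finsetSum _ fun s _ => (integrable_ipw hP.cont _ _).const_mul _]
      congr 1
      ext θ
      simp only [Finset.sum_mul, eval_finsetSum, Finset.mul_sum, smul_mul_assoc, eval_smul,
        smul_eq_mul]
      exact Finset.sum_congr rfl fun s _ => by ring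
    have e4 : ∀ k, ip μ ((X + C (a k)) * (∑ s ∈ Finset.range M, c s •
        ∑ i ∈ Finset.range s, X ^ i * C (a k) ^ (s - 1 - i)) * star Φ n) (star Φ n) =
        ∑ s ∈ Finset.range M, c s * ip μ ((X + C (a k)) *
          (∑ i ∈ Finset.range s, X ^ i * C (a k) ^ (s - 1 - i)) * star Φ n) (star Φ n) := by
      intro k
      rw [Finset.mul_sum, Finset.sum_mul, ip_sum_left]
      simp only [mul_smul_comm, smul_mul_assoc, ip_smul_left]
    rw [e1, e2, e3]
    simp only [e4]
    have e5 : ∀ f : ℕ → Fin m → ℂ, ∑ k, (β k : ℂ) * ∑ s ∈ Finset.range M, c s * f s k =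
        ∑ s ∈ Finset.range M, c s * ∑ k, (β k : ℂ) * f s k := by
      intro f
      simp only [Finset.mul_sum]
      rw [Finset.sum_comm]
      exact Finset.sum_congr rfl fun s _ => Finset.sum_congr rfl fun k _ => by ring
    rw [e5 fun s k => ip μ ((X + C (a k)) *
          (∑ i ∈ Finset.range s, X ^ i * C (a k) ^ (s - 1 - i)) * star Φ n) (star Φ n),
      ← Finset.sum_sub_distrib, ← Finset.sum_add_distrib, ← Finset.sum_add_distrib]
    exact Finset.sum_congr rfl fun s _ => by rw [corr]; ring
  · intro k
    rw [← hΛ k, map_sum, Finset.mul_sum, ← Finset.sum_add_distrib]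
    refine Finset.sum_congr rfl fun s _ => ?_
    have h := (Commute.all (X : ℂ[X]) (C (a k))).geom_sum₂_mul s
    rw [mul_smul_comm, mul_comm (X - C (a k)), h, smul_eq_C_mul, smul_eq_C_mul, C_mul, C_pow]
    ring

lemma corr_eq {m : ℕ} {l : ℂ → ℂ} {a : Fin m → ℂ} {β : Fin m → ℝ}
    (n s : ℕ) :
    corr μ Φ l a β n s = s * ip μ (X ^ s * star Φ n) (star Φ n) +
      ip μ (X ^ s * (X * derivative (star Φ n))) (star Φ n) -
      ip μ (X ^ s * star Φ n) (X * derivative (star Φ n)) +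
      ipw μ l (X ^ s * star Φ n) (star Φ n) +
      ∑ k, (β k : ℂ) * ∑ i ∈ Finset.range s, (a k ^ (s - 1 - i) *
        ip μ (X ^ (i + 1) * star Φ n) (star Φ n) +
        a k ^ (s - i) * ip μ (X ^ i * star Φ n) (star Φ n)) := by
  unfold corr
  have e1 : X * derivative (X ^ s * star Φ n) = (s : ℂ) • (X ^ s * star Φ n) +
      X ^ s * (X * derivative (star Φ n)) := by
    rw [derivative_mul, derivative_X_pow, mul_add, smul_eq_C_mul]
    cases s with
    | zero => simp
    | succ s => simp only [Nat.add_sub_cancel, pow_succ]; ring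
  have e2 : ∀ k, ip μ ((X + C (a k)) *
      (∑ i ∈ Finset.range s, X ^ i * C (a k) ^ (s - 1 - i)) * star Φ n) (star Φ n) =
      ∑ i ∈ Finset.range s, (a k ^ (s - 1 - i) *
        ip μ (X ^ (i + 1) * star Φ n) (star Φ n) +
        a k ^ (s - i) * ip μ (X ^ i * star Φ n) (star Φ n)) := by
    intro k
    rw [Finset.mul_sum, Finset.sum_mul, ip_sum_left]
    refine Finset.sum_congr rfl fun i hi => ?_
    rw [← ip_smul_left, ← ip_smul_left, ← ip_add_left]
    congr 1
    have : s - i = (s - 1 - i) + 1 := by have := Finset.mem_range.1 hi; omega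
    rw [smul_eq_C_mul, smul_eq_C_mul, this, C_pow, C_pow]
    ring
  rw [e1, ip_add_left, ip_smul_left]
  simp only [e2]

lemma X_mul_derivative_star (S : System μ D₀ Φ α) {n N : ℕ} (h : n < N) :
    X * derivative (star Φ n) =
      ∑ i ∈ Finset.range N, ((i : ℂ) * (star Φ n).coeff i) • X ^ i := by
  have h1 : (X * derivative (star Φ n)).natDegree < N := by
    refine lt_of_le_of_lt (natDegree_le_iff_coeff_eq_zero.2 fun i hi => ?_) h
    by_contra h
    have := S.coeff_X_mul_derivative_star h
    omega
  refine (as_sum_range_C_mul_X_pow' _ h1).trans (Finset.sum_congr rfl fun i _ => ?_)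
  rw [coeff_X_mul_derivative, smul_eq_C_mul]

/-- High degree part of the correction term. -/
lemma exists_norm_ip_derivative_le (S : System μ D₀ Φ α) (M : ℕ) :
    ∃ K : ℝ, 0 ≤ K ∧ ∀ n, M < n → ∀ s ≤ M,
      ‖ip μ (X ^ s * (X * derivative (star Φ n))) (star Φ n)‖ ≤ K * n * win α (M + 1) n ^ 2 := by
  choose K hK0 hK using S.exists_coeff_star_bound
  set K' := ∑ i ∈ Finset.range (M + 1), K i with hK'
  have hK'' : ∀ n, ∀ i ≤ M, ‖(star Φ n).coeff i‖ ≤ K' := fun n i hi =>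
    (hK i n).trans (Finset.single_le_sum (f := K) (fun j _ => hK0 j)
      (Finset.mem_range.2 (Nat.lt_succ_of_le hi)))
  have hK'0 : 0 ≤ K' := Finset.sum_nonneg fun i _ => hK0 i
  have hh := nsq_nonneg μ (Φ 0)
  refine ⟨(M + 1) * ((K' * (M + 1)) * (nsq μ (Φ 0) * (M + 1))), by positivity,
    fun n hn s hs => ?_⟩
  have e1 : X ^ s * (X * derivative (star Φ n)) =
      ∑ i ∈ Finset.range (n + 1), ((i : ℂ) * (star Φ n).coeff i) • X ^ (s + i) := by
    rw [S.X_mul_derivative_star n.lt_succ_self, Finset.mul_sum]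
    exact Finset.sum_congr rfl fun i _ => by rw [mul_smul_comm, pow_add]
  rw [e1, ip_sum_left, ← Finset.sum_range_reflect]
  have e2 : ∀ r ∈ Finset.range (n + 1), r ∉ Finset.range (M + 1) →
      ip μ ((((n + 1 - 1 - r : ℕ) : ℂ) * (star Φ n).coeff (n + 1 - 1 - r)) • X ^ (s + (n + 1 - 1 - r)))
        (star Φ n) = 0 := by
    intro r hr hr'
    rw [Finset.mem_range] at hr hr'
    rw [ip_smul_left]
    rcases Nat.eq_zero_or_pos (n + 1 - 1 - r) with h0 | h0
    · rw [h0]; simp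
    · rw [S.ip_X_pow_star (by omega) (by omega), mul_zero]
  rw [← Finset.sum_subset (Finset.range_mono (by omega)) e2]
  refine (norm_sum_le _ _).trans ((Finset.sum_le_card_nsmul _ _
    (n * ((K' * (M + 1)) * (nsq μ (Φ 0) * (M + 1)) * win α (M + 1) n ^ 2)) fun r hr => ?_).trans_eq ?_)
  · have hr' : r ≤ M := Nat.lt_succ_iff.1 (Finset.mem_range.1 hr)
    have hw := win_nonneg α (M + 1) n
    have h1 : ‖(star Φ n).coeff (n + 1 - 1 - r)‖ ≤ K' * (M + 1) * win α (M + 1) n := by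
      rw [Nat.add_sub_cancel, star, coeff_rev (Nat.sub_le _ _), Nat.sub_sub_self (by omega),
        RCLike.norm_conj]
      refine (S.norm_coeff_le hK'' hr' (by omega)).trans ?_
      rw [mul_assoc]
      gcongr
      refine (sum_norm_le_win (M := M + 1) (n := n) fun i hi => ⟨by omega, by omega⟩).trans ?_
      gcongr
      exact_mod_cast Nat.succ_le_succ hr'
    have h2 : ‖ip μ (X ^ (s + (n + 1 - 1 - r))) (star Φ n)‖ ≤
        nsq μ (Φ 0) * (M + 1) * win α (M + 1) n := by
      rw [Nat.add_sub_cancel]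
      rcases Nat.lt_or_ge r s with h | h
      · have h3 : s + (n - r) = n + (s - r) := by omega
        rw [h3]
        refine (S.norm_ip_X_pow_star_le (by omega)).trans ?_
        rw [mul_assoc]
        gcongr
        refine (sum_norm_le_win (M := M + 1) (n := n) fun i hi => ⟨by omega, by omega⟩).trans ?_
        gcongr
        have : s - r ≤ M + 1 := by omega
        exact_mod_cast this
      · rw [S.ip_X_pow_star (by omega) (by omega), norm_zero]
        positivity
    rw [ip_smul_left, norm_mul, norm_mul, Complex.norm_natCast]
    calc _ ≤ (n : ℝ) * (K' * (M + 1) * win α (M + 1) n) * (nsq μ (Φ 0) * (M + 1) * win α (M + 1) n) := by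
          gcongr
          omega
      _ = _ := by ring
  · rw [Finset.card_range, nsmul_eq_mul]; push_cast; ring

/-- Low degree part of the correction term. -/
lemma ip_X_pow_mul_star_derivative (S : System μ D₀ Φ α) (n s : ℕ) :
    ip μ (X ^ s * star Φ n) (X * derivative (star Φ n)) =
      ∑ i ∈ Finset.range (s + 1), (i : ℂ) * (starRingEnd ℂ) ((star Φ n).coeff i) *
        ip μ (X ^ (s - i) * star Φ n) 1 := by
  rw [S.X_mul_derivative_star (N := s + 1 + n) (by omega), ip_sum_right]
  rw [← Finset.sum_subset (Finset.range_mono (Nat.le_add_right (s + 1) n))]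
  · refine Finset.sum_congr rfl fun i hi => ?_
    have h1 : (X : ℂ[X]) ^ s = X ^ i * X ^ (s - i) := by
      rw [← pow_add, Nat.add_sub_cancel' (Nat.lt_succ_iff.1 (Finset.mem_range.1 hi))]
    have h2 := ip_X_pow_mul μ i (X ^ (s - i) * star Φ n) 1
    rw [mul_one, ← mul_assoc, ← h1] at h2
    rw [ip_smul_right, h2]
    simp
  · intro i _ hi
    rw [Finset.mem_range, not_lt] at hi
    rw [ip_smul_right]
    rcases Nat.lt_or_ge n i with h | h
    · rw [coeff_eq_zero_of_natDegree_lt ((S.natDegree_star n).trans_lt h)]; simp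
    · have h1 : (X : ℂ[X]) ^ i = X ^ s * X ^ (i - s) := by
        rw [← pow_add, Nat.add_sub_cancel' (by omega)]
      rw [h1, ip_X_pow_mul, ← conj_ip, S.ip_X_pow_star (by omega) (by omega)]
      simp

end System

/-- A sequence tending to zero which is quadratically controlled by its neighbours up to `1 / n` is
`O(1 / n)`. -/
lemma exists_norm_le_div_of_window {α : ℕ → ℂ} (hα : Tendsto α atTop (nhds 0)) {C : ℝ} {M N₀ : ℕ}
    (hC : 0 ≤ C) (h : ∀ n, N₀ ≤ n → n * ‖α n‖ ≤ C + C * n * win α M n ^ 2) :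
    ∃ A : ℝ, 0 ≤ A ∧ ∀ n : ℕ, ‖α n‖ ≤ A / (n + 1) := by
  obtain ⟨R, hR⟩ := hα.norm.bddAbove_range
  have hR' : ∀ n, ‖α n‖ ≤ R := fun n => hR ⟨n, rfl⟩
  have hR0 : 0 ≤ R := (norm_nonneg _).trans (hR' 0)
  set L : ℝ := 2 * M + 1 with hL
  have hL1 : 1 ≤ L := by rw [hL]; have : (0 : ℝ) ≤ M := by positivity
                         linarith
  set ε : ℝ := 1 / (4 * (C + 1) * L * L) with hε
  have hε0 : 0 < ε := by positivity
  obtain ⟨N₁, hN₁⟩ : ∃ N₁, ∀ n, N₁ ≤ n → ‖α n‖ ≤ ε := by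
    have := (Metric.tendsto_atTop.1 hα) ε hε0
    obtain ⟨N₁, h1⟩ := this
    exact ⟨N₁, fun n hn => by simpa using (h1 n hn).le⟩
  have hwin : ∀ (n : ℕ) (B : ℝ), 0 ≤ B → (∀ N, n ≤ N + M → N ≤ n + M → ‖α N‖ ≤ B) →
      win α M n ≤ L * B := by
    intro n B hB hb
    refine (Finset.sum_le_card_nsmul _ _ B fun N hN => ?_).trans ?_
    · rw [Finset.mem_Icc] at hN
      exact hb N (by omega) (by omega)
    · rw [nsmul_eq_mul, Nat.card_Icc]
      gcongr
      have : n + M + 1 - (n - M) ≤ 2 * M + 1 := by omega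
      rw [hL]
      exact_mod_cast this
  set N₂ := N₀ + N₁ + 2 * M + 1 with hN₂
  set A : ℝ := 4 * C + (N₂ + 1) * R with hA
  have hA0 : 0 ≤ A := by positivity
  have key : ∀ k n : ℕ, ‖α n‖ ≤ A / (n + 1) + R / 2 ^ k := by
    intro k
    induction k with
    | zero =>
      intro n
      have := hR' n
      have h2 : 0 ≤ A / (n + 1) := by positivity
      simpa using by linarith
    | succ k ih =>
      intro n
      have hn0 : (0 : ℝ) < n + 1 := by positivity
      rcases Nat.lt_or_ge n N₂ with hn | hn
      · have h1 : R ≤ A / (n + 1) := by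
          rw [le_div_iff₀ hn0]
          have : (n : ℝ) + 1 ≤ N₂ + 1 := by exact_mod_cast Nat.succ_le_succ hn.le
          nlinarith
        have h2 : 0 ≤ R / 2 ^ (k + 1) := by positivity
        linarith [hR' n]
      · have w1 : win α M n ≤ L * ε := hwin n ε hε0.le fun N h1 _ => hN₁ N (by omega)
        have w2 : win α M n ≤ L * (2 * A / (n + 1) + R / 2 ^ k) := by
          refine hwin n _ (by positivity) fun N h1 _ => (ih N).trans ?_
          gcongr ?_ + _
          rw [div_le_div_iff₀ (by positivity) hn0]
          have : (n : ℝ) + 1 ≤ 2 * (N + 1) := by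
            have : n + 1 ≤ 2 * (N + 1) := by omega
            exact_mod_cast this
          nlinarith
        have w3 : win α M n ^ 2 ≤ L * ε * (L * (2 * A / (n + 1) + R / 2 ^ k)) := by
          rw [sq]
          exact mul_le_mul w1 w2 (win_nonneg _ _ _) (by positivity)
        have h1 := h n (by omega)
        have hn1 : (1 : ℝ) ≤ n := by
          have : 1 ≤ n := by omega
          exact_mod_cast this
        have h2 : C * (L * ε * (L * (2 * A / (n + 1) + R / 2 ^ k))) ≤
            1 / 4 * (2 * A / (n + 1) + R / 2 ^ k) := by
          have e : C * (L * ε * (L * (2 * A / (n + 1) + R / 2 ^ k))) =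
              (C / (C + 1)) * (1 / 4 * (2 * A / (n + 1) + R / 2 ^ k)) := by
            rw [hε]; field_simp
          rw [e]
          refine mul_le_of_le_one_left (by positivity) ?_
          rw [div_le_one (by positivity)]
          linarith
        have h3 : ‖α n‖ ≤ C / n + C * win α M n ^ 2 := by
          have : (n : ℝ) * ‖α n‖ ≤ n * (C / n + C * win α M n ^ 2) := by
            have e : (n : ℝ) * (C / n + C * win α M n ^ 2) = C + C * n * win α M n ^ 2 := by
              field_simp
            rw [e]; exact h1
          exact le_of_mul_le_mul_left this (by linarith)
        have h4 : C * win α M n ^ 2 ≤ C * (L * ε * (L * (2 * A / (n + 1) + R / 2 ^ k))) := by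
          gcongr
        have h5 : C / n ≤ 2 * C / (n + 1) := by
          rw [div_le_div_iff₀ (by linarith) hn0]
          nlinarith
        have h6 : 2 * C / (n + 1) + 1 / 4 * (2 * A / (n + 1)) ≤ A / (n + 1) := by
          rw [← mul_div_assoc, ← add_div]
          gcongr
          have : 0 ≤ (N₂ + 1) * R := by positivity
          linarith
        have h7 : R / 2 ^ (k + 1) = 1 / 2 * (R / 2 ^ k) := by rw [pow_succ]; ring
        have h8 : 0 ≤ R / 2 ^ k := by positivity
        linarith
  refine ⟨A, hA0, fun n => ?_⟩
  have ht : Tendsto (fun k : ℕ => A / (n + 1) + R / 2 ^ k) atTop (nhds (A / (n + 1) + 0)) := by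
    refine tendsto_const_nhds.add ?_
    simpa [div_eq_mul_inv] using
      (tendsto_pow_atTop_nhds_zero_of_lt_one (r := (1 / 2 : ℝ)) (by norm_num)
        (by norm_num)).const_mul R
  rw [add_zero] at ht
  exact ge_of_tendsto' ht fun k => key k n

lemma exists_interpolation {m : ℕ} {a : Fin m → ℂ} (ha : Function.Injective a) :
    ∃ B : ℝ, 0 ≤ B ∧ ∀ v : Fin m → ℂ, (∀ k, ‖v k‖ ≤ 1) → ∃ c : ℕ → ℂ, (∀ s, ‖c s‖ ≤ B) ∧
      ∀ k, ∑ s ∈ Finset.range m, c s * a k ^ s = v k := by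
  refine ⟨∑ s ∈ Finset.range m, ∑ k, ‖(Lagrange.basis Finset.univ a k).coeff s‖,
    Finset.sum_nonneg fun _ _ => Finset.sum_nonneg fun _ _ => norm_nonneg _, fun v hv => ?_⟩
  have hdeg : ∀ s, m ≤ s → (Lagrange.interpolate Finset.univ a v).coeff s = 0 := by
    intro s hs
    refine coeff_eq_zero_of_degree_lt ((Lagrange.degree_interpolate_lt v
      (ha.injOn)).trans_le ?_)
    simpa using hs
  refine ⟨fun s => (Lagrange.interpolate Finset.univ a v).coeff s, fun s => ?_, fun k => ?_⟩
  · rcases Nat.lt_or_ge s m with hs | hs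
    · refine le_trans ?_ (Finset.single_le_sum (f := fun s => ∑ k,
        ‖(Lagrange.basis Finset.univ a k).coeff s‖)
        (fun _ _ => Finset.sum_nonneg fun _ _ => norm_nonneg _) (Finset.mem_range.2 hs))
      beta_reduce
      rw [Lagrange.interpolate_apply, finsetSum_coeff]
      refine (norm_sum_le _ _).trans (Finset.sum_le_sum fun k _ => ?_)
      rw [coeff_C_mul, norm_mul]
      exact mul_le_of_le_one_left (norm_nonneg _) (hv k)
    · beta_reduce
      rw [hdeg s hs, norm_zero]
      exact Finset.sum_nonneg fun _ _ => Finset.sum_nonneg fun _ _ => norm_nonneg _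
  · have h := Lagrange.eval_interpolate_at_node v (s := Finset.univ) ha.injOn
      (Finset.mem_univ k)
    rw [← h, eval_eq_sum_range' (n := m)]
    rcases Nat.eq_zero_or_pos m with rfl | hm
    · exact k.elim0
    · refine lt_of_le_of_lt (b := m - 1) (natDegree_le_iff_coeff_eq_zero.2 fun s hs => ?_) (by omega)
      exact hdeg s (by omega)

namespace System

variable {μ : Measure ℝ} [IsFiniteMeasure μ] {D₀ : ℝ} {Φ : ℕ → ℂ[X]} {α : ℕ → ℂ}

lemma norm_ip_X_pow_mul_star_star_le (S : System μ D₀ Φ α) (n i : ℕ) :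
    ‖ip μ (X ^ i * star Φ n) (star Φ n)‖ ≤ nsq μ (Φ 0) :=
  norm_ip_le μ (nsq_nonneg _ _) (by rw [nsq_X_pow_mul]; exact S.nsq_star_le n) (S.nsq_star_le n)

lemma norm_ip_X_pow_mul_star_one_le (S : System μ D₀ Φ α) (n i : ℕ) :
    ‖ip μ (X ^ i * star Φ n) 1‖ ≤ nsq μ (Φ 0) :=
  norm_ip_le μ (nsq_nonneg _ _) (by rw [nsq_X_pow_mul]; exact S.nsq_star_le n)
    (by rw [S.zero_eq_one])

lemma exists_norm_corr_le (S : System μ D₀ Φ α) {m : ℕ} {l : ℂ → ℂ} {a : Fin m → ℂ}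
    {β : Fin m → ℝ} {L : ℝ} (hL0 : 0 ≤ L) (hL : ∀ θ, ‖l (circ θ)‖ ≤ L) (ha : ∀ k, ‖a k‖ = 1)
    (M : ℕ) : ∃ K : ℝ, 0 ≤ K ∧ ∀ n, M < n → ∀ s ≤ M,
      ‖corr μ Φ l a β n s‖ ≤ K + K * n * win α (M + 1) n ^ 2 := by
  obtain ⟨K, hK0, hK⟩ := S.exists_norm_ip_derivative_le M
  choose K' hK'0 hK' using S.exists_coeff_star_bound
  have hh := nsq_nonneg μ (Φ 0)
  set h₀ := nsq μ (Φ 0) with hh₀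
  set K₁ : ℝ := M * h₀ + (∑ i ∈ Finset.range (M + 1), M * K' i * h₀) + L * h₀ +
    ∑ k, |β k| * (M * (h₀ + h₀)) with hK₁
  have hsum : 0 ≤ ∑ i ∈ Finset.range (M + 1), M * K' i * h₀ :=
    Finset.sum_nonneg fun i _ => by have := hK'0 i; positivity
  have hsum2 : 0 ≤ ∑ k, |β k| * (M * (h₀ + h₀)) := Finset.sum_nonneg fun i _ => by positivity
  have hK₁0 : 0 ≤ K₁ := by positivity
  refine ⟨K + K₁, by positivity, fun n hn s hs => ?_⟩
  have hs' : (s : ℝ) ≤ M := by exact_mod_cast hs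
  rw [corr_eq, S.ip_X_pow_mul_star_derivative]
  have b1 : ‖(s : ℂ) * ip μ (X ^ s * star Φ n) (star Φ n)‖ ≤ M * h₀ := by
    rw [norm_mul, Complex.norm_natCast]
    gcongr
    exact S.norm_ip_X_pow_mul_star_star_le n s
  have b2 := hK n hn s hs
  have b3 : ‖∑ i ∈ Finset.range (s + 1), (i : ℂ) * (starRingEnd ℂ) ((star Φ n).coeff i) *
        ip μ (X ^ (s - i) * star Φ n) 1‖ ≤ ∑ i ∈ Finset.range (M + 1), M * K' i * h₀ := by
    refine (norm_sum_le _ _).trans ?_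
    refine (Finset.sum_le_sum fun i hi => ?_).trans (Finset.sum_le_sum_of_subset_of_nonneg
      (Finset.range_mono (by omega)) fun i _ _ => by have := hK'0 i; positivity)
    rw [norm_mul, norm_mul, Complex.norm_natCast, RCLike.norm_conj]
    have hi' : (i : ℝ) ≤ M := by
      have := Finset.mem_range.1 hi
      have : i ≤ M := by omega
      exact_mod_cast this
    have := hK'0 i
    gcongr
    · exact hK' i n
    · exact S.norm_ip_X_pow_mul_star_one_le n _
  have b4 : ‖ipw μ l (X ^ s * star Φ n) (star Φ n)‖ ≤ L * h₀ :=
    norm_ipw_le hL0 hL (by rw [nsq_X_pow_mul]; exact S.nsq_star_le n) (S.nsq_star_le n)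
  have b5 : ‖∑ k, (β k : ℂ) * ∑ i ∈ Finset.range s, (a k ^ (s - 1 - i) *
        ip μ (X ^ (i + 1) * star Φ n) (star Φ n) +
        a k ^ (s - i) * ip μ (X ^ i * star Φ n) (star Φ n))‖ ≤ ∑ k, |β k| * (M * (h₀ + h₀)) := by
    refine (norm_sum_le _ _).trans (Finset.sum_le_sum fun k _ => ?_)
    rw [norm_mul, Complex.norm_real, Real.norm_eq_abs]
    gcongr
    refine (norm_sum_le _ _).trans ((Finset.sum_le_card_nsmul _ _ (h₀ + h₀) fun i _ => ?_).trans ?_)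
    · refine (norm_add_le _ _).trans ?_
      rw [norm_mul, norm_mul, norm_pow, norm_pow, ha k, one_pow, one_pow, one_mul, one_mul]
      exact add_le_add (S.norm_ip_X_pow_mul_star_star_le n _)
        (S.norm_ip_X_pow_mul_star_star_le n _)
    · rw [Finset.card_range, nsmul_eq_mul]
      gcongr
  have hw : 0 ≤ K₁ * n * win α (M + 1) n ^ 2 := by positivity
  refine (norm_add_le _ _).trans ((add_le_add ((norm_add_le _ _).trans (add_le_add
    ((norm_sub_le _ _).trans (add_le_add ((norm_add_le _ _).trans (add_le_add b1 b2)) b3)) b4))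
    b5).trans ?_)
  rw [hK₁] at hw ⊢
  nlinarith

/-- The Verblunsky coefficients are `O(1 / n)`. -/
lemma exists_norm_alpha_le (S : System μ D₀ Φ α) {m : ℕ} {l : ℂ → ℂ} {a : Fin m → ℂ}
    {β : Fin m → ℝ} (hP : PartsFormula μ l a β) (ha : ∀ k, ‖a k‖ = 1)
    (ha' : Function.Injective a) :
    ∃ A : ℝ, 0 ≤ A ∧ ∀ n : ℕ, ‖α n‖ ≤ A / (n + 1) := by
  obtain ⟨L, hL0, hL⟩ := exists_bound_circ hP.cont
  obtain ⟨B, hB0, hB⟩ := exists_interpolation ha'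
  obtain ⟨K, hK0, hK⟩ := S.exists_norm_corr_le hL0 hL ha (β := β) m
  have hh := nsq_nonneg μ (Φ 0)
  set h₀ := nsq μ (Φ 0) with hh₀
  set b : ℝ := ∑ k, |β k| with hb
  have hb0 : 0 ≤ b := Finset.sum_nonneg fun _ _ => abs_nonneg _
  have hD : 0 < D₀ ^ 2 := pow_pos S.pos 2
  set C₁ : ℝ := b * h₀ + L * h₀ + m * (B * K) with hC₁
  have hC₁0 : 0 ≤ C₁ := by positivity
  obtain ⟨N₀, hN₀⟩ := exists_nat_ge (2 * b)
  refine exists_norm_le_div_of_window (C := 2 * C₁ / D₀ ^ 2) (M := m + 1) (N₀ := N₀ + m + 1)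
    S.tendsto_alpha (by positivity) fun n hn => ?_
  obtain ⟨c, hc, hc'⟩ := hB (fun k => phase Φ (a k) n) fun k => (S.norm_phase (ha k) n).le
  have hid := S.alpha_identity_sum hP ha n m c hc'
  set w := win α (m + 1) n with hw
  have b1 : ‖∑ k, (β k : ℂ) * phase Φ (a k) n‖ ≤ b := by
    refine (norm_sum_le _ _).trans (Finset.sum_le_sum fun k _ => ?_)
    rw [norm_mul, S.norm_phase (ha k), Complex.norm_real, Real.norm_eq_abs, mul_one]
  have b2 : ‖ipw μ l (star Φ n) (X * Φ n)‖ ≤ L * h₀ :=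
    norm_ipw_le hL0 hL (S.nsq_star_le n) (by rw [nsq_X_mul]; exact S.nsq_le n)
  have b3 : ‖∑ s ∈ Finset.range m, c s * corr μ Φ l a β n s‖ ≤
      m * (B * (K + K * n * w ^ 2)) := by
    refine (norm_sum_le _ _).trans ((Finset.sum_le_card_nsmul _ _ (B * (K + K * n * w ^ 2))
      fun s hs => ?_).trans_eq (by simp))
    rw [norm_mul]
    exact mul_le_mul (hc s) (hK n (by omega) s (Finset.mem_range.1 hs).le) (norm_nonneg _) hB0
  have hsub : (n + 1 + ∑ k, (β k : ℂ)) * α n * nsq μ (Φ n) =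
      ipw μ l (star Φ n) (X * Φ n) - (∑ s ∈ Finset.range m, c s * corr μ Φ l a β n s) -
        (∑ k, (β k : ℂ) * phase Φ (a k) n) * nsq μ (Φ n) := by
    linear_combination hid
  have hup : ‖((n : ℂ) + 1 + ∑ k, (β k : ℂ)) * α n * nsq μ (Φ n)‖ ≤ C₁ + C₁ * n * w ^ 2 := by
    rw [hsub]
    have b4 : ‖(∑ k, (β k : ℂ) * phase Φ (a k) n) * nsq μ (Φ n)‖ ≤ b * h₀ := by
      rw [norm_mul, Complex.norm_real, Real.norm_of_nonneg (nsq_nonneg _ _)]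
      exact mul_le_mul b1 (S.nsq_le n) (nsq_nonneg _ _) hb0
    refine (norm_sub_le _ _).trans ((add_le_add ((norm_sub_le _ _).trans (add_le_add b2 b3))
      b4).trans ?_)
    have : 0 ≤ (b * h₀ + L * h₀) * n * w ^ 2 := by positivity
    rw [hC₁]
    nlinarith
  have hlow : (n : ℝ) / 2 * ‖α n‖ * D₀ ^ 2 ≤ ‖((n : ℂ) + 1 + ∑ k, (β k : ℂ)) * α n * nsq μ (Φ n)‖ := by
    rw [norm_mul, norm_mul, Complex.norm_real, Real.norm_of_nonneg (nsq_nonneg _ _)]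
    have h1 : (n : ℝ) / 2 ≤ ‖(n : ℂ) + 1 + ∑ k, (β k : ℂ)‖ := by
      have e : (n : ℂ) + 1 + ∑ k, (β k : ℂ) = ((n + 1 + ∑ k, β k : ℝ) : ℂ) := by push_cast; rfl
      rw [e, Complex.norm_real, Real.norm_eq_abs]
      refine le_trans ?_ (le_abs_self _)
      have h2 : -b ≤ ∑ k, β k := neg_le_of_abs_le (Finset.abs_sum_le_sum_abs _ _)
      have h3 : (N₀ : ℝ) ≤ n := by
        have : N₀ ≤ n := by omega
        exact_mod_cast this
      linarith
    gcongr
    exact S.le_nsq n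
  have h5 : (n : ℝ) / 2 * ‖α n‖ * D₀ ^ 2 ≤ C₁ + C₁ * n * w ^ 2 := hlow.trans hup
  have e : 2 * C₁ / D₀ ^ 2 + 2 * C₁ / D₀ ^ 2 * n * w ^ 2 =
      2 / D₀ ^ 2 * (C₁ + C₁ * n * w ^ 2) := by field_simp
  have hDne := S.pos.ne'
  rw [e]
  calc (n : ℝ) * ‖α n‖ = 2 / D₀ ^ 2 * ((n : ℝ) / 2 * ‖α n‖ * D₀ ^ 2) := by field_simp
    _ ≤ _ := by gcongr

end System

lemma norm_sub_le_of_tendsto {E : Type*} [NormedAddCommGroup E] {x : ℕ → E} {y : E} {K : ℝ}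
    {N : ℕ} (hK : 0 ≤ K) (h : ∀ n, N ≤ n → ‖x (n + 1) - x n‖ ≤ K / (n + 1) ^ 2)
    (hx : Tendsto x atTop (nhds y)) : ∀ n, N ≤ n → ‖x n - y‖ ≤ 2 * K / (n + 1) := by
  intro n hn
  have key : ∀ j : ℕ, ‖x (n + j) - x n‖ ≤ 2 * K * (1 / (n + 1) - 1 / (n + j + 1)) := by
    intro j
    induction j with
    | zero => simp
    | succ j ih =>
      have h1 := h (n + j) (by omega)
      have h2 : K / ((n + j : ℕ) + 1 : ℝ) ^ 2 ≤
          2 * K * (1 / (n + j + 1) - 1 / (n + (j + 1 : ℕ) + 1)) := by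
        push_cast
        set t : ℝ := n + j + 1 with ht
        have ht1 : 1 ≤ t := by
          have : (0 : ℝ) ≤ n := by positivity
          have : (0 : ℝ) ≤ j := by positivity
          linarith
        have e : 1 / t - 1 / (n + (j + 1) + 1) = 1 / (t * (t + 1)) := by
          have : (n : ℝ) + (j + 1) + 1 = t + 1 := by rw [ht]; ring
          rw [this]; field_simp; ring
        rw [e, mul_one_div, div_le_div_iff₀ (by positivity) (by positivity)]
        nlinarith [mul_nonneg hK (by linarith : 0 ≤ t - 1)]
      have h3 : x (n + (j + 1)) - x n = (x (n + j + 1) - x (n + j)) + (x (n + j) - x n) := by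
        rw [← add_assoc]; abel
      rw [h3]
      refine (norm_add_le _ _).trans ?_
      linarith
  have ht : Tendsto (fun j => ‖x (n + j) - x n‖) atTop (nhds ‖y - x n‖) := by
    have : Tendsto (fun j => x (n + j)) atTop (nhds y) := by
      simpa [add_comm] using (tendsto_add_atTop_iff_nat n).2 hx
    exact (this.sub_const _).norm
  rw [norm_sub_rev]
  refine le_of_tendsto' ht fun j => (key j).trans ?_
  rw [mul_div_assoc, div_eq_mul_one_div K, ← mul_assoc]
  have : (0 : ℝ) ≤ 1 / (n + j + 1) := by positivity
  gcongr
  linarith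

/-- The hypothesis that `l` is given on the circle by an absolutely convergent imaginary
trigonometric series. -/
structure LaurentSeries' (l : ℂ → ℂ) (c : ℕ → ℂ) : Prop where
  zero : c 0 = 0
  summable : Summable fun j => ‖c j‖ * (j + 1)
  hasSum : ∀ θ, HasSum (fun j => c j * circ θ ^ j - (starRingEnd ℂ) (c j * circ θ ^ j)) (l (circ θ))

lemma LaurentSeries'.hasSum_ipw {μ : Measure ℝ} [IsFiniteMeasure μ] {l : ℂ → ℂ} {c : ℕ → ℂ}
    (hl : LaurentSeries' l c) (p q : ℂ[X]) :
    HasSum (fun j => c j * ip μ (X ^ j * p) q - (starRingEnd ℂ) (c j) * ip μ p (X ^ j * q))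
      (ipw μ l p q) := by
  set F : ℕ → ℝ → ℂ := fun j θ => (c j * circ θ ^ j - (starRingEnd ℂ) (c j * circ θ ^ j)) *
    (p.eval (circ θ) * (starRingEnd ℂ) (q.eval (circ θ))) with hF
  have h_int : ∀ j, Integrable (F j) μ := fun j =>
    integrable_comp_circ (F := fun z => (c j * z ^ j - (starRingEnd ℂ) (c j * z ^ j)) *
      (p.eval z * (starRingEnd ℂ) (q.eval z))) (by fun_prop) μ
  have e1 : ∀ j, ∫ θ, F j θ ∂μ =
      c j * ip μ (X ^ j * p) q - (starRingEnd ℂ) (c j) * ip μ p (X ^ j * q) := by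
    intro j
    unfold ip
    rw [← integral_const_mul, ← integral_const_mul, ← integral_sub]
    · congr 1
      ext θ
      simp only [hF, eval_mul, eval_pow, eval_X, map_mul, map_pow]
      ring
    · exact (integrable_eval_mul_conj _ _ _).const_mul _
    · exact (integrable_eval_mul_conj _ _ _).const_mul _
  have hnorm : Integrable (fun θ => ‖p.eval (circ θ) * (starRingEnd ℂ) (q.eval (circ θ))‖) μ :=
    (integrable_eval_mul_conj p q μ).norm
  have e2 : Summable fun j => ∫ θ, ‖F j θ‖ ∂μ := by
    refine Summable.of_nonneg_of_le (fun j => integral_nonneg fun _ => norm_nonneg _) (fun j => ?_)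
      (hl.summable.mul_right
        (2 * ∫ θ, ‖p.eval (circ θ) * (starRingEnd ℂ) (q.eval (circ θ))‖ ∂μ))
    have h0 : 0 ≤ ∫ θ, ‖p.eval (circ θ) * (starRingEnd ℂ) (q.eval (circ θ))‖ ∂μ :=
      integral_nonneg fun _ => norm_nonneg _
    calc ∫ θ, ‖F j θ‖ ∂μ ≤ ∫ θ, 2 * ‖c j‖ *
          ‖p.eval (circ θ) * (starRingEnd ℂ) (q.eval (circ θ))‖ ∂μ := by
          refine integral_mono (h_int j).norm (hnorm.const_mul _) fun θ => ?_
          simp only [hF]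
          rw [norm_mul]
          gcongr
          refine (norm_sub_le _ _).trans ?_
          rw [RCLike.norm_conj, norm_mul, norm_pow, norm_circ, one_pow, mul_one, two_mul]
      _ ≤ _ := by
          rw [integral_const_mul]
          have : 0 ≤ ‖c j‖ * j := by positivity
          nlinarith [mul_nonneg this h0]
  have h := hasSum_integral_of_summable_integral_norm h_int e2
  simp only [e1] at h
  have e3 : ∫ θ, ∑' j, F j θ ∂μ = ipw μ l p q :=
    integral_congr_ae (ae_of_all _ fun θ => ((hl.hasSum θ).mul_right _).tsum_eq)
  rwa [e3] at h

namespace System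

variable {μ : Measure ℝ} [IsFiniteMeasure μ] {D₀ : ℝ} {Φ : ℕ → ℂ[X]} {α : ℕ → ℂ}

lemma norm_ip_X_pow_mul_star_le_div (S : System μ D₀ Φ α) {A : ℝ} (hA0 : 0 ≤ A)
    (hA : ∀ n : ℕ, ‖α n‖ ≤ A / (n + 1)) {n j : ℕ} (hj : 1 ≤ j) {q : ℂ[X]}
    (hq : nsq μ q ≤ nsq μ (Φ 0))
    (ho : ∀ p : ℂ[X], (∀ i, p.coeff i ≠ 0 → 1 ≤ i ∧ i ≤ n) → ip μ p q = 0) :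
    ‖ip μ (X ^ j * star Φ n) q‖ ≤ nsq μ (Φ 0) * (2 * A + 2) * j / (n + 1) := by
  have hh := nsq_nonneg μ (Φ 0)
  rcases Nat.lt_or_ge n (2 * j) with h | h
  · refine (norm_ip_le μ hh (by rw [nsq_X_pow_mul]; exact S.nsq_star_le n) hq).trans ?_
    rw [le_div_iff₀ (by positivity), mul_assoc]
    gcongr
    have : (n : ℝ) + 1 ≤ 2 * j := by exact_mod_cast h
    nlinarith [mul_nonneg hA0 (Nat.cast_nonneg (α := ℝ) j)]
  · refine (S.norm_ip_X_pow_mul_star hj (by omega) hq ho).trans ?_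
    rw [mul_assoc, mul_div_assoc]
    gcongr
    refine (Finset.sum_le_card_nsmul _ _ (2 * A / (n + 1)) fun i _ => (hA _).trans ?_).trans ?_
    · rw [div_le_div_iff₀ (by positivity) (by positivity)]
      have h1 : (n : ℝ) + 1 ≤ 2 * ((n - j + i : ℕ) + 1) := by
        have : n + 1 ≤ 2 * (n - j + i + 1) := by omega
        exact_mod_cast this
      nlinarith
    · rw [Finset.card_range, nsmul_eq_mul, mul_div_assoc', mul_comm]
      gcongr
      linarith

lemma sum_norm_le_div {A : ℝ} (hA0 : 0 ≤ A) (hA : ∀ n : ℕ, ‖α n‖ ≤ A / (n + 1)) (n j : ℕ) :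
    ∑ i ∈ Finset.range j, ‖α (n + i)‖ ≤ A * j / (n + 1) := by
  refine (Finset.sum_le_card_nsmul _ _ (A / (n + 1)) fun i _ => (hA _).trans ?_).trans_eq ?_
  · gcongr
    simp
  · rw [Finset.card_range, nsmul_eq_mul]; ring

lemma exists_norm_ipw_star_le (S : System μ D₀ Φ α) {A : ℝ} (hA0 : 0 ≤ A)
    (hA : ∀ n : ℕ, ‖α n‖ ≤ A / (n + 1)) {l : ℂ → ℂ} {c : ℕ → ℂ} (hl : LaurentSeries' l c) :
    ∃ K : ℝ, 0 ≤ K ∧ ∀ n : ℕ, ‖ipw μ l (star Φ n) (X * Φ n)‖ ≤ K / (n + 1) := by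
  have hh := nsq_nonneg μ (Φ 0)
  set h₀ := nsq μ (Φ 0) with hh₀
  have hs0 : 0 ≤ ∑' j, ‖c j‖ * (j + 1) := tsum_nonneg fun j => by positivity
  refine ⟨(∑' j, ‖c j‖ * (j + 1)) * (h₀ * (2 * A + 2) + h₀ * A), by positivity, fun n => ?_⟩
  rw [mul_div_assoc]
  refine (hl.hasSum_ipw (μ := μ) (star Φ n) (X * Φ n)).norm_le_of_bounded
    (hl.summable.hasSum.mul_right _) fun j => ?_
  rcases Nat.eq_zero_or_pos j with rfl | hj
  · simp only [hl.zero]; simp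
  · refine (norm_sub_le _ _).trans ?_
    rw [norm_mul, norm_mul, RCLike.norm_conj, ← mul_add, mul_assoc]
    gcongr
    have b1 := S.norm_ip_X_pow_mul_star_le_div hA0 hA (n := n) hj (q := X * Φ n)
      (by rw [nsq_X_mul]; exact S.nsq_le n) fun p hp => S.ip_X_mul_right hp
    have b2 : ‖ip μ (star Φ n) (X ^ j * (X * Φ n))‖ ≤ h₀ * (A * (j + 1 : ℕ) / (n + 1)) := by
      rw [← conj_ip, RCLike.norm_conj]
      refine S.norm_ip_X_pow_mul_le.trans ?_
      gcongr
      exact sum_norm_le_div hA0 hA n (j + 1)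
    refine (add_le_add b1 b2).trans ?_
    rw [mul_div_assoc', ← add_div, mul_div_assoc']
    gcongr
    push_cast
    nlinarith [mul_nonneg hh hA0]

lemma exists_norm_ipw_X_pow_add_le (S : System μ D₀ Φ α) {A : ℝ} (hA0 : 0 ≤ A)
    (hA : ∀ n : ℕ, ‖α n‖ ≤ A / (n + 1)) {l : ℂ → ℂ} {c : ℕ → ℂ} (hl : LaurentSeries' l c) (s : ℕ) :
    ∃ K : ℝ, 0 ≤ K ∧ ∀ n : ℕ, ‖ipw μ l (X ^ s * star Φ n) (star Φ n) +
      (starRingEnd ℂ) (c s) * nsq μ (Φ n)‖ ≤ K / (n + 1) := by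
  have hh := nsq_nonneg μ (Φ 0)
  set h₀ := nsq μ (Φ 0) with hh₀
  set K₁ := h₀ * (2 * A + 2) with hK₁
  have hK₁0 : 0 ≤ K₁ := by positivity
  have hs0 : 0 ≤ ∑' j, ‖c j‖ * (j + 1) := tsum_nonneg fun j => by positivity
  refine ⟨(∑' j, ‖c j‖ * (j + 1)) * (2 * K₁ * (s + 1)), by positivity, fun n => ?_⟩
  have h1 := (hl.hasSum_ipw (μ := μ) (X ^ s * star Φ n) (star Φ n)).add
    (hasSum_ite_eq s ((starRingEnd ℂ) (c s) * nsq μ (Φ n)))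
  rw [mul_div_assoc]
  refine h1.norm_le_of_bounded (hl.summable.hasSum.mul_right _) fun j => ?_
  have b0 : ∀ i, 1 ≤ i → i ≤ j + s →
      ‖ip μ (X ^ i * star Φ n) (star Φ n)‖ ≤ K₁ * (j + s) / (n + 1) := fun i hi hi' => by
    refine (S.norm_ip_X_pow_mul_star_le_div hA0 hA hi (S.nsq_star_le n) fun p hp => S.ip_star hp).trans ?_
    gcongr
    exact_mod_cast hi'
  have b1 : ‖c j * ip μ (X ^ j * (X ^ s * star Φ n)) (star Φ n)‖ ≤
      ‖c j‖ * (K₁ * (j + s) / (n + 1)) := by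
    rcases Nat.eq_zero_or_pos j with rfl | hj
    · simp only [hl.zero]; simp
    · rw [norm_mul, ← mul_assoc, ← pow_add]
      gcongr
      exact b0 _ (by omega) le_rfl
  have b2 : ‖-((starRingEnd ℂ) (c j) * ip μ (X ^ s * star Φ n) (X ^ j * star Φ n)) +
      (if j = s then (starRingEnd ℂ) (c s) * (nsq μ (Φ n) : ℂ) else 0)‖ ≤
        ‖c j‖ * (K₁ * (j + s) / (n + 1)) := by
    rcases lt_trichotomy j s with h | h | h
    · rw [if_neg h.ne, add_zero, norm_neg, norm_mul, RCLike.norm_conj]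
      have e : (X : ℂ[X]) ^ s = X ^ j * X ^ (s - j) := by rw [← pow_add]; congr 1; omega
      rw [e, mul_assoc, ip_X_pow_mul]
      gcongr
      exact b0 _ (by omega) (by omega)
    · subst h
      rw [if_pos rfl, ip_X_pow_mul, ip_self, S.nsq_star, neg_add_cancel, norm_zero]
      positivity
    · rw [if_neg h.ne', add_zero, norm_neg, norm_mul, RCLike.norm_conj]
      have e : (X : ℂ[X]) ^ j = X ^ s * X ^ (j - s) := by rw [← pow_add]; congr 1; omega
      rw [e, mul_assoc, ip_X_pow_mul, ← conj_ip, RCLike.norm_conj]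
      gcongr
      exact b0 _ (by omega) (by omega)
  rw [sub_eq_add_neg, add_assoc]
  refine (norm_add_le _ _).trans ((add_le_add b1 b2).trans ?_)
  clear_value K₁
  rw [← mul_add, mul_assoc ‖c j‖, ← add_div, mul_div_assoc' ((j : ℝ) + 1)]
  refine mul_le_mul_of_nonneg_left (div_le_div_of_nonneg_right ?_ (by positivity))
    (norm_nonneg (c j))
  have h2 : (0 : ℝ) ≤ j * s := by positivity
  nlinarith [mul_nonneg hK₁0 h2]

end System

lemma win_le_div {α : ℕ → ℂ} {A : ℝ} (hA0 : 0 ≤ A) (hA : ∀ n : ℕ, ‖α n‖ ≤ A / (n + 1)) {M n : ℕ}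
    (hn : 2 * M ≤ n) : win α M n ≤ (2 * M + 1) * (2 * A) / (n + 1) := by
  refine (Finset.sum_le_card_nsmul _ _ (2 * A / (n + 1)) fun N hN => (hA N).trans ?_).trans ?_
  · rw [Finset.mem_Icc] at hN
    rw [div_le_div_iff₀ (by positivity) (by positivity)]
    have : (n : ℝ) + 1 ≤ 2 * (N + 1) := by
      have : n + 1 ≤ 2 * (N + 1) := by omega
      exact_mod_cast this
    nlinarith
  · rw [nsmul_eq_mul, Nat.card_Icc, mul_div_assoc (2 * (M : ℝ) + 1)]
    gcongr
    have : n + M + 1 - (n - M) ≤ 2 * M + 1 := by omega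
    exact_mod_cast this

namespace System

variable {μ : Measure ℝ} [IsFiniteMeasure μ] {D₀ : ℝ} {Φ : ℕ → ℂ[X]} {α : ℕ → ℂ}

lemma norm_nsq_sub_le (S : System μ D₀ Φ α) {A : ℝ}
    (hA : ∀ n : ℕ, ‖α n‖ ≤ A / (n + 1)) (n : ℕ) :
    ‖nsq μ (Φ (n + 1)) - nsq μ (Φ n)‖ ≤ nsq μ (Φ 0) * A ^ 2 / (n + 1) ^ 2 := by
  rw [S.nsq_succ]
  have e : nsq μ (Φ n) * (1 - ‖α n‖ ^ 2) - nsq μ (Φ n) = -(nsq μ (Φ n) * ‖α n‖ ^ 2) := by ring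
  rw [e, norm_neg, Real.norm_of_nonneg (mul_nonneg (nsq_nonneg _ _) (sq_nonneg _)), mul_div_assoc,
    ← div_pow]
  have h1 := S.nsq_le n
  have h2 := hA n
  have h3 := nsq_nonneg μ (Φ n)
  have h4 := nsq_nonneg μ (Φ 0)
  gcongr

lemma exists_norm_low_sub_le (S : System μ D₀ Φ α) {A : ℝ} (hA0 : 0 ≤ A)
    (hA : ∀ n : ℕ, ‖α n‖ ≤ A / (n + 1)) (s : ℕ) :
    ∃ K : ℝ, 0 ≤ K ∧ ∀ n : ℕ, 2 * s + 1 ≤ n →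
      ‖ip μ (X ^ s * star Φ (n + 1)) (X * derivative (star Φ (n + 1))) -
        ip μ (X ^ s * star Φ n) (X * derivative (star Φ n))‖ ≤ K / (n + 1) ^ 2 := by
  choose K hK0 hK using S.exists_coeff_star_bound
  set K' := ∑ i ∈ Finset.range (s + 1), K i with hK'
  have hK'' : ∀ n, ∀ i ≤ s, ‖(star Φ n).coeff i‖ ≤ K' := fun n i hi =>
    (hK i n).trans (Finset.single_le_sum (f := K) (fun j _ => hK0 j)
      (Finset.mem_range.2 (Nat.lt_succ_of_le hi)))
  have hK'0 : 0 ≤ K' := Finset.sum_nonneg fun i _ => hK0 i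
  have hh := nsq_nonneg μ (Φ 0)
  set h₀ := nsq μ (Φ 0) with hh₀
  refine ⟨(s + 1) * (s * (A * (K' * (s * (2 * A))) * h₀ + K' * (A * (h₀ * (A * (s + 1)))))),
    by positivity, fun n hn => ?_⟩
  rw [S.ip_X_pow_mul_star_derivative, S.ip_X_pow_mul_star_derivative, ← Finset.sum_sub_distrib]
  refine (norm_sum_le _ _).trans ((Finset.sum_le_card_nsmul _ _
    ((s * (A * (K' * (s * (2 * A))) * h₀ + K' * (A * (h₀ * (A * (s + 1)))))) / (n + 1) ^ 2)
    fun i hi => ?_).trans_eq ?_)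
  · have hi' : i ≤ s := Nat.lt_succ_iff.1 (Finset.mem_range.1 hi)
    have e1 : star Φ (n + 1) = star Φ n - α n • (X * Φ n) := S.rec_star n
    have hc : ‖(star Φ (n + 1)).coeff i - (star Φ n).coeff i‖ ≤
        A / (n + 1) * (K' * (s * (2 * A / (n + 1)))) := by
      rw [e1, coeff_sub, sub_sub_cancel_left, norm_neg, coeff_smul, smul_eq_mul, norm_mul]
      refine mul_le_mul (hA n) ?_ (norm_nonneg _) (by positivity)
      rcases Nat.eq_zero_or_pos i with rfl | h0
      · simp; positivity
      · obtain ⟨r, rfl⟩ := Nat.exists_eq_add_of_le' h0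
        rw [coeff_X_mul]
        refine (S.norm_coeff_le (m := s) hK'' (by omega) (by omega)).trans ?_
        gcongr
        refine (Finset.sum_le_card_nsmul _ _ (2 * A / (n + 1)) fun j hj => (hA _).trans ?_).trans ?_
        · have := Finset.mem_range.1 hj
          rw [div_le_div_iff₀ (by positivity) (by positivity)]
          have h1 : (n : ℝ) + 1 ≤ 2 * ((n - 1 - j : ℕ) + 1) := by
            have : n + 1 ≤ 2 * (n - 1 - j + 1) := by omega
            exact_mod_cast this
          nlinarith
        · rw [Finset.card_range, nsmul_eq_mul]
          gcongr
    have hB : ‖ip μ (X ^ (s - i) * star Φ (n + 1)) 1 - ip μ (X ^ (s - i) * star Φ n) 1‖ ≤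
        A / (n + 1) * (h₀ * (A * (s + 1) / (n + 1))) := by
      rw [← ip_sub_left, ← mul_sub, e1, sub_sub_cancel_left, mul_neg, ← neg_one_smul ℂ (_ * _),
        ip_smul_left, mul_smul_comm, ip_smul_left]
      have e2 : (X : ℂ[X]) ^ (s - i) * (X * Φ n) = X ^ (s - i + 1) * Φ n := by ring
      rw [e2, norm_mul, norm_mul, norm_neg, norm_one, one_mul]
      refine mul_le_mul (hA n) ((S.norm_ip_X_pow_mul_one (by omega)).trans ?_) (norm_nonneg _)
        (by positivity)
      gcongr
      refine (sum_norm_le_div hA0 hA n _).trans ?_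
      gcongr
      have : s - i + 1 ≤ s + 1 := by omega
      exact_mod_cast this
    have e3 : (i : ℂ) * (starRingEnd ℂ) ((star Φ (n + 1)).coeff i) *
        ip μ (X ^ (s - i) * star Φ (n + 1)) 1 - (i : ℂ) * (starRingEnd ℂ) ((star Φ n).coeff i) *
        ip μ (X ^ (s - i) * star Φ n) 1 =
        (i : ℂ) * ((starRingEnd ℂ) ((star Φ (n + 1)).coeff i - (star Φ n).coeff i) *
          ip μ (X ^ (s - i) * star Φ (n + 1)) 1 + (starRingEnd ℂ) ((star Φ n).coeff i) *
          (ip μ (X ^ (s - i) * star Φ (n + 1)) 1 - ip μ (X ^ (s - i) * star Φ n) 1)) := by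
      rw [map_sub]; ring
    rw [e3, norm_mul, Complex.norm_natCast, mul_div_assoc]
    refine mul_le_mul (by exact_mod_cast hi') ?_ (norm_nonneg _) (by positivity)
    refine (norm_add_le _ _).trans ?_
    rw [norm_mul, norm_mul, RCLike.norm_conj, RCLike.norm_conj]
    refine (add_le_add (mul_le_mul hc (S.norm_ip_X_pow_mul_star_one_le _ _) (norm_nonneg _)
      (by positivity)) (mul_le_mul (hK'' n i hi') hB (norm_nonneg _) hK'0)).trans_eq ?_
    rw [← hh₀]
    field_simp
  · rw [Finset.card_range, nsmul_eq_mul]; push_cast; ring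

lemma exists_norm_corr_add_le (S : System μ D₀ Φ α) {A : ℝ} (hA0 : 0 ≤ A)
    (hA : ∀ n : ℕ, ‖α n‖ ≤ A / (n + 1)) {m : ℕ} {l : ℂ → ℂ} {c : ℕ → ℂ} {a : Fin m → ℂ}
    {β : Fin m → ℝ} (hl : LaurentSeries' l c) (ha : ∀ k, ‖a k‖ = 1) (s : ℕ) :
    ∃ K : ℝ, 0 ≤ K ∧ ∀ n : ℕ, 2 * s + 2 ≤ n →
      ‖corr μ Φ l a β n s + ip μ (X ^ s * star Φ n) (X * derivative (star Φ n)) -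
        (if s = 0 then 0 else ∑ k, β k * a k ^ s - (starRingEnd ℂ) (c s)) * nsq μ (Φ n)‖ ≤
        K / (n + 1) := by
  obtain ⟨K₁, hK₁0, hK₁⟩ := S.exists_norm_ip_derivative_le s
  obtain ⟨K₂, hK₂0, hK₂⟩ := S.exists_norm_ipw_X_pow_add_le hA0 hA hl s
  have hh := nsq_nonneg μ (Φ 0)
  set h₀ := nsq μ (Φ 0) with hh₀
  set K₃ := h₀ * (2 * A + 2) with hK₃
  have hK₃0 : 0 ≤ K₃ := by positivity
  set P : ℝ := (2 * (s + 1 : ℕ) + 1) * (2 * A) with hP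
  set K₅ : ℝ := ∑ k, |β k| * (s * (2 * (K₃ * s))) with hK₅
  have hK₅0 : 0 ≤ K₅ := Finset.sum_nonneg fun _ _ => by positivity
  refine ⟨K₃ * s * s + K₁ * P ^ 2 + K₂ + K₅, by positivity, fun n hn => ?_⟩
  have hstar : ∀ j : ℕ, 1 ≤ j → ‖ip μ (X ^ j * star Φ n) (star Φ n)‖ ≤ K₃ * j / (n + 1) := fun j hj =>
    S.norm_ip_X_pow_mul_star_le_div hA0 hA hj (S.nsq_star_le n) fun p hp => S.ip_star hp
  clear_value K₃
  have b1 : ‖(s : ℂ) * ip μ (X ^ s * star Φ n) (star Φ n)‖ ≤ K₃ * s * s / (n + 1) := by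
    rcases Nat.eq_zero_or_pos s with rfl | h0
    · simp
    · rw [norm_mul, Complex.norm_natCast, mul_comm (s : ℝ), mul_div_right_comm]
      gcongr
      exact hstar s h0
  have b2 : ‖ip μ (X ^ s * (X * derivative (star Φ n))) (star Φ n)‖ ≤ K₁ * P ^ 2 / (n + 1) := by
    refine (hK₁ n (by omega) s le_rfl).trans ?_
    have hw := win_le_div hA0 hA (M := s + 1) (n := n) (by omega)
    have hw0 := win_nonneg α (s + 1) n
    calc K₁ * n * win α (s + 1) n ^ 2 ≤ K₁ * (n + 1) * (P / (n + 1)) ^ 2 := by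
          gcongr
          linarith
      _ = _ := by field_simp
  have b3 := hK₂ n
  have b5 : ∀ k, ‖(∑ i ∈ Finset.range s, (a k ^ (s - 1 - i) *
        ip μ (X ^ (i + 1) * star Φ n) (star Φ n) +
        a k ^ (s - i) * ip μ (X ^ i * star Φ n) (star Φ n))) -
        (if s = 0 then 0 else a k ^ s * nsq μ (Φ n))‖ ≤ s * (2 * (K₃ * s)) / (n + 1) := by
    intro k
    have e : (if s = 0 then 0 else a k ^ s * (nsq μ (Φ n) : ℂ)) =
        ∑ i ∈ Finset.range s, if i = 0 then a k ^ s * (nsq μ (Φ n) : ℂ) else 0 := by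
      rw [Finset.sum_ite_eq']
      rcases Nat.eq_zero_or_pos s with rfl | h0
      · simp
      · simp [h0, h0.ne']
    rw [e, ← Finset.sum_sub_distrib]
    refine (norm_sum_le _ _).trans ((Finset.sum_le_card_nsmul _ _ (2 * (K₃ * s) / (n + 1))
      fun i hi => ?_).trans_eq ?_)
    · have hi' := Finset.mem_range.1 hi
      have hb : ∀ j, 1 ≤ j → j ≤ s → ‖ip μ (X ^ j * star Φ n) (star Φ n)‖ ≤ K₃ * s / (n + 1) :=
        fun j hj hjs => (hstar j hj).trans (by gcongr)
      rw [add_sub_assoc]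
      have hn0 : 0 ≤ K₃ * s / (n + 1) := by positivity
      have c1 : ‖a k ^ (s - 1 - i) * ip μ (X ^ (i + 1) * star Φ n) (star Φ n)‖ ≤
          K₃ * s / (n + 1) := by
        rw [norm_mul, norm_pow, ha k, one_pow, one_mul]
        exact hb _ (by omega) (by omega)
      have c2 : ‖a k ^ (s - i) * ip μ (X ^ i * star Φ n) (star Φ n) -
          (if i = 0 then a k ^ s * (nsq μ (Φ n) : ℂ) else 0)‖ ≤ K₃ * s / (n + 1) := by
        rcases Nat.eq_zero_or_pos i with rfl | h0
        · rw [if_pos rfl, pow_zero, one_mul, ip_self, S.nsq_star, Nat.sub_zero, sub_self, norm_zero]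
          exact hn0
        · rw [if_neg h0.ne', sub_zero, norm_mul, norm_pow, ha k, one_pow, one_mul]
          exact hb _ h0 hi'.le
      refine (norm_add_le _ _).trans ((add_le_add c1 c2).trans_eq ?_)
      ring
    · rw [Finset.card_range, nsmul_eq_mul]; ring
  have b4 : ‖∑ k, (β k : ℂ) * ((∑ i ∈ Finset.range s, (a k ^ (s - 1 - i) *
        ip μ (X ^ (i + 1) * star Φ n) (star Φ n) +
        a k ^ (s - i) * ip μ (X ^ i * star Φ n) (star Φ n))) -
        (if s = 0 then 0 else a k ^ s * nsq μ (Φ n)))‖ ≤ K₅ / (n + 1) := by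
    rw [hK₅, Finset.sum_div]
    refine (norm_sum_le _ _).trans (Finset.sum_le_sum fun k _ => ?_)
    rw [norm_mul, Complex.norm_real, Real.norm_eq_abs, mul_div_assoc]
    gcongr
    exact b5 k
  have hsum := norm_add_le_of_le (norm_add_le_of_le (norm_add_le_of_le b1 b2) b3) b4
  rw [← add_div, ← add_div, ← add_div] at hsum
  refine le_trans (le_of_eq (congrArg norm ?_)) hsum
  rw [corr_eq]
  simp only [mul_sub, Finset.sum_sub_distrib]
  rcases Nat.eq_zero_or_pos s with rfl | h0
  · simp [hl.zero]; ring
  · simp only [if_neg h0.ne', sub_mul, Finset.sum_mul]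
    have e : ∀ k, (β k : ℂ) * a k ^ s * (nsq μ (Φ n) : ℂ) =
      (β k : ℂ) * (a k ^ s * (nsq μ (Φ n) : ℂ)) := fun k => by ring
    simp only [e]
    ring

/-- The Verblunsky coefficients in terms of the phases of the reversed polynomials. -/
lemma exists_norm_alpha_add_phase_le (S : System μ D₀ Φ α) {m : ℕ} {l : ℂ → ℂ} {c : ℕ → ℂ}
    {a : Fin m → ℂ} {β : Fin m → ℝ} (hP : PartsFormula μ l a β) (hl : LaurentSeries' l c)
    (ha : ∀ k, ‖a k‖ = 1) (ha' : Function.Injective a)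
    (hh : Tendsto (fun n => nsq μ (Φ n)) atTop (nhds (D₀ ^ 2)))
    (hY : ∀ s, Tendsto (fun n => ip μ (X ^ s * star Φ n) (X * derivative (star Φ n))) atTop
      (nhds ((if s = 0 then 0 else ∑ k, β k * a k ^ s - (starRingEnd ℂ) (c s)) * D₀ ^ 2))) :
    ∃ K : ℝ, 0 ≤ K ∧ ∃ N : ℕ, ∀ n : ℕ, N ≤ n →
      ‖n * α n + ∑ k, (β k : ℂ) * phase Φ (a k) n‖ ≤ K / (n + 1) := by
  obtain ⟨A, hA0, hA⟩ := S.exists_norm_alpha_le hP ha ha'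
  have hh0 := nsq_nonneg μ (Φ 0)
  set h₀ := nsq μ (Φ 0) with hh₀
  have hD : 0 < D₀ ^ 2 := pow_pos S.pos 2
  have hcorr : ∀ s, ∃ K : ℝ, 0 ≤ K ∧ ∀ n : ℕ, 2 * s + 2 ≤ n →
      ‖corr μ Φ l a β n s‖ ≤ K / (n + 1) := by
    intro s
    obtain ⟨K₁, hK₁0, hK₁⟩ := S.exists_norm_corr_add_le hA0 hA hl ha (β := β) s
    obtain ⟨K₂, hK₂0, hK₂⟩ := S.exists_norm_low_sub_le hA0 hA s
    have hK₃ := norm_sub_le_of_tendsto (N := 2 * s + 1) hK₂0 hK₂ (hY s)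
    have hK₄ := norm_sub_le_of_tendsto (x := fun n => nsq μ (Φ n)) (N := 0)
      (K := h₀ * A ^ 2) (by positivity) (fun n _ => S.norm_nsq_sub_le hA n) hh
    set t : ℂ := if s = 0 then 0 else ∑ k, β k * a k ^ s - (starRingEnd ℂ) (c s) with ht
    refine ⟨K₁ + 2 * K₂ + ‖t‖ * (2 * (h₀ * A ^ 2)), by positivity, fun n hn => ?_⟩
    have h1 := hK₁ n hn
    have h2 := hK₃ n (by omega)
    have h3 : ‖t * ((nsq μ (Φ n) : ℂ) - (D₀ : ℂ) ^ 2)‖ ≤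
        ‖t‖ * (2 * (h₀ * A ^ 2)) / (n + 1) := by
      rw [norm_mul, mul_div_assoc]
      gcongr
      have := hK₄ n (Nat.zero_le n)
      rw [← Complex.norm_real] at this
      simpa using this
    have h4 := norm_add_le_of_le (norm_sub_le_of_le h1 h2) h3
    rw [← add_div, ← add_div] at h4
    refine le_trans (le_of_eq (congrArg norm ?_)) h4
    ring
  choose K hK0 hK using hcorr
  obtain ⟨B, hB0, hB⟩ := exists_interpolation ha'
  obtain ⟨K₁, hK₁0, hK₁⟩ := S.exists_norm_ipw_star_le hA0 hA hl
  have hKs : 0 ≤ ∑ s ∈ Finset.range m, B * K s :=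
    Finset.sum_nonneg fun s _ => mul_nonneg hB0 (hK0 s)
  set b : ℝ := ‖(1 : ℂ) + ∑ k, (β k : ℂ)‖ with hb
  refine ⟨(K₁ + (∑ s ∈ Finset.range m, B * K s) + b * A * h₀) / D₀ ^ 2, by positivity,
    2 * m + 2, fun n hn => ?_⟩
  obtain ⟨v, hv, hv'⟩ := hB (fun k => phase Φ (a k) n) fun k => (S.norm_phase (ha k) n).le
  have hid := S.alpha_identity_sum hP ha n m v hv'
  have b1 := hK₁ n
  have b2 : ‖∑ s ∈ Finset.range m, v s * corr μ Φ l a β n s‖ ≤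
      (∑ s ∈ Finset.range m, B * K s) / (n + 1) := by
    rw [Finset.sum_div]
    refine (norm_sum_le _ _).trans (Finset.sum_le_sum fun s hs => ?_)
    have := Finset.mem_range.1 hs
    rw [norm_mul, mul_div_assoc]
    exact mul_le_mul (hv s) (hK s n (by omega)) (norm_nonneg _) hB0
  have b3 : ‖((1 : ℂ) + ∑ k, (β k : ℂ)) * α n * nsq μ (Φ n)‖ ≤ b * A * h₀ / (n + 1) := by
    rw [norm_mul, norm_mul, Complex.norm_real, Real.norm_of_nonneg (nsq_nonneg _ _)]
    calc _ ≤ b * (A / (n + 1)) * h₀ := by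
          have := hA n
          have := S.nsq_le n
          have := nsq_nonneg μ (Φ n)
          gcongr
      _ = _ := by ring
  have h4 := norm_sub_le_of_le (norm_sub_le_of_le b1 b2) b3
  rw [← add_div, ← add_div] at h4
  have e : ipw μ l (star Φ n) (X * Φ n) - (∑ s ∈ Finset.range m, v s * corr μ Φ l a β n s) -
      ((1 : ℂ) + ∑ k, (β k : ℂ)) * α n * nsq μ (Φ n) =
      (n * α n + ∑ k, (β k : ℂ) * phase Φ (a k) n) * nsq μ (Φ n) := by
    linear_combination -hid
  rw [e, norm_mul, Complex.norm_real, Real.norm_of_nonneg (nsq_nonneg _ _)] at h4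
  rw [div_right_comm, le_div_iff₀ hD]
  refine le_trans ?_ h4
  gcongr
  exact S.le_nsq n

end System

lemma exists_tendsto_of_norm_sub_le {y : ℕ → ℂ} {C : ℝ} {N₀ : ℕ} (hC : 0 ≤ C)
    (h : ∀ n, N₀ ≤ n → ‖y (n + 1) - y n‖ ≤ C / (n + 1) ^ 2 * ‖y n‖) :
    ∃ Y K : ℝ, ∃ y₀ : ℂ, 0 ≤ K ∧ 0 ≤ Y ∧ Tendsto y atTop (nhds y₀) ∧
      ∀ n, N₀ + 1 ≤ n → ‖y n - y₀‖ ≤ K / (n + 1) := by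
  have hb : ∀ j : ℕ, ‖y (N₀ + 1 + j)‖ ≤
      ‖y (N₀ + 1)‖ * Real.exp (C * (1 / (N₀ + 1) - 1 / (N₀ + 1 + j))) := by
    intro j
    induction j with
    | zero => simp
    | succ j ih =>
      have h1 := h (N₀ + 1 + j) (by omega)
      have h2 : ‖y (N₀ + 1 + (j + 1))‖ ≤ (1 + C / ((N₀ + 1 + j : ℕ) + 1) ^ 2) * ‖y (N₀ + 1 + j)‖ := by
        have := norm_le_norm_add_norm_sub' (y (N₀ + 1 + j + 1)) (y (N₀ + 1 + j))
        rw [← add_assoc]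
        linarith
      have h3 : 1 + C / ((N₀ + 1 + j : ℕ) + 1) ^ 2 ≤
          Real.exp (C * (1 / (N₀ + 1 + j) - 1 / (N₀ + 1 + (j + 1)))) := by
        refine le_trans ?_ (Real.add_one_le_exp _)
        rw [add_comm, add_le_add_iff_right, div_eq_mul_inv]
        refine mul_le_mul_of_nonneg_left ?_ hC
        have hp : (0 : ℝ) < N₀ + 1 + j := by positivity
        push_cast
        rw [div_sub_div _ _ hp.ne' (by positivity), inv_eq_one_div, div_le_div_iff₀ (by positivity)
          (by positivity)]
        nlinarith
      calc _ ≤ _ := h2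
        _ ≤ Real.exp (C * (1 / (N₀ + 1 + j) - 1 / (N₀ + 1 + (j + 1)))) *
            (‖y (N₀ + 1)‖ * Real.exp (C * (1 / (N₀ + 1) - 1 / (N₀ + 1 + j)))) := by
          gcongr
        _ = _ := by
          rw [mul_left_comm, ← Real.exp_add]
          congr 2
          push_cast
          ring
  set Y := ‖y (N₀ + 1)‖ * Real.exp C with hY
  have hY0 : 0 ≤ Y := by positivity
  have hb' : ∀ n, N₀ + 1 ≤ n → ‖y n‖ ≤ Y := by
    intro n hn
    obtain ⟨j, rfl⟩ := Nat.exists_eq_add_of_le hn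
    refine (hb j).trans ?_
    rw [hY]
    gcongr
    have h1 : (1 : ℝ) / (N₀ + 1) ≤ 1 := by
      rw [div_le_one (by positivity)]
      linarith [(Nat.cast_nonneg N₀ : (0 : ℝ) ≤ N₀)]
    have h2 : (0 : ℝ) ≤ 1 / (N₀ + 1 + j) := by positivity
    nlinarith
  have hd : ∀ n, N₀ + 1 ≤ n → ‖y (n + 1) - y n‖ ≤ (C * Y) / (n + 1) ^ 2 := by
    intro n hn
    refine (h n (by omega)).trans ?_
    rw [mul_div_right_comm]
    gcongr
    exact hb' n hn
  have hs : Summable fun n : ℕ => (C * Y) / ((n : ℝ) + 1) ^ 2 := by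
    have := (summable_nat_add_iff 1).2 (Real.summable_nat_pow_inv.2 (by norm_num : 1 < 2))
    simpa [div_eq_mul_inv] using this.mul_left (C * Y)
  have hc : CauchySeq fun n => y (n + (N₀ + 1)) := by
    refine cauchySeq_of_dist_le_of_summable _ (fun n => ?_) ((summable_nat_add_iff (N₀ + 1)).2 hs)
    rw [dist_comm, dist_eq_norm]
    have := hd (n + (N₀ + 1)) (by omega)
    rw [add_right_comm] at this
    exact this
  obtain ⟨y₀, hy₀⟩ := cauchySeq_tendsto_of_complete hc
  have hy := (tendsto_add_atTop_iff_nat (N₀ + 1)).1 hy₀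
  exact ⟨Y, 2 * (C * Y), y₀, by positivity, hY0, hy, norm_sub_le_of_tendsto (by positivity) hd hy⟩

lemma exists_tendsto_ne_zero {y : ℕ → ℂ} {C : ℝ} {N₀ : ℕ} (hC : 0 ≤ C) (hy : ∀ n, y n ≠ 0)
    (h : ∀ n, N₀ ≤ n → ‖y (n + 1) / y n - 1‖ ≤ C / (n + 1) ^ 2) :
    ∃ K : ℝ, ∃ y₀ : ℂ, ∃ N : ℕ, 0 ≤ K ∧ y₀ ≠ 0 ∧ Tendsto y atTop (nhds y₀) ∧
      ∀ n, N ≤ n → ‖y n - y₀‖ ≤ K / (n + 1) := by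
  have h1 : ∀ n, N₀ ≤ n → ‖y (n + 1) - y n‖ ≤ C / (n + 1) ^ 2 * ‖y n‖ := by
    intro n hn
    have h2 : y (n + 1) - y n = (y (n + 1) / y n - 1) * y n := by
      have := hy n
      field_simp
    rw [h2, norm_mul]
    gcongr
    exact h n hn
  obtain ⟨N₁, hN₁⟩ := exists_nat_ge (2 * C)
  have h2 : ∀ n, N₀ + N₁ ≤ n → ‖(y (n + 1))⁻¹ - (y n)⁻¹‖ ≤ (2 * C) / (n + 1) ^ 2 * ‖(y n)⁻¹‖ := by
    intro n hn
    have h3 := h n (by omega)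
    have h4 : (y (n + 1))⁻¹ - (y n)⁻¹ =
        -(y (n + 1) / y n - 1) * (y (n + 1) / y n)⁻¹ * (y n)⁻¹ := by
      have := hy n
      have := hy (n + 1)
      field_simp
      ring
    have h5 : (1 : ℝ) / 2 ≤ ‖y (n + 1) / y n‖ := by
      have h6 : C / ((n : ℝ) + 1) ^ 2 ≤ 1 / 2 := by
        rw [div_le_div_iff₀ (by positivity) (by norm_num)]
        have : (N₁ : ℝ) ≤ n := by exact_mod_cast (by omega : N₁ ≤ n)
        nlinarith [(Nat.cast_nonneg n : (0 : ℝ) ≤ n)]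
      have h7 := norm_sub_norm_le (1 : ℂ) (1 - y (n + 1) / y n)
      rw [norm_sub_rev 1 (y (n + 1) / y n), sub_sub_cancel, norm_one] at h7
      linarith
    rw [h4, norm_mul, norm_mul, norm_neg]
    gcongr
    rw [norm_inv, mul_comm 2 C, mul_div_right_comm]
    gcongr
    · rw [inv_le_comm₀ (by linarith) (by norm_num)]
      linarith
  obtain ⟨Y, K, y₀, hK, _, ht, hy₀⟩ := exists_tendsto_of_norm_sub_le hC h1
  obtain ⟨_, _, z₀, _, _, hz, _⟩ :=
    exists_tendsto_of_norm_sub_le (y := fun n => (y n)⁻¹) (by positivity) h2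
  refine ⟨K, y₀, N₀ + 1, hK, ?_, ht, hy₀⟩
  rintro rfl
  have h3 := ht.mul hz
  simp only [mul_inv_cancel₀ (hy _), zero_mul] at h3
  exact one_ne_zero (tendsto_nhds_unique tendsto_const_nhds h3)

/-- The increments `g` agree with `β / (n + 1)` up to a small telescoping term and a summable
error. -/
structure Increments (g τ : ℕ → ℂ) (β A : ℝ) : Prop where
  nonneg : 0 ≤ A
  norm_g : ∀ n, ‖g n‖ ≤ A / (n + 1)
  norm_tau : ∀ n, ‖τ n‖ ≤ A / (n + 1)
  norm_sub : ∀ n, ‖g n - β / (n + 1) - (τ (n + 1) - τ n)‖ ≤ A / (n + 1) ^ 2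

lemma norm_exp_neg_sub_one_add_le {z : ℂ} (hz : ‖z‖ ≤ 1) :
    ‖Complex.exp (-z) - 1 + z‖ ≤ ‖z‖ ^ 2 := by
  have := Complex.norm_exp_sub_one_sub_id_le (x := -z) (by simpa using hz)
  simpa using this

lemma abs_log_sub_le (n : ℕ) :
    |Real.log (n + 2) - Real.log (n + 1) - 1 / (n + 1)| ≤ 1 / ((n : ℝ) + 1) ^ 2 := by
  have hn : (0 : ℝ) < n + 1 := by positivity
  have h1 : Real.log (n + 2) - Real.log (n + 1) = Real.log ((n + 2) / (n + 1)) := by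
    rw [Real.log_div (by positivity) hn.ne']
  have h2 := Real.log_le_sub_one_of_pos (x := ((n : ℝ) + 2) / (n + 1)) (by positivity)
  have h3 := Real.one_sub_inv_le_log_of_pos (x := ((n : ℝ) + 2) / (n + 1)) (by positivity)
  have h4 : ((n : ℝ) + 2) / (n + 1) - 1 = 1 / (n + 1) := by field_simp; ring
  have h5 : 1 - (((n : ℝ) + 2) / (n + 1))⁻¹ = 1 / (n + 2) := by field_simp; ring
  have h6 : (1 : ℝ) / (n + 1) - 1 / (n + 2) ≤ 1 / ((n : ℝ) + 1) ^ 2 := by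
    rw [div_sub_div _ _ hn.ne' (by positivity), div_le_div_iff₀ (by positivity) (by positivity)]
    nlinarith
  rw [h1, abs_le]
  constructor <;> [linarith; (have : (0:ℝ) ≤ 1 / ((n : ℝ) + 1) ^ 2 := by positivity)]
  linarith

lemma Increments.exists_tendsto {g τ : ℕ → ℂ} {β A : ℝ} (hI : Increments g τ β A) {u : ℕ → ℂ}
    (hu : ∀ n, u n ≠ 0) (hg : ∀ n, u (n + 1) = u n * (1 + g n)) :
    ∃ K : ℝ, ∃ U : ℂ, ∃ N : ℕ, 0 ≤ K ∧ U ≠ 0 ∧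
      Tendsto (fun n : ℕ => u n * (Real.exp (-(β * Real.log (n + 1))) : ℝ)) atTop (nhds U) ∧
      ∀ n : ℕ, N ≤ n → ‖u n * (Real.exp (-(β * Real.log (n + 1))) : ℝ) - U‖ ≤ K / (n + 1) := by
  have hA := hI.nonneg
  set y : ℕ → ℂ := fun n => u n * Complex.exp (-(β * Real.log (n + 1)) - τ n) with hy
  set e : ℕ → ℂ := fun n => β * (Real.log (n + 2) - Real.log (n + 1)) + (τ (n + 1) - τ n) with he
  have hyr : ∀ n, y (n + 1) / y n = (1 + g n) * Complex.exp (-e n) := by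
    intro n
    simp only [hy, he]
    rw [hg, mul_div_mul_comm, mul_div_cancel_left₀ _ (hu n), ← Complex.exp_sub]
    congr 2
    push_cast
    rw [add_assoc, one_add_one_eq_two]
    ring
  set B := A + |β| with hB
  have hB0 : 0 ≤ B := by positivity
  have he1 : ∀ n, ‖g n - e n‖ ≤ B / (n + 1) ^ 2 := by
    intro n
    have h1 : g n - e n = (g n - β / (n + 1) - (τ (n + 1) - τ n)) -
        ((β * (Real.log (n + 2) - Real.log (n + 1) - 1 / (n + 1)) : ℝ) : ℂ) := by
      simp only [he]; push_cast; ring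
    rw [h1, hB, add_div]
    refine norm_sub_le_of_le (hI.norm_sub n) ?_
    rw [Complex.norm_real, norm_mul, Real.norm_eq_abs, Real.norm_eq_abs, div_eq_mul_one_div |β|]
    gcongr
    exact abs_log_sub_le n
  have he2 : ∀ n, ‖e n‖ ≤ (A + B) / (n + 1) := by
    intro n
    have h1 : e n = g n - (g n - e n) := by ring
    rw [h1, add_div]
    refine norm_sub_le_of_le (hI.norm_g n) ((he1 n).trans ?_)
    gcongr
    nlinarith [(Nat.cast_nonneg n : (0 : ℝ) ≤ n)]
  obtain ⟨N₀, hN₀⟩ := exists_nat_ge (A + B)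
  have hr : ∀ n, N₀ ≤ n → ‖y (n + 1) / y n - 1‖ ≤
      (B + A * (A + B) + (1 + A) * (A + B) ^ 2) / (n + 1) ^ 2 := by
    intro n hn
    have h1 : ‖e n‖ ≤ 1 := by
      refine (he2 n).trans ?_
      rw [div_le_one (by positivity)]
      have : (N₀ : ℝ) ≤ n := by exact_mod_cast hn
      linarith
    have h2 := norm_exp_neg_sub_one_add_le h1
    have h3 : y (n + 1) / y n - 1 =
        (g n - e n) - g n * e n + (1 + g n) * (Complex.exp (-e n) - 1 + e n) := by
      rw [hyr]; ring
    have h4 : ‖g n * e n‖ ≤ A * (A + B) / (n + 1) ^ 2 := by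
      rw [norm_mul, pow_two, mul_div_mul_comm]
      have := hI.norm_g n
      have := he2 n
      gcongr
    have h5 : ‖1 + g n‖ ≤ 1 + A := by
      refine norm_add_le_of_le (by simp) ((hI.norm_g n).trans ?_)
      exact div_le_self hA (by linarith [(Nat.cast_nonneg n : (0 : ℝ) ≤ n)])
    rw [h3, add_div, add_div]
    refine norm_add_le_of_le (norm_sub_le_of_le (he1 n) h4) ?_
    rw [norm_mul, mul_div_assoc, ← div_pow]
    gcongr
    refine h2.trans ?_
    gcongr
    exact he2 n
  have hy0 : ∀ n, y n ≠ 0 := fun n => mul_ne_zero (hu n) (Complex.exp_ne_zero _)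
  obtain ⟨K, U, N, hK, hU, hT, hN⟩ := exists_tendsto_ne_zero (by positivity) hy0 hr
  have hx : ∀ n : ℕ, u n * (Real.exp (-(β * Real.log (n + 1))) : ℝ) = y n * Complex.exp (τ n) := by
    intro n
    simp only [hy]
    rw [mul_assoc, ← Complex.exp_add]
    push_cast
    congr 2
    ring
  have hτ : Tendsto τ atTop (nhds 0) := by
    refine squeeze_zero_norm hI.norm_tau ?_
    have := (tendsto_one_div_add_atTop_nhds_zero_nat (𝕜 := ℝ)).const_mul A
    simpa [div_eq_mul_inv] using this
  obtain ⟨N₁, hN₁⟩ := exists_nat_ge A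
  refine ⟨K * Real.exp 1 + ‖U‖ * (2 * A), U, N + N₁, by positivity, hU, ?_, fun n hn => ?_⟩
  · simp only [hx]
    simpa using hT.mul ((Complex.continuous_exp.tendsto 0).comp hτ)
  · have h1 : ‖τ n‖ ≤ 1 := by
      refine (hI.norm_tau n).trans ?_
      rw [div_le_one (by positivity)]
      have : (N₁ : ℝ) ≤ n := by exact_mod_cast (by omega : N₁ ≤ n)
      linarith
    have h2 : ‖Complex.exp (τ n) - 1‖ ≤ 2 * ‖τ n‖ := Complex.norm_exp_sub_one_le h1
    have h3 : ‖Complex.exp (τ n)‖ ≤ Real.exp 1 := by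
      rw [Complex.norm_exp]
      exact Real.exp_le_exp.2 ((Complex.re_le_norm _).trans h1)
    have h4 : y n * Complex.exp (τ n) - U =
        (y n - U) * Complex.exp (τ n) + U * (Complex.exp (τ n) - 1) := by ring
    rw [hx, h4, add_div]
    refine norm_add_le_of_le ?_ ?_
    · rw [norm_mul, mul_div_right_comm]
      have := hN n (by omega)
      gcongr
    · rw [norm_mul, mul_div_assoc, mul_div_assoc]
      have := hI.norm_tau n
      have h5 := h2.trans (mul_le_mul_of_nonneg_left this zero_le_two)
      gcongr

lemma norm_div_conj_sub_le {x U : ℂ} (hx : x ≠ 0) (hU : U ≠ 0) :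
    ‖x / (starRingEnd ℂ) x - U / (starRingEnd ℂ) U‖ ≤ 2 / ‖U‖ * ‖x - U‖ := by
  have hx' := (map_ne_zero (starRingEnd ℂ)).2 hx
  have hU' := (map_ne_zero (starRingEnd ℂ)).2 hU
  have hxn := norm_pos_iff.2 hx
  have hUn := norm_pos_iff.2 hU
  have h1 : x / (starRingEnd ℂ) x - U / (starRingEnd ℂ) U =
      ((starRingEnd ℂ) x * (x - U) - x * (starRingEnd ℂ) (x - U)) /
        ((starRingEnd ℂ) x * (starRingEnd ℂ) U) := by
    rw [map_sub]
    field_simp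
    ring
  rw [h1, norm_div, norm_mul, RCLike.norm_conj, RCLike.norm_conj, div_le_iff₀ (by positivity)]
  refine (norm_sub_le _ _).trans (le_of_eq ?_)
  rw [norm_mul, norm_mul, RCLike.norm_conj, RCLike.norm_conj]
  field_simp
  ring

structure Weights (g : ℕ → ℂ) (ω : ℕ → ℝ) (C : ℝ) : Prop where
  lt_one : ∀ n, ‖g n‖ < 1
  pos : ∀ n, 0 < ω n
  step : ∀ n, ω (n + 1) * (1 - ‖g n‖ ^ 2) = ω n * ‖1 + g n‖ ^ 2
  sum_le : ∀ n : ℕ, ∑ i ∈ Finset.range (n + 1), ω i ≤ C * (n + 1) * ω n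

/-- The recursion satisfied by the normalized values of the orthogonal polynomials at a point of
modulus `r`. -/
structure Ladder (g : ℕ → ℂ) (r : ℝ) (P Q : ℕ → ℂ) : Prop where
  left_zero : P 0 = 1
  right_zero : Q 0 = 1
  left_succ : ∀ n, P (n + 1) * (1 + g n) = P n + r * g n * Q n
  right_succ : ∀ n, Q (n + 1) * (1 + (starRingEnd ℂ) (g n)) = r * Q n + (starRingEnd ℂ) (g n) * P n

lemma Weights.ne_zero {g : ℕ → ℂ} {ω : ℕ → ℝ} {C : ℝ} (hW : Weights g ω C) (n : ℕ) :
    1 + g n ≠ 0 := by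
  intro h
  have h1 : g n = -1 := by linear_combination h
  have := hW.lt_one n
  rw [h1] at this
  simp at this

lemma Weights.nonneg {g : ℕ → ℂ} {ω : ℕ → ℝ} {C : ℝ} (hW : Weights g ω C) : 0 ≤ C := by
  have := hW.sum_le 0
  have := hW.pos 0
  simp at *
  nlinarith

lemma Weights.norm_le {g : ℕ → ℂ} {ω : ℕ → ℝ} {C : ℝ} (hW : Weights g ω C) {E : Type*}
    [NormedAddCommGroup E] [NormedSpace ℝ E] {x : E} {y : ℕ → E} {n : ℕ} {η b : ℝ} (hη : 0 ≤ η)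
    (hb : 0 ≤ b)
    (h : ω n • x = η • ∑ i ∈ Finset.range (n + 1), ω i • y i) (hy : ∀ i ≤ n, ‖y i‖ ≤ b) :
    ‖x‖ ≤ η * C * (n + 1) * b := by
  have h1 : ω n * ‖x‖ ≤ ω n * (η * C * (n + 1) * b) := by
    calc ω n * ‖x‖ = ‖ω n • x‖ := by rw [norm_smul, Real.norm_of_nonneg (hW.pos n).le]
      _ ≤ η * ∑ i ∈ Finset.range (n + 1), ω i * b := by
        rw [h, norm_smul, Real.norm_of_nonneg hη]
        refine mul_le_mul_of_nonneg_left ((norm_sum_le _ _).trans ?_) hη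
        refine Finset.sum_le_sum fun i hi => ?_
        rw [norm_smul, Real.norm_of_nonneg (hW.pos i).le]
        exact mul_le_mul_of_nonneg_left (hy i (by have := Finset.mem_range.1 hi; omega))
          (hW.pos i).le
      _ ≤ η * (C * (n + 1) * ω n * b) := by
        rw [← Finset.sum_mul]
        have := hW.sum_le n
        gcongr
      _ = _ := by ring
  exact le_of_mul_le_mul_left h1 (hW.pos n)

lemma gronwall {x : ℕ → ℝ} {f δ : ℝ} {N : ℕ} (hf : 0 ≤ f) (hδ : 0 ≤ δ)
    (h : ∀ n ≤ N, ∀ M : ℕ → ℝ, (∀ i < n, ∀ j ≤ i, x j ≤ M i) →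
      x n ≤ f + ∑ i ∈ Finset.range n, δ * M i) :
    ∀ n ≤ N, x n ≤ f * (1 + δ) ^ n := by
  have h1 : ∀ n : ℕ, f + ∑ i ∈ Finset.range n, δ * (f * (1 + δ) ^ i) = f * (1 + δ) ^ n := by
    intro n
    induction n with
    | zero => simp
    | succ n ih => rw [Finset.sum_range_succ, ← add_assoc, ih]; ring
  intro n
  induction n using Nat.strong_induction_on with
  | _ n ih =>
    intro hn
    rw [← h1]
    refine h n hn _ fun i hi j hj => (ih j (by omega) (by omega)).trans ?_
    gcongr
    linarith

namespace Ladder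

variable {g : ℕ → ℂ} {r : ℝ} {P Q : ℕ → ℂ} {ω : ℕ → ℝ} {C : ℝ}

noncomputable def coef (g : ℕ → ℂ) (n : ℕ) : ℂ :=
  (starRingEnd ℂ) (g n) / (1 + (starRingEnd ℂ) (g n))

lemma right_sub (hL : Ladder g r P Q) (hW : Weights g ω C) (n : ℕ) :
    Q (n + 1) - Q n = coef g n * (P n - r * Q n) - ((1 - r : ℝ) : ℂ) * Q n := by
  have h1 : 1 + (starRingEnd ℂ) (g n) ≠ 0 := by
    have := (map_ne_zero (starRingEnd ℂ)).2 (hW.ne_zero n)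
    simpa using this
  have h2 : Q (n + 1) = (r * Q n + (starRingEnd ℂ) (g n) * P n) / (1 + (starRingEnd ℂ) (g n)) := by
    rw [← hL.right_succ n, mul_div_cancel_right₀ _ h1]
  rw [h2, coef]
  push_cast
  field_simp
  ring

lemma weighted_succ (hL : Ladder g r P Q) (hW : Weights g ω C) (n : ℕ) :
    (ω (n + 1) : ℂ) * (P (n + 1) - Q (n + 1)) = ω n * (P n - r * Q n) := by
  have h0 := hW.ne_zero n
  have h1 : 1 + (starRingEnd ℂ) (g n) ≠ 0 := by
    have := (map_ne_zero (starRingEnd ℂ)).2 h0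
    simpa using this
  have h2 : ((‖g n‖ ^ 2 : ℝ) : ℂ) = g n * (starRingEnd ℂ) (g n) := by
    rw [Complex.mul_conj, Complex.normSq_eq_norm_sq]
  have h3 : ((‖1 + g n‖ ^ 2 : ℝ) : ℂ) = (1 + g n) * (1 + (starRingEnd ℂ) (g n)) := by
    rw [← Complex.normSq_eq_norm_sq, ← Complex.mul_conj]; simp
  have h4 : (ω (n + 1) : ℂ) * (1 - g n * (starRingEnd ℂ) (g n)) =
      ω n * ((1 + g n) * (1 + (starRingEnd ℂ) (g n))) := by
    rw [← h2, ← h3]; exact_mod_cast hW.step n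
  have h5 : (P (n + 1) - Q (n + 1)) * ((1 + g n) * (1 + (starRingEnd ℂ) (g n))) =
      (1 - g n * (starRingEnd ℂ) (g n)) * (P n - r * Q n) := by
    linear_combination (1 + (starRingEnd ℂ) (g n)) * hL.left_succ n - (1 + g n) * hL.right_succ n
  refine mul_right_cancel₀ (mul_ne_zero h0 h1) ?_
  rw [mul_assoc, h5]
  linear_combination (P n - r * Q n) * h4

lemma weighted_sum (hL : Ladder g r P Q) (hW : Weights g ω C) (n : ℕ) :
    ω n • (P n - r * Q n) = (1 - r) • ∑ i ∈ Finset.range (n + 1), ω i • Q i := by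
  induction n with
  | zero =>
    simp [hL.left_zero, hL.right_zero]
    ring
  | succ n ih =>
    rw [Finset.sum_range_succ, smul_add, ← ih]
    have := hL.weighted_succ hW n
    simp only [Complex.real_smul]
    push_cast
    linear_combination this

lemma norm_le (hL : Ladder g r P Q) (hW : Weights g ω C) (hr : r ≤ 1) {n : ℕ} {b : ℝ}
    (h : ∀ i ≤ n, ‖Q i‖ ≤ b) : ‖P n - r * Q n‖ ≤ (1 - r) * C * (n + 1) * b :=
  hW.norm_le (by linarith) ((norm_nonneg _).trans (h 0 (Nat.zero_le _))) (hL.weighted_sum hW n) h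

lemma abs_im_le (hL : Ladder g r P Q) (hW : Weights g ω C) (hr : r ≤ 1) {n : ℕ} {b : ℝ}
    (h : ∀ i ≤ n, |(Q i).im| ≤ b) : |(P n - r * Q n).im| ≤ (1 - r) * C * (n + 1) * b := by
  refine hW.norm_le (y := fun i => (Q i).im) (by linarith)
    ((abs_nonneg _).trans (h 0 (Nat.zero_le _))) ?_ h
  have := congrArg Complex.im (hL.weighted_sum hW n)
  simpa only [Complex.smul_im, Complex.im_sum] using this

lemma right_eq (hL : Ladder g r P Q) (hW : Weights g ω C) (n : ℕ) :
    Q n = 1 + ∑ i ∈ Finset.range n, (coef g i * (P i - r * Q i) - ((1 - r : ℝ) : ℂ) * Q i) := by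
  simp_rw [← hL.right_sub hW, Finset.sum_range_sub, hL.right_zero]
  ring

lemma norm_right_le (hL : Ladder g r P Q) (hW : Weights g ω C) (hr : r ≤ 1) {A : ℝ}
    (hA : 0 ≤ A) (hg : ∀ n, ‖coef g n‖ ≤ A / (n + 1)) (n : ℕ) :
    ‖Q n‖ ≤ (1 + (1 - r) * (A * C + 1)) ^ n := by
  have hC := hW.nonneg
  have hη : 0 ≤ 1 - r := by linarith
  have := gronwall (x := fun n => ‖Q n‖) (f := 1) (δ := (1 - r) * (A * C + 1)) (N := n)
    zero_le_one (by positivity) (fun k _ M hM => ?_) n le_rfl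
  · simpa using this
  · rw [hL.right_eq hW k]
    refine norm_add_le_of_le (by simp) ((norm_sum_le _ _).trans (Finset.sum_le_sum fun i hi => ?_))
    have hi := Finset.mem_range.1 hi
    have h1 := hL.norm_le hW hr (hM i hi)
    have h2 : ‖((1 - r : ℝ) : ℂ) * Q i‖ ≤ (1 - r) * M i := by
      rw [norm_mul, Complex.norm_real, Real.norm_of_nonneg hη]
      exact mul_le_mul_of_nonneg_left (hM i hi i le_rfl) hη
    have h3 : ‖coef g i * (P i - r * Q i)‖ ≤ A / (i + 1) * ((1 - r) * C * (i + 1) * M i) := by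
      rw [norm_mul]
      exact mul_le_mul (hg i) h1 (norm_nonneg _) (by positivity)
    refine (norm_sub_le_of_le h3 h2).trans (le_of_eq ?_)
    field_simp

lemma abel_sum (t s : ℕ → ℝ) (n : ℕ) :
    ∑ i ∈ Finset.range n, (t (i + 1) - t i) * s i =
      t n * s n - t 0 * s 0 - ∑ i ∈ Finset.range n, t (i + 1) * (s (i + 1) - s i) := by
  induction n with
  | zero => simp
  | succ n ih => rw [Finset.sum_range_succ, Finset.sum_range_succ, ih]; ring

lemma norm_sub_le (hL : Ladder g r P Q) (hW : Weights g ω C) (hr : r ≤ 1) {A b : ℝ}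
    (hA : 0 ≤ A) (hκ : ∀ n, |(1 - ‖g n‖ ^ 2) / ‖1 + g n‖ ^ 2 - 1| ≤ A / (n + 1)) {n : ℕ}
    (h : ∀ i ≤ n + 1, ‖Q i‖ ≤ b) :
    ‖(P (n + 1) - r * Q (n + 1)) - (P n - r * Q n)‖ ≤ (1 - r) * (A * C + 1) * b := by
  have hη : 0 ≤ 1 - r := by linarith
  have hC := hW.nonneg
  have h0 := hW.ne_zero n
  have hb : 0 ≤ b := (norm_nonneg _).trans (h 0 (Nat.zero_le _))
  have h1 : P (n + 1) - Q (n + 1) =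
      (((1 - ‖g n‖ ^ 2) / ‖1 + g n‖ ^ 2 : ℝ) : ℂ) * (P n - r * Q n) := by
    have h2 := hL.weighted_succ hW n
    have h3 := (hW.pos n).ne'
    have h4 := (hW.pos (n + 1)).ne'
    have h5 : (1 - ‖g n‖ ^ 2) / ‖1 + g n‖ ^ 2 = ω n / ω (n + 1) := by
      rw [div_eq_div_iff (pow_ne_zero _ (norm_ne_zero_iff.2 h0)) h4, ← hW.step n]
      ring
    have h6 : (ω (n + 1) : ℂ) ≠ 0 := by exact_mod_cast h4
    rw [h5]
    push_cast
    rw [div_mul_eq_mul_div, ← h2, mul_div_cancel_left₀ _ h6]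
  have h2 : (P (n + 1) - r * Q (n + 1)) - (P n - r * Q n) =
      (((1 - ‖g n‖ ^ 2) / ‖1 + g n‖ ^ 2 - 1 : ℝ) : ℂ) * (P n - r * Q n) +
        ((1 - r : ℝ) : ℂ) * Q (n + 1) := by
    rw [Complex.ofReal_sub ((1 - ‖g n‖ ^ 2) / ‖1 + g n‖ ^ 2), sub_mul, ← h1]
    push_cast
    ring
  have h3 := hL.norm_le hW hr (n := n) (b := b) fun i hi => h i (by omega)
  rw [h2]
  have e : (1 - r) * (A * C + 1) * b = A / (n + 1) * ((1 - r) * C * (n + 1) * b) + (1 - r) * b := by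
    field_simp
  rw [e]
  refine norm_add_le_of_le ?_ ?_
  · rw [norm_mul, Complex.norm_real]
    exact mul_le_mul (hκ n) h3 (norm_nonneg _) (by positivity)
  · rw [norm_mul, Complex.norm_real, Real.norm_of_nonneg hη]
    exact mul_le_mul_of_nonneg_left (h _ le_rfl) hη

lemma abs_sum_im_le (hL : Ladder g r P Q) (hW : Weights g ω C) (hr : r ≤ 1) {A b : ℝ}
    (hA : 0 ≤ A) (hκ : ∀ n, |(1 - ‖g n‖ ^ 2) / ‖1 + g n‖ ^ 2 - 1| ≤ A / (n + 1))
    {t : ℕ → ℝ} (ht : ∀ n, |t n| ≤ A / (n + 1))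
    (hc : ∀ n, |(coef g n).im + (t (n + 1) - t n)| ≤ A / (n + 1) ^ 2) {n : ℕ}
    (h : ∀ i ≤ n, ‖Q i‖ ≤ b) :
    |∑ i ∈ Finset.range n, (coef g i).im * (P i - r * Q i).re| ≤
      (1 - r) * b * (2 * A * C + A * (A * C + 1 + C) * ∑ i ∈ Finset.range n, 1 / ((i : ℝ) + 1)) := by
  have hη : 0 ≤ 1 - r := by linarith
  have hC := hW.nonneg
  have hb : 0 ≤ b := (norm_nonneg _).trans (h 0 (Nat.zero_le _))
  set s : ℕ → ℝ := fun i => (P i - r * Q i).re with hs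
  have hsb : ∀ i ≤ n, |s i| ≤ (1 - r) * C * (i + 1) * b := fun i hi =>
    (Complex.abs_re_le_norm _).trans (hL.norm_le hW hr fun j hj => h j (by omega))
  have hts : ∀ i ≤ n, |t i * s i| ≤ (1 - r) * b * (A * C) := by
    intro i hi
    rw [abs_mul]
    refine (mul_le_mul (ht i) (hsb i hi) (abs_nonneg _) (by positivity)).trans (le_of_eq ?_)
    field_simp
  have e1 : ∑ i ∈ Finset.range n, (coef g i).im * s i =
      (∑ i ∈ Finset.range n, ((coef g i).im + (t (i + 1) - t i)) * s i) -
        (t n * s n - t 0 * s 0 - ∑ i ∈ Finset.range n, t (i + 1) * (s (i + 1) - s i)) := by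
    rw [← abel_sum, ← Finset.sum_sub_distrib]
    exact Finset.sum_congr rfl fun i _ => by ring
  have b1 : |∑ i ∈ Finset.range n, ((coef g i).im + (t (i + 1) - t i)) * s i| ≤
      (1 - r) * b * (A * C) * ∑ i ∈ Finset.range n, 1 / ((i : ℝ) + 1) := by
    rw [Finset.mul_sum]
    refine (Finset.abs_sum_le_sum_abs _ _).trans (Finset.sum_le_sum fun i hi => ?_)
    have hi := Finset.mem_range.1 hi
    rw [abs_mul]
    refine (mul_le_mul (hc i) (hsb i hi.le) (abs_nonneg _) (by positivity)).trans (le_of_eq ?_)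
    field_simp
  have b2 : |∑ i ∈ Finset.range n, t (i + 1) * (s (i + 1) - s i)| ≤
      (1 - r) * b * (A * (A * C + 1)) * ∑ i ∈ Finset.range n, 1 / ((i : ℝ) + 1) := by
    rw [Finset.mul_sum]
    refine (Finset.abs_sum_le_sum_abs _ _).trans (Finset.sum_le_sum fun i hi => ?_)
    have hi := Finset.mem_range.1 hi
    have h1 : |s (i + 1) - s i| ≤ (1 - r) * (A * C + 1) * b := by
      refine le_trans ?_ (hL.norm_sub_le hW hr hA hκ (n := i) fun j hj => h j (by omega))
      rw [hs, ← Complex.sub_re]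
      exact Complex.abs_re_le_norm _
    have h2 : |t (i + 1)| ≤ A / (i + 1) := by
      refine (ht _).trans ?_
      gcongr
      linarith
    rw [abs_mul]
    refine (mul_le_mul h2 h1 (abs_nonneg _) (by positivity)).trans (le_of_eq ?_)
    field_simp
  rw [e1]
  have b3 := hts n le_rfl
  have b4 := hts 0 (Nat.zero_le _)
  rw [abs_le] at *
  constructor <;> linarith [b1.1, b1.2, b2.1, b2.2, b3.1, b3.2, b4.1, b4.2]

lemma abs_im_right_le (hL : Ladder g r P Q) (hW : Weights g ω C) (hr : r ≤ 1) {A f : ℝ}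
    (hA : 0 ≤ A) (hg : ∀ n, ‖coef g n‖ ≤ A / (n + 1)) {N : ℕ}
    (hf : ∀ n ≤ N, |∑ i ∈ Finset.range n, (coef g i).im * (P i - r * Q i).re| ≤ f) :
    ∀ n ≤ N, |(Q n).im| ≤ f * (1 + (1 - r) * (A * C + 1)) ^ n := by
  have hC := hW.nonneg
  have hη : 0 ≤ 1 - r := by linarith
  refine gronwall ((abs_nonneg _).trans (hf 0 (Nat.zero_le _))) (by positivity) fun k hk M hM => ?_
  have e : (Q k).im = (∑ i ∈ Finset.range k, (coef g i).im * (P i - r * Q i).re) +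
      ∑ i ∈ Finset.range k, ((coef g i).re * (P i - r * Q i).im - (1 - r) * (Q i).im) := by
    rw [hL.right_eq hW k, Complex.add_im, Complex.one_im, zero_add, Complex.im_sum,
      ← Finset.sum_add_distrib]
    refine Finset.sum_congr rfl fun i _ => ?_
    rw [Complex.sub_im, Complex.mul_im, Complex.im_ofReal_mul]
    ring
  rw [e]
  refine (abs_add_le _ _).trans (add_le_add (hf k hk) ?_)
  refine (Finset.abs_sum_le_sum_abs _ _).trans (Finset.sum_le_sum fun i hi => ?_)
  have hi := Finset.mem_range.1 hi
  have h1 := hL.abs_im_le hW hr (hM i hi)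
  have h2 : |(1 - r) * (Q i).im| ≤ (1 - r) * M i := by
    rw [abs_mul, abs_of_nonneg hη]
    exact mul_le_mul_of_nonneg_left (hM i hi i le_rfl) hη
  have h3 : |(coef g i).re * (P i - r * Q i).im| ≤ A / (i + 1) * ((1 - r) * C * (i + 1) * M i) := by
    rw [abs_mul]
    exact mul_le_mul ((Complex.abs_re_le_norm _).trans (hg i)) h1 (abs_nonneg _) (by positivity)
  refine (norm_sub_le_of_le (E := ℝ) h3 h2).trans (le_of_eq ?_)
  field_simp

lemma exists_abs_im_left_le {τ : ℕ → ℂ} {β A : ℝ} (hI : Increments g τ β A)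
    (hW : Weights g ω C) :
    ∃ c : ℝ, 0 ≤ c ∧ ∀ (r : ℝ) (P Q : ℕ → ℂ), 0 ≤ r → r ≤ 1 → Ladder g r P Q → ∀ N : ℕ,
      |(P N).im| ≤ c * Real.exp (c * ((1 - r) * (N + 1))) *
        ((1 - r) * (1 + ∑ i ∈ Finset.range N, 1 / ((i : ℝ) + 1))) := by
  have hA := hI.nonneg
  have hC := hW.nonneg
  obtain ⟨B, hB0, hB⟩ : ∃ B : ℝ, 0 ≤ B ∧ ∀ n, ‖(1 + g n)⁻¹‖ ≤ B := by
    have hg : Tendsto g atTop (nhds 0) := by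
      refine squeeze_zero_norm hI.norm_g ?_
      have := (tendsto_one_div_add_atTop_nhds_zero_nat (𝕜 := ℝ)).const_mul A
      simpa [div_eq_mul_inv] using this
    have h1 : Tendsto (fun n => (1 + g n)⁻¹) atTop (nhds ((1 + 0)⁻¹)) :=
      (tendsto_const_nhds.add hg).inv₀ (by simp)
    obtain ⟨B, hB⟩ := (Metric.isBounded_range_of_tendsto _ h1).exists_norm_le
    exact ⟨B, (norm_nonneg _).trans (hB _ ⟨0, rfl⟩), fun n => hB _ ⟨n, rfl⟩⟩
  have hBc : ∀ n, ‖(1 + (starRingEnd ℂ) (g n))⁻¹‖ ≤ B := by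
    intro n
    have : (1 + (starRingEnd ℂ) (g n))⁻¹ = (starRingEnd ℂ) (1 + g n)⁻¹ := by simp
    rw [this, RCLike.norm_conj]
    exact hB n
  set A' := A + A * B + 4 * A * B ^ 2 + A ^ 2 * B with hA'
  have hA'0 : 0 ≤ A' := by positivity
  have hc0 : ∀ n, ‖coef g n‖ ≤ A' / (n + 1) := by
    intro n
    have h1 := hI.norm_g n
    have h2 := hBc n
    calc ‖coef g n‖ = ‖g n‖ * ‖(1 + (starRingEnd ℂ) (g n))⁻¹‖ := by
          rw [coef, div_eq_mul_inv, norm_mul, RCLike.norm_conj]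
      _ ≤ A / (n + 1) * B := by gcongr
      _ = A * B / (n + 1) := by ring
      _ ≤ _ := by
        gcongr
        have : 0 ≤ A + 4 * A * B ^ 2 + A ^ 2 * B := by positivity
        linarith
  have ht : ∀ n, |(τ n).im| ≤ A' / (n + 1) := by
    intro n
    refine (Complex.abs_im_le_norm _).trans ((hI.norm_tau n).trans ?_)
    gcongr
    have : 0 ≤ A * B + 4 * A * B ^ 2 + A ^ 2 * B := by positivity
    linarith
  have hκ : ∀ n, |(1 - ‖g n‖ ^ 2) / ‖1 + g n‖ ^ 2 - 1| ≤ A' / (n + 1) := by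
    intro n
    have h0 := norm_pos_iff.2 (hW.ne_zero n)
    have h1 : ‖1 + g n‖ ^ 2 = 1 + 2 * (g n).re + ‖g n‖ ^ 2 := by
      rw [← Complex.normSq_eq_norm_sq, ← Complex.normSq_eq_norm_sq, Complex.normSq_apply,
        Complex.normSq_apply]
      simp
      ring
    have h2 : (1 - ‖g n‖ ^ 2) / ‖1 + g n‖ ^ 2 - 1 =
        (-2 * ‖g n‖ ^ 2 - 2 * (g n).re) * ‖(1 + g n)⁻¹‖ ^ 2 := by
      rw [norm_inv, inv_pow]
      field_simp
      linear_combination -h1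
    have h3 : |-2 * ‖g n‖ ^ 2 - 2 * (g n).re| ≤ 4 * ‖g n‖ := by
      have h4 := Complex.abs_re_le_norm (g n)
      have h5 := hW.lt_one n
      have h6 := norm_nonneg (g n)
      rw [abs_le] at *
      constructor <;> nlinarith
    have h4 := hI.norm_g n
    have h5 := hB n
    calc _ ≤ 4 * ‖g n‖ * ‖(1 + g n)⁻¹‖ ^ 2 := by
          rw [h2, abs_mul, abs_of_nonneg (sq_nonneg ‖(1 + g n)⁻¹‖)]
          gcongr
      _ ≤ 4 * (A / (n + 1)) * B ^ 2 := by gcongr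
      _ = 4 * A * B ^ 2 / (n + 1) := by ring
      _ ≤ _ := by
        gcongr
        have : 0 ≤ A + A * B + A ^ 2 * B := by positivity
        linarith
  have hcim : ∀ n, |(coef g n).im + ((τ (n + 1)).im - (τ n).im)| ≤ A' / (n + 1) ^ 2 := by
    intro n
    have h0 : 1 + (starRingEnd ℂ) (g n) ≠ 0 := by
      have := (map_ne_zero (starRingEnd ℂ)).2 (hW.ne_zero n)
      simpa using this
    have h1 : coef g n = (starRingEnd ℂ) (g n) -
        (starRingEnd ℂ) (g n) ^ 2 * (1 + (starRingEnd ℂ) (g n))⁻¹ := by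
      rw [coef]; field_simp; ring
    have h2 : ((β : ℂ) / ((n : ℂ) + 1)).im = 0 := by
      have : (β : ℂ) / ((n : ℂ) + 1) = ((β / (n + 1) : ℝ) : ℂ) := by push_cast; rfl
      rw [this, Complex.ofReal_im]
    have h3 : (coef g n).im + ((τ (n + 1)).im - (τ n).im) =
        -(g n - β / (n + 1) - (τ (n + 1) - τ n)).im -
          ((starRingEnd ℂ) (g n) ^ 2 * (1 + (starRingEnd ℂ) (g n))⁻¹).im := by
      rw [h1]
      simp only [Complex.sub_im, h2, Complex.conj_im]
      ring
    rw [h3]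
    have h4 : |(g n - β / (n + 1) - (τ (n + 1) - τ n)).im| ≤ A / (n + 1) ^ 2 :=
      (Complex.abs_im_le_norm _).trans (hI.norm_sub n)
    have h5 : |((starRingEnd ℂ) (g n) ^ 2 * (1 + (starRingEnd ℂ) (g n))⁻¹).im| ≤
        A ^ 2 * B / (n + 1) ^ 2 := by
      refine (Complex.abs_im_le_norm _).trans ?_
      rw [norm_mul, norm_pow, RCLike.norm_conj]
      have h6 := hI.norm_g n
      have h7 := hBc n
      calc _ ≤ (A / (n + 1)) ^ 2 * B := by gcongr
        _ = _ := by rw [div_pow, div_mul_eq_mul_div]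
    have h6 := norm_sub_le_of_le (E := ℝ) ((abs_neg _).trans_le h4) h5
    refine h6.trans ?_
    rw [← add_div]
    gcongr
    have : 0 ≤ A * B + 4 * A * B ^ 2 := by positivity
    linarith
  set c₁ := A' * C + 1 with hc₁
  set c₂ := 2 * A' * C + A' * (A' * C + 1 + C) with hc₂
  have hc₁0 : 0 ≤ c₁ := by positivity
  have hc₂0 : 0 ≤ c₂ := by positivity
  refine ⟨2 * c₁ + C + c₂, by positivity, fun r P Q hr0 hr hL N => ?_⟩
  have hη : 0 ≤ 1 - r := by linarith
  set b := Real.exp (c₁ * ((1 - r) * (N + 1))) with hb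
  have hpow : ∀ n ≤ N, (1 + (1 - r) * c₁) ^ n ≤ b := by
    intro n hn
    have h1 : (1 : ℝ) ≤ 1 + (1 - r) * c₁ := by
      have : 0 ≤ (1 - r) * c₁ := by positivity
      linarith
    calc _ ≤ (1 + (1 - r) * c₁) ^ (N + 1) := pow_le_pow_right₀ h1 (by omega)
      _ ≤ Real.exp ((1 - r) * c₁) ^ (N + 1) := by
        gcongr
        rw [add_comm]
        exact Real.add_one_le_exp _
      _ = b := by
        rw [← Real.exp_nat_mul, hb]
        congr 1
        push_cast
        ring
  have hQ : ∀ n ≤ N, ‖Q n‖ ≤ b := fun n hn =>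
    (hL.norm_right_le hW hr hA'0 hc0 n).trans (hpow n hn)
  set H := ∑ i ∈ Finset.range N, 1 / ((i : ℝ) + 1) with hH
  have hH0 : 0 ≤ H := Finset.sum_nonneg fun i _ => by positivity
  have hb0 : 0 ≤ b := (Real.exp_pos _).le
  have hf : ∀ n ≤ N, |∑ i ∈ Finset.range n, (coef g i).im * (P i - r * Q i).re| ≤
      (1 - r) * b * (c₂ * (1 + H)) := by
    intro n hn
    refine (hL.abs_sum_im_le hW hr hA'0 hκ (t := fun n => (τ n).im) ht hcim
      fun i hi => hQ i (hi.trans hn)).trans ?_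
    have h1 : ∑ i ∈ Finset.range n, 1 / ((i : ℝ) + 1) ≤ H :=
      Finset.sum_le_sum_of_subset_of_nonneg (Finset.range_mono hn) fun i _ _ => by positivity
    gcongr
    have h2 : 0 ≤ A' * (A' * C + 1 + C) := by positivity
    have h3 : 0 ≤ 2 * A' * C := by positivity
    nlinarith
  set f := (1 - r) * b * (c₂ * (1 + H)) with hf'
  have hf0 : 0 ≤ f := by positivity
  have hQi : ∀ n ≤ N, |(Q n).im| ≤ f * b := fun n hn =>
    (hL.abs_im_right_le hW hr hA'0 hc0 hf n hn).trans (by gcongr; exact hpow n hn)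
  have hPN : P N = (P N - r * Q N) + r * Q N := by ring
  have h1 := hL.abs_im_le hW hr hQi
  have h2 : |(r * Q N).im| ≤ f * b := by
    rw [Complex.im_ofReal_mul, abs_mul, abs_of_nonneg hr0]
    exact (mul_le_of_le_one_left (abs_nonneg _) hr).trans (hQi N le_rfl)
  have h3 : (1 - r) * C * (N + 1) + 1 ≤ Real.exp (C * ((1 - r) * (N + 1))) := by
    refine le_trans (le_of_eq ?_) (Real.add_one_le_exp _)
    ring
  have h4 : Real.exp (C * ((1 - r) * (N + 1))) * (b * b) ≤
      Real.exp ((2 * c₁ + C + c₂) * ((1 - r) * (N + 1))) := by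
    rw [hb, ← Real.exp_add, ← Real.exp_add]
    refine Real.exp_le_exp.2 ?_
    have : 0 ≤ c₂ * ((1 - r) * (N + 1)) := by positivity
    linarith
  calc |(P N).im| ≤ (1 - r) * C * (N + 1) * (f * b) + f * b := by
        rw [hPN, Complex.add_im]
        exact (abs_add_le _ _).trans (add_le_add h1 h2)
    _ = c₂ * (((1 - r) * C * (N + 1) + 1) * (b * b)) * ((1 - r) * (1 + H)) := by rw [hf']; ring
    _ ≤ (2 * c₁ + C + c₂) * Real.exp ((2 * c₁ + C + c₂) * ((1 - r) * (N + 1))) *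
        ((1 - r) * (1 + H)) := by
      have h5 : c₂ ≤ 2 * c₁ + C + c₂ := by linarith
      have h6 := (mul_le_mul_of_nonneg_right h3 (mul_nonneg hb0 hb0)).trans h4
      have h7 : 0 ≤ (1 - r) * C * (N + 1) + 1 := by positivity
      exact mul_le_mul_of_nonneg_right
        (mul_le_mul h5 h6 (mul_nonneg h7 (mul_nonneg hb0 hb0)) (hc₂0.trans h5))
        (mul_nonneg hη (add_nonneg zero_le_one hH0))

end Ladder

lemma norm_sub_telescope_le {x : ℕ → ℂ} {l : ℂ} {E : ℝ} (hl : l ≠ 1) (hx : ∀ n, ‖x n‖ ≤ 1)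
    (h : ∀ n, ‖x (n + 1) - l * x n‖ ≤ E / (n + 1)) (n : ℕ) :
    ‖x n / (n + 1) - (x (n + 1) / ((((n + 1 : ℕ) : ℂ) + 1) * (l - 1)) -
      x n / ((n + 1) * (l - 1)))‖ ≤ (E + 1) / ‖l - 1‖ / (n + 1) ^ 2 := by
  have hl' : l - 1 ≠ 0 := sub_ne_zero.2 hl
  have h1 : (n : ℂ) + 1 ≠ 0 := by exact_mod_cast n.succ_ne_zero
  have h2 : (((n + 1 : ℕ) : ℂ) + 1) ≠ 0 := by exact_mod_cast (n + 1).succ_ne_zero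
  have e : x n / (n + 1) - (x (n + 1) / ((((n + 1 : ℕ) : ℂ) + 1) * (l - 1)) -
      x n / ((n + 1) * (l - 1))) =
      (-((x (n + 1) - l * x n) / (n + 1)) +
        x (n + 1) / ((n + 1) * (((n + 1 : ℕ) : ℂ) + 1))) / (l - 1) := by
    field_simp
    push_cast
    ring
  have h3 : ‖(n : ℂ) + 1‖ = n + 1 := by
    exact_mod_cast Complex.norm_natCast (n + 1)
  have h4 : ‖(((n + 1 : ℕ) : ℂ) + 1)‖ = n + 2 := by
    have := Complex.norm_natCast (n + 2)
    push_cast at this ⊢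
    rw [add_assoc, one_add_one_eq_two]
    exact this
  rw [e, norm_div, div_right_comm]
  refine div_le_div_of_nonneg_right ?_ (norm_nonneg _)
  rw [add_div]
  refine norm_add_le_of_le ?_ ?_
  · rw [norm_neg, norm_div, h3, pow_two, ← div_div]
    exact div_le_div_of_nonneg_right (h n) (by positivity)
  · rw [norm_div, norm_mul, h3, h4]
    refine div_le_div₀ zero_le_one (hx _) (by positivity) ?_
    nlinarith [(Nat.cast_nonneg n : (0 : ℝ) ≤ n)]

lemma sum_rpow_le {γ : ℝ} (hγ : -1 < γ) :
    ∃ C : ℝ, 0 ≤ C ∧ ∀ n : ℕ, ∑ i ∈ Finset.range (n + 1), ((i : ℝ) + 1) ^ γ ≤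
      C * ((n + 1) * ((n : ℝ) + 1) ^ γ) := by
  rcases le_or_gt 0 γ with h0 | h0
  · refine ⟨1, zero_le_one, fun n => ?_⟩
    rw [one_mul]
    refine (Finset.sum_le_card_nsmul _ _ (((n : ℝ) + 1) ^ γ) fun i hi => ?_).trans (by simp)
    have : (i : ℝ) ≤ n := by
      have := Finset.mem_range.1 hi
      exact_mod_cast (by omega : i ≤ n)
    gcongr
  · set p := γ + 1 with hp
    have hp0 : 0 < p := by linarith
    refine ⟨p⁻¹, by positivity, fun n => ?_⟩
    have key : ∀ i : ℕ, p * ((i : ℝ) + 1) ^ γ ≤ ((i : ℝ) + 1) ^ p - (i : ℝ) ^ p := by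
      intro i
      have hi : (0 : ℝ) < i + 1 := by positivity
      have h1 := rpow_one_add_le_one_add_mul_self (s := -(1 / ((i : ℝ) + 1))) (p := p)
        (by rw [neg_le_neg_iff, div_le_one hi]; linarith [(Nat.cast_nonneg i : (0 : ℝ) ≤ i)])
        hp0.le (by linarith)
      have h2 : 1 + -(1 / ((i : ℝ) + 1)) = i / (i + 1) := by field_simp; ring
      rw [h2, Real.div_rpow (by positivity) hi.le, div_le_iff₀ (by positivity)] at h1
      have h3 : ((i : ℝ) + 1) ^ p = (i + 1) ^ γ * (i + 1) := by
        rw [hp, Real.rpow_add hi, Real.rpow_one]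
      have h4 : (1 + p * -(1 / ((i : ℝ) + 1))) * (i + 1) ^ p = (i + 1) ^ p - p * (i + 1) ^ γ := by
        rw [h3]
        field_simp
        ring
      linarith
    have h5 : ∑ i ∈ Finset.range (n + 1), p * ((i : ℝ) + 1) ^ γ ≤ ((n : ℝ) + 1) ^ p := by
      refine (Finset.sum_le_sum fun i _ => key i).trans ?_
      have := Finset.sum_range_sub (fun i : ℕ => (i : ℝ) ^ p) (n + 1)
      push_cast at this
      rw [this, Real.zero_rpow hp0.ne', sub_zero]
    rw [← Finset.mul_sum] at h5
    rw [inv_mul_eq_div, le_div_iff₀ hp0, mul_comm]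
    refine h5.trans (le_of_eq ?_)
    rw [hp, Real.rpow_add (by positivity), Real.rpow_one, mul_comm]

namespace System

variable {μ : Measure ℝ} [IsFiniteMeasure μ] {D₀ : ℝ} {Φ : ℕ → ℂ[X]} {α : ℕ → ℂ}

noncomputable def incr (Φ : ℕ → ℂ[X]) (α : ℕ → ℂ) (a : ℂ) (n : ℕ) : ℂ :=
  -(α n) * (starRingEnd ℂ) (phase Φ a n)

lemma norm_incr (S : System μ D₀ Φ α) {a : ℂ} (ha : ‖a‖ = 1) (n : ℕ) :
    ‖incr Φ α a n‖ = ‖α n‖ := by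
  rw [incr, norm_mul, norm_neg, RCLike.norm_conj, S.norm_phase ha, mul_one]

lemma eval_star_succ (S : System μ D₀ Φ α) {a : ℂ} (ha : ‖a‖ = 1) (n : ℕ) :
    (star Φ (n + 1)).eval a = (star Φ n).eval a * (1 + incr Φ α a n) := by
  rw [S.rec_star, eval_sub, eval_smul, S.eval_X_mul ha, incr, smul_eq_mul]
  ring

lemma one_add_incr_ne_zero (S : System μ D₀ Φ α) {a : ℂ} (ha : ‖a‖ = 1) (n : ℕ) :
    1 + incr Φ α a n ≠ 0 := by
  have := S.eval_star_ne_zero (n + 1) ha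
  rw [S.eval_star_succ ha] at this
  exact right_ne_zero_of_mul this

lemma norm_phase_succ_sub_le (S : System μ D₀ Φ α) {a : ℂ} (ha : ‖a‖ = 1) (n : ℕ) :
    ‖phase Φ a (n + 1) - a⁻¹ * phase Φ a n‖ ≤ 2 * ‖α n‖ := by
  have h1 := S.one_add_incr_ne_zero ha n
  have h2 := norm_div_conj_sub_le h1 one_ne_zero
  have h3 : phase Φ a (n + 1) - a⁻¹ * phase Φ a n = a⁻¹ * phase Φ a n *
      ((1 + incr Φ α a n) / (starRingEnd ℂ) (1 + incr Φ α a n) - 1 / (starRingEnd ℂ) 1) := by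
    rw [phase, phase, S.eval_star_succ ha, map_mul, map_one, div_one, pow_succ a (n + 1), mul_inv,
      mul_div_mul_comm]
    ring
  rw [h3, norm_mul, norm_mul, norm_inv, ha, S.norm_phase ha, inv_one, one_mul, one_mul]
  simpa [S.norm_incr ha] using h2

lemma exists_increments (S : System μ D₀ Φ α) {m : ℕ} {a : Fin m → ℂ} {β : Fin m → ℝ}
    (ha : ∀ k, ‖a k‖ = 1) (ha' : Function.Injective a) {A : ℝ} (hA0 : 0 ≤ A)
    (hA : ∀ n : ℕ, ‖α n‖ ≤ A / (n + 1)) {K : ℝ} {N : ℕ} (hK0 : 0 ≤ K)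
    (hK : ∀ n : ℕ, N ≤ n → ‖n * α n + ∑ k, (β k : ℂ) * phase Φ (a k) n‖ ≤ K / (n + 1))
    (k : Fin m) : ∃ (τ : ℕ → ℂ) (B : ℝ), Increments (incr Φ α (a k)) τ (β k) B := by
  set x : Fin m → ℕ → ℂ := fun j n => phase Φ (a j) n * (starRingEnd ℂ) (phase Φ (a k) n) with hx
  have hxd : ∀ j n, x j n = phase Φ (a j) n * (starRingEnd ℂ) (phase Φ (a k) n) := fun _ _ => rfl
  clear_value x
  set l : Fin m → ℂ := fun j => (a j)⁻¹ * a k with hl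
  have hl1 : ∀ j, j ≠ k → l j ≠ 1 := by
    intro j hj h
    refine hj (ha' ?_)
    have h0 : a j ≠ 0 := by rw [← norm_pos_iff, ha]; norm_num
    simp only [hl] at h
    field_simp at h
    exact h.symm
  have hx1 : ∀ j n, ‖x j n‖ = 1 := by
    intro j n
    simp [hxd, S.norm_phase (ha _)]
  have hxs : ∀ j n, ‖x j (n + 1) - l j * x j n‖ ≤ 4 * A / (n + 1) := by
    intro j n
    have hc : (starRingEnd ℂ) (a k)⁻¹ = a k := by
      rw [map_inv₀, ← Complex.inv_eq_conj (ha k), inv_inv]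
    have e : x j (n + 1) - l j * x j n =
        (phase Φ (a j) (n + 1) - (a j)⁻¹ * phase Φ (a j) n) *
          (starRingEnd ℂ) (phase Φ (a k) (n + 1)) + (a j)⁻¹ * phase Φ (a j) n *
          (starRingEnd ℂ) (phase Φ (a k) (n + 1) - (a k)⁻¹ * phase Φ (a k) n) := by
      simp only [hxd, hl]
      rw [map_sub, map_mul, hc]
      ring
    have e2 : 4 * A / (n + 1) = 2 * (A / (n + 1)) + 2 * (A / (n + 1)) := by ring
    rw [e, e2]
    refine norm_add_le_of_le ?_ ?_
    · rw [norm_mul, RCLike.norm_conj, S.norm_phase (ha k), mul_one]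
      exact (S.norm_phase_succ_sub_le (ha j) n).trans (by gcongr; exact hA n)
    · rw [norm_mul, norm_mul, norm_inv, RCLike.norm_conj, S.norm_phase (ha j), ha, inv_one,
        one_mul, one_mul]
      exact (S.norm_phase_succ_sub_le (ha k) n).trans (by gcongr; exact hA n)
  set σ : Fin m → ℕ → ℂ := fun j n => x j n / ((n + 1) * (l j - 1)) with hσ
  set b : ℝ := ∑ j, |β j| with hb
  have hb0 : 0 ≤ b := Finset.sum_nonneg fun _ _ => abs_nonneg _
  set s : Finset (Fin m) := Finset.univ.erase k with hs
  set q : ℝ := ∑ j ∈ s, |β j| * ((4 * A + 1) / ‖l j - 1‖) with hq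
  set q' : ℝ := ∑ j ∈ s, |β j| * (1 / ‖l j - 1‖) with hq'
  have hq0 : 0 ≤ q := Finset.sum_nonneg fun _ _ => by positivity
  have hq'0 : 0 ≤ q' := Finset.sum_nonneg fun _ _ => by positivity
  have hK' : ∀ n : ℕ, ‖(n + 1) * α n + ∑ k, (β k : ℂ) * phase Φ (a k) n‖ ≤
      (K + A + (A + b) * (N + 1)) / (n + 1) := by
    intro n
    rcases le_or_gt N n with hn | hn
    · have e : (n + 1) * α n + ∑ k, (β k : ℂ) * phase Φ (a k) n =
          (n * α n + ∑ k, (β k : ℂ) * phase Φ (a k) n) + α n := by ring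
      rw [e]
      refine (norm_add_le_of_le (hK n hn) (hA n)).trans ?_
      rw [← add_div]
      have : 0 ≤ (A + b) * (N + 1) := by positivity
      exact div_le_div_of_nonneg_right (by linarith) (by positivity)
    · have h1 : ‖((n : ℂ) + 1) * α n‖ ≤ A := by
        rw [norm_mul]
        have h3 : ‖(n : ℂ) + 1‖ = n + 1 := by exact_mod_cast Complex.norm_natCast (n + 1)
        have := hA n
        rw [le_div_iff₀ (by positivity)] at this
        rw [h3]; linarith
      have h2 : ‖∑ k, (β k : ℂ) * phase Φ (a k) n‖ ≤ b := by
        refine (norm_sum_le _ _).trans (Finset.sum_le_sum fun j _ => ?_)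
        rw [norm_mul, S.norm_phase (ha j), mul_one, Complex.norm_real, Real.norm_eq_abs]
      refine (norm_add_le_of_le h1 h2).trans ?_
      rw [le_div_iff₀ (by positivity)]
      have : (n : ℝ) ≤ N := by exact_mod_cast hn.le
      nlinarith
  set M := K + A + (A + b) * (N + 1) with hM
  have hM0 : 0 ≤ M := by positivity
  have hxk : ∀ n, x k n = 1 := by
    intro n
    rw [hxd, Complex.mul_conj, Complex.normSq_eq_norm_sq, S.norm_phase (ha k)]
    simp
  refine ⟨fun n => ∑ j ∈ s, β j * σ j n, A + q' + (M + q), ⟨by positivity, fun n => ?_,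
    fun n => ?_, fun n => ?_⟩⟩
  · rw [S.norm_incr (ha k)]
    refine (hA n).trans ?_
    gcongr
    linarith
  · have h1 : ‖∑ j ∈ s, β j * σ j n‖ ≤ q' / (n + 1) := by
      rw [hq', Finset.sum_div]
      refine (norm_sum_le _ _).trans (Finset.sum_le_sum fun j _ => le_of_eq ?_)
      have h3 : ‖(n : ℂ) + 1‖ = n + 1 := by exact_mod_cast Complex.norm_natCast (n + 1)
      simp only [hσ]
      rw [norm_mul, norm_div, norm_mul, hx1, h3, Complex.norm_real, Real.norm_eq_abs,
        mul_comm ((n : ℝ) + 1), ← div_div, mul_div_assoc]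
    refine h1.trans ?_
    gcongr
    linarith
  · have hn0 : (n : ℂ) + 1 ≠ 0 := by exact_mod_cast n.succ_ne_zero
    have e : incr Φ α (a k) n - β k / (n + 1) -
        (∑ j ∈ s, β j * σ j (n + 1) - ∑ j ∈ s, β j * σ j n) =
        -(((n + 1) * α n + ∑ k, (β k : ℂ) * phase Φ (a k) n) / (n + 1) *
          (starRingEnd ℂ) (phase Φ (a k) n)) +
          ∑ j ∈ s, β j * (x j n / (n + 1) - (σ j (n + 1) - σ j n)) := by
      have e1 : (∑ j, (β j : ℂ) * phase Φ (a j) n) * (starRingEnd ℂ) (phase Φ (a k) n) =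
          β k + ∑ j ∈ s, β j * x j n := by
        rw [Finset.sum_mul, ← Finset.add_sum_erase _ _ (Finset.mem_univ k), ← hs]
        congr 1
        · rw [mul_assoc, ← hxd, hxk, mul_one]
        · exact Finset.sum_congr rfl fun j _ => by rw [hxd]; ring
      have e2 : ∑ j ∈ s, β j * (x j n / (n + 1) - (σ j (n + 1) - σ j n)) =
          (∑ j ∈ s, β j * x j n) / (n + 1) -
            (∑ j ∈ s, β j * σ j (n + 1) - ∑ j ∈ s, β j * σ j n) := by
        rw [Finset.sum_div, ← Finset.sum_sub_distrib, ← Finset.sum_sub_distrib]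
        exact Finset.sum_congr rfl fun j _ => by ring
      rw [e2, div_mul_eq_mul_div, add_mul, e1, incr]
      field_simp
      ring
    rw [e]
    have h1 : ‖-(((n + 1) * α n + ∑ k, (β k : ℂ) * phase Φ (a k) n) / (n + 1) *
          (starRingEnd ℂ) (phase Φ (a k) n))‖ ≤ M / (n + 1) ^ 2 := by
      have h3 : ‖(n : ℂ) + 1‖ = n + 1 := by exact_mod_cast Complex.norm_natCast (n + 1)
      rw [norm_neg, norm_mul, norm_div, RCLike.norm_conj, S.norm_phase (ha k), mul_one, h3,
        pow_two, ← div_div]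
      exact div_le_div_of_nonneg_right (hK' n) (by positivity)
    have h2 : ‖∑ j ∈ s, β j * (x j n / (n + 1) - (σ j (n + 1) - σ j n))‖ ≤ q / (n + 1) ^ 2 := by
      rw [hq, Finset.sum_div]
      refine (norm_sum_le _ _).trans (Finset.sum_le_sum fun j hj => ?_)
      rw [norm_mul, Complex.norm_real, Real.norm_eq_abs, mul_div_assoc]
      refine mul_le_mul_of_nonneg_left ?_ (abs_nonneg _)
      exact norm_sub_telescope_le (hl1 j (Finset.ne_of_mem_erase hj)) (fun n => (hx1 j n).le)
        (hxs j) n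
    refine (norm_add_le_of_le h1 h2).trans ?_
    rw [← add_div]
    exact div_le_div_of_nonneg_right (by linarith) (by positivity)

end System

namespace System

variable {μ : Measure ℝ} [IsFiniteMeasure μ] {D₀ : ℝ} {Φ : ℕ → ℂ[X]} {α : ℕ → ℂ}

lemma exists_weights (S : System μ D₀ Φ α) {a : ℂ} (ha : ‖a‖ = 1) {β B : ℝ} {τ : ℕ → ℂ}
    (hβ : -(1 / 2) < β) (hI : Increments (incr Φ α a) τ β B) :
    ∃ (ω : ℕ → ℝ) (C : ℝ), Weights (incr Φ α a) ω C := by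
  obtain ⟨K, U, N, hK, hU, hT, -⟩ := hI.exists_tendsto (u := fun n => (star Φ n).eval a)
    (fun n => S.eval_star_ne_zero n ha) (S.eval_star_succ ha)
  set x : ℕ → ℂ := fun n => (star Φ n).eval a * (Real.exp (-(β * Real.log (n + 1))) : ℝ) with hx
  have hx0 : ∀ n, x n ≠ 0 := fun n => mul_ne_zero (S.eval_star_ne_zero n ha)
    (by exact_mod_cast (Real.exp_pos _).ne')
  obtain ⟨M₁, hM₁⟩ := (Metric.isBounded_range_of_tendsto _ hT).exists_norm_le
  obtain ⟨M₂, hM₂⟩ := (Metric.isBounded_range_of_tendsto _ (hT.inv₀ hU)).exists_norm_le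
  have h1 : ∀ n, ‖x n‖ ≤ M₁ := fun n => hM₁ _ ⟨n, rfl⟩
  have h2 : ∀ n, 1 ≤ M₂ * ‖x n‖ := by
    intro n
    have := hM₂ _ ⟨n, rfl⟩
    change ‖(x n)⁻¹‖ ≤ M₂ at this
    rw [norm_inv] at this
    exact (inv_le_iff_one_le_mul₀ (norm_pos_iff.2 (hx0 n))).1 this
  have hM₁0 : 0 ≤ M₁ := (norm_nonneg _).trans (h1 0)
  have hM₂0 : 0 ≤ M₂ := by
    have := h2 0
    have := norm_pos_iff.2 (hx0 0)
    by_contra! h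
    nlinarith
  have hw : ∀ n : ℕ, ‖(star Φ n).eval a‖ ^ 2 = ‖x n‖ ^ 2 * ((n : ℝ) + 1) ^ (2 * β) := by
    intro n
    simp only [hx]
    rw [norm_mul, Complex.norm_real, Real.norm_of_nonneg (Real.exp_pos _).le, mul_pow, mul_assoc,
      Real.rpow_def_of_pos (by positivity), ← Real.exp_nat_mul, ← Real.exp_add]
    have : ((2 : ℕ) : ℝ) * -(β * Real.log (n + 1)) + Real.log (n + 1) * (2 * β) = 0 := by
      push_cast; ring
    rw [this, Real.exp_zero, mul_one]
  obtain ⟨C, hC0, hC⟩ := sum_rpow_le (γ := 2 * β) (by linarith)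
  set h₀ := nsq μ (Φ 0) with hh₀
  have hD : 0 < D₀ ^ 2 := pow_pos S.pos 2
  have hh₀0 : 0 < h₀ := S.nsq_pos 0
  refine ⟨fun n => ‖(star Φ n).eval a‖ ^ 2 / nsq μ (Φ n), M₁ ^ 2 / D₀ ^ 2 * C * (M₂ ^ 2 * h₀),
    fun n => ?_, fun n => ?_, fun n => ?_, fun n => ?_⟩
  · rw [S.norm_incr ha]; exact S.norm_alpha_lt_one n
  · have := norm_pos_iff.2 (S.eval_star_ne_zero n ha)
    have := S.nsq_pos n
    positivity
  · have h3 := S.nsq_pos n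
    have h4 := S.nsq_pos (n + 1)
    have h5 : 0 < 1 - ‖α n‖ ^ 2 := by
      have := S.norm_alpha_lt_one n
      have := norm_nonneg (α n)
      nlinarith
    rw [S.norm_incr ha, S.nsq_succ, S.eval_star_succ ha, norm_mul]
    field_simp
  · have h3 : ∀ i, ‖(star Φ i).eval a‖ ^ 2 / nsq μ (Φ i) ≤
        M₁ ^ 2 / D₀ ^ 2 * ((i : ℝ) + 1) ^ (2 * β) := by
      intro i
      rw [hw, div_mul_eq_mul_div]
      have := h1 i
      have := S.le_nsq i
      gcongr
    have h4 : ((n : ℝ) + 1) ^ (2 * β) ≤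
        M₂ ^ 2 * h₀ * (‖(star Φ n).eval a‖ ^ 2 / nsq μ (Φ n)) := by
      have h5 : ((n : ℝ) + 1) ^ (2 * β) ≤ M₂ ^ 2 * ‖(star Φ n).eval a‖ ^ 2 := by
        rw [hw]
        have h6 : 1 ≤ (M₂ * ‖x n‖) ^ 2 := one_le_pow₀ (h2 n)
        have h7 : 0 ≤ ((n : ℝ) + 1) ^ (2 * β) := by positivity
        nlinarith
      have h8 : 1 ≤ h₀ / nsq μ (Φ n) := (one_le_div (S.nsq_pos n)).2 (S.nsq_le n)
      calc _ ≤ M₂ ^ 2 * ‖(star Φ n).eval a‖ ^ 2 := h5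
        _ ≤ M₂ ^ 2 * ‖(star Φ n).eval a‖ ^ 2 * (h₀ / nsq μ (Φ n)) :=
          le_mul_of_one_le_right (by positivity) h8
        _ = _ := by ring
    refine (Finset.sum_le_sum fun i _ => h3 i).trans ?_
    rw [← Finset.mul_sum]
    calc _ ≤ M₁ ^ 2 / D₀ ^ 2 * (C * ((n + 1) * ((n : ℝ) + 1) ^ (2 * β))) := by
          have := hC n
          gcongr
      _ ≤ M₁ ^ 2 / D₀ ^ 2 * (C * ((n + 1) *
          (M₂ ^ 2 * h₀ * (‖(star Φ n).eval a‖ ^ 2 / nsq μ (Φ n))))) := by gcongr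
      _ = _ := by ring

lemma ladder (S : System μ D₀ Φ α) {a : ℂ} (ha : ‖a‖ = 1) (r : ℝ) :
    Ladder (incr Φ α a) r (fun n => (star Φ n).eval (r * a) / (star Φ n).eval a)
      (fun n => (Φ n).eval (r * a) / (a ^ n * (starRingEnd ℂ) ((star Φ n).eval a))) := by
  have h0 : star Φ 0 = 1 := by
    have h1 := S.natDegree_star 0
    rw [eq_C_of_natDegree_le_zero h1, S.coeff_zero_star, map_one]
  have ha0 : a ≠ 0 := by rw [← norm_pos_iff, ha]; norm_num
  have hca : (starRingEnd ℂ) a = a⁻¹ := (Complex.inv_eq_conj ha).symm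
  refine ⟨by simp [h0], by simp [h0, S.zero_eq_one], fun n => ?_, fun n => ?_⟩
  · have h1 := S.eval_star_ne_zero n ha
    have h1' := (map_ne_zero (starRingEnd ℂ)).2 h1
    have h2 := S.one_add_incr_ne_zero ha n
    rw [S.eval_star_succ ha, div_mul_eq_mul_div, mul_div_mul_right _ _ h2, S.rec_star, eval_sub,
      eval_smul, eval_mul, eval_X, smul_eq_mul, incr, phase]
    have hcn : (starRingEnd ℂ) ((a ^ (n + 1))⁻¹) = a ^ (n + 1) := by
      rw [map_inv₀, map_pow, hca, inv_pow, inv_inv]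
    rw [map_mul, hcn, map_div₀, Complex.conj_conj]
    field_simp
    ring
  · have h1 := S.eval_star_ne_zero n ha
    have h1' := (map_ne_zero (starRingEnd ℂ)).2 h1
    have h2 := (map_ne_zero (starRingEnd ℂ)).2 (S.one_add_incr_ne_zero ha n)
    have h3 : (1 : ℂ) + (starRingEnd ℂ) (incr Φ α a n) =
        (starRingEnd ℂ) (1 + incr Φ α a n) := by simp
    rw [h3, S.eval_star_succ ha, map_mul, ← mul_assoc, div_mul_eq_mul_div,
      mul_div_mul_right _ _ h2, S.rec_left, eval_sub, eval_smul, eval_mul, eval_X, smul_eq_mul,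
      incr, phase]
    simp only [map_mul, map_neg, Complex.conj_conj]
    field_simp
    ring

lemma tendsto_im (S : System μ D₀ Φ α) {a : ℂ} (ha : ‖a‖ = 1) {β B : ℝ} {τ : ℕ → ℂ}
    (hβ : -(1 / 2) < β) (hI : Increments (incr Φ α a) τ β B) {K : ℝ} (hK : 0 < K) :
    Tendsto (fun n : ℕ => ((star Φ n).eval (((1 - K / n : ℝ) : ℂ) * a) /
      (star Φ n).eval a).im) atTop (nhds 0) := by
  obtain ⟨ω, C, hW⟩ := S.exists_weights ha hβ hI
  obtain ⟨c, hc0, hc⟩ := Ladder.exists_abs_im_left_le hI hW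
  have hlim : Tendsto (fun n : ℕ => c * Real.exp (c * (2 * K)) * (K * ((n : ℝ)⁻¹ +
      (n : ℝ)⁻¹ * ∑ i ∈ Finset.range n, 1 / ((i : ℝ) + 1)))) atTop
      (nhds (c * Real.exp (c * (2 * K)) * (K * (0 + 0)))) :=
    ((tendsto_inv_atTop_nhds_zero_nat.add
      (tendsto_one_div_add_atTop_nhds_zero_nat (𝕜 := ℝ)).cesaro).const_mul K).const_mul _
  rw [add_zero, mul_zero, mul_zero] at hlim
  obtain ⟨N, hN⟩ := exists_nat_ge K
  refine squeeze_zero_norm' ?_ hlim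
  filter_upwards [eventually_ge_atTop (N + 1)] with n hn
  have hn0 : (0 : ℝ) < n := by exact_mod_cast (by omega : 0 < n)
  have hnK : K ≤ n := hN.trans (by exact_mod_cast (by omega : N ≤ n))
  have hr0 : 0 ≤ 1 - K / n := by
    rw [sub_nonneg, div_le_one hn0]; exact hnK
  have hr1 : 1 - K / n ≤ 1 := by
    have : 0 ≤ K / n := by positivity
    linarith
  have h1 := hc _ _ _ hr0 hr1 (S.ladder ha (1 - K / n)) n
  rw [Real.norm_eq_abs]
  refine h1.trans ?_
  rw [sub_sub_cancel]
  have hS : 0 ≤ ∑ i ∈ Finset.range n, 1 / ((i : ℝ) + 1) :=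
    Finset.sum_nonneg fun i _ => by positivity
  have h2 : K / n * (n + 1) ≤ 2 * K := by
    rw [div_mul_eq_mul_div, div_le_iff₀ hn0]
    have : (1 : ℝ) ≤ n := by exact_mod_cast (by omega : 1 ≤ n)
    nlinarith
  have h3 : K / n * (1 + ∑ i ∈ Finset.range n, 1 / ((i : ℝ) + 1)) =
      K * ((n : ℝ)⁻¹ + (n : ℝ)⁻¹ * ∑ i ∈ Finset.range n, 1 / ((i : ℝ) + 1)) := by
    rw [div_eq_mul_inv]; ring
  rw [h3]
  gcongr

/-- Boundary asymptotics of the reversed polynomials at a singular point. -/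
lemma exists_asymptotics (S : System μ D₀ Φ α) {m : ℕ} {a : Fin m → ℂ} {β : Fin m → ℝ}
    (ha : ∀ k, ‖a k‖ = 1) (ha' : Function.Injective a) (hβ : ∀ k, -(1 / 2) < β k) {A : ℝ}
    (hA0 : 0 ≤ A) (hA : ∀ n : ℕ, ‖α n‖ ≤ A / (n + 1)) {K : ℝ} {N : ℕ} (hK0 : 0 ≤ K)
    (hK : ∀ n : ℕ, N ≤ n → ‖n * α n + ∑ k, (β k : ℂ) * phase Φ (a k) n‖ ≤ K / (n + 1))
    (k : Fin m) :
    ∃ (U : ℂ) (M M' : ℝ) (N' : ℕ), U ≠ 0 ∧ 0 ≤ M ∧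
      (∀ n : ℕ, N' ≤ n → ‖(star Φ n).eval (a k) / (starRingEnd ℂ) ((star Φ n).eval (a k)) -
        U / (starRingEnd ℂ) U‖ ≤ M / (n + 1)) ∧
      (∀ n : ℕ, ‖(star Φ n).eval (a k)‖ ≤ M' * ((n : ℝ) + 1) ^ (β k)) ∧
      ∀ K : ℝ, 0 < K → Tendsto (fun n : ℕ => ((star Φ n).eval (((1 - K / n : ℝ) : ℂ) * a k) /
        (star Φ n).eval (a k)).im) atTop (nhds 0) := by
  obtain ⟨τ, B, hI⟩ := S.exists_increments ha ha' hA0 hA hK0 hK k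
  obtain ⟨K', U, N', hK', hU, hT, hN'⟩ := hI.exists_tendsto (u := fun n => (star Φ n).eval (a k))
    (fun n => S.eval_star_ne_zero n (ha k)) (S.eval_star_succ (ha k))
  obtain ⟨M₁, hM₁⟩ := (Metric.isBounded_range_of_tendsto _ hT).exists_norm_le
  refine ⟨U, 2 / ‖U‖ * K', M₁, N', hU, by positivity, fun n hn => ?_, fun n => ?_,
    fun K hK => S.tendsto_im (ha k) (hβ k) hI hK⟩
  · have he : ((Real.exp (-(β k * Real.log (n + 1))) : ℝ) : ℂ) ≠ 0 := by
      exact_mod_cast (Real.exp_pos _).ne'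
    have h0 := S.eval_star_ne_zero n (ha k)
    have h1 := norm_div_conj_sub_le (mul_ne_zero h0 he) hU
    rw [map_mul, Complex.conj_ofReal, mul_div_mul_right _ _ he] at h1
    refine h1.trans ?_
    rw [mul_div_assoc]
    have := hN' n hn
    gcongr
  · have h1 := hM₁ _ ⟨n, rfl⟩
    rw [norm_mul, Complex.norm_real, Real.norm_of_nonneg (Real.exp_pos _).le, Real.exp_neg,
      ← div_eq_mul_inv, div_le_iff₀ (Real.exp_pos _)] at h1
    rwa [Real.rpow_def_of_pos (by positivity), mul_comm (Real.log _)]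

end System

/-- Normalized arc length, parametrized by the angle. -/
noncomputable def arc : Measure ℝ :=
  ENNReal.ofReal (2 * π)⁻¹ • volume.restrict (Ioc 0 (2 * π))

instance : IsProbabilityMeasure arc := by
  constructor
  rw [arc, Measure.smul_apply, Measure.restrict_apply_univ, Real.volume_Ioc, smul_eq_mul, sub_zero,
    ← ENNReal.ofReal_mul (by positivity), inv_mul_cancel₀ (by positivity), ENNReal.ofReal_one]

lemma integral_arc {E : Type*} [NormedAddCommGroup E] [NormedSpace ℝ E] (f : ℝ → E) :
    ∫ θ, f θ ∂arc = (2 * π)⁻¹ • ∫ θ in (0 : ℝ)..(2 * π), f θ := by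
  rw [arc, integral_smul_measure, ENNReal.toReal_ofReal (by positivity),
    intervalIntegral.integral_of_le (by positivity)]

lemma integrable_arc_iff {E : Type*} [NormedAddCommGroup E] {f : ℝ → E} :
    Integrable f arc ↔ IntervalIntegrable f volume 0 (2 * π) := by
  rw [arc, integrable_smul_measure (by simp [Real.pi_pos]) ENNReal.ofReal_ne_top,
    intervalIntegrable_iff_integrableOn_Ioc_of_le (by positivity), IntegrableOn]

lemma circleAverage_eq (f : ℂ → ℂ) (R : ℝ) :
    Real.circleAverage f 0 R = ∫ θ, f (R * circ θ) ∂arc := by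
  rw [integral_arc, Real.circleAverage_def]
  simp [circleMap, circ]

lemma countable_circ_eq (a : ℂ) : {θ : ℝ | circ θ = a}.Countable := by
  by_cases h : ∃ φ, circ φ = a
  · obtain ⟨φ, rfl⟩ := h
    refine (Set.countable_range fun n : ℤ => φ + n * (2 * π)).mono fun θ hθ => ?_
    obtain ⟨n, hn⟩ := Complex.exp_eq_exp_iff_exists_int.1 hθ
    refine ⟨n, ?_⟩
    have h1 : ((θ : ℂ) - (φ + n * (2 * π))) * Complex.I = 0 := by linear_combination hn
    have h2 : (θ : ℂ) - (φ + n * (2 * π)) = 0 := by simpa using h1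
    have h3 : θ - (φ + n * (2 * π)) = 0 := by exact_mod_cast h2
    simp only
    linarith
  · push Not at h
    simp [h]

lemma arc_absolutelyContinuous : arc ≪ volume :=
  (Measure.smul_absolutelyContinuous).trans Measure.absolutelyContinuous_restrict

lemma ae_circ_ne (a : ℂ) : ∀ᵐ θ ∂arc, circ θ ≠ a :=
  arc_absolutelyContinuous.ae_le ((countable_circ_eq a).ae_notMem volume)

lemma circ_add (θ φ : ℝ) : circ (θ + φ) = circ θ * circ φ := by
  simp [circ, add_mul, Complex.exp_add]

lemma periodic_circ : Function.Periodic circ (2 * π) := fun θ => by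
  rw [circ_add]
  simp [circ]

lemma exists_circ_eq {a : ℂ} (ha : ‖a‖ = 1) : ∃ φ, circ φ = a := by
  refine ⟨a.arg, ?_⟩
  have := Complex.norm_mul_exp_arg_mul_I a
  rwa [ha, Complex.ofReal_one, one_mul] at this

/-- A holomorphic function on the unit disc with dominated radial limits. -/
structure Radial (F : ℂ → ℂ) (f : ℝ → ℂ) : Prop where
  diff : DifferentiableOn ℂ F (ball 0 1)
  bound : ∃ g : ℝ → ℝ, Integrable g arc ∧
    ∀ R : ℝ, 0 < R → R < 1 → ∀ᵐ θ ∂arc, ‖F (R * circ θ)‖ ≤ g θ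
  lim : ∀ᵐ θ ∂arc, Tendsto (fun R : ℝ => F (R * circ θ)) (nhdsWithin 1 (Iio 1)) (nhds (f θ))

lemma norm_ofReal_mul_circ {R : ℝ} (hR : 0 ≤ R) (θ : ℝ) : ‖(R : ℂ) * circ θ‖ = R := by
  rw [norm_mul, norm_circ, mul_one, Complex.norm_real, Real.norm_of_nonneg hR]

lemma tendsto_ofReal_mul_circ (θ : ℝ) :
    Tendsto (fun R : ℝ => (R : ℂ) * circ θ) (nhdsWithin 1 (Iio 1)) (nhds (circ θ)) := by
  have h : Continuous fun R : ℝ => (R : ℂ) * circ θ := by fun_prop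
  have := h.tendsto 1
  rw [Complex.ofReal_one, one_mul] at this
  exact this.mono_left nhdsWithin_le_nhds

namespace Radial

variable {F : ℂ → ℂ} {f : ℝ → ℂ}

lemma tendsto_integral (h : Radial F f) {k : ℂ → ℂ} {R₀ : ℝ} (hR₀ : 0 ≤ R₀) (hR₁ : R₀ < 1)
    (hk : ContinuousOn k {z | R₀ ≤ ‖z‖ ∧ ‖z‖ ≤ 1}) :
    Tendsto (fun R : ℝ => ∫ θ, k (R * circ θ) * F (R * circ θ) ∂arc) (nhdsWithin 1 (Iio 1))
      (nhds (∫ θ, k (circ θ) * f θ ∂arc)) := by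
  obtain ⟨g, hg, hgb⟩ := h.bound
  have hcomp : IsCompact {z : ℂ | R₀ ≤ ‖z‖ ∧ ‖z‖ ≤ 1} := by
    refine (isCompact_closedBall (0 : ℂ) 1).of_isClosed_subset ?_ fun z hz => ?_
    · exact (isClosed_le continuous_const continuous_norm).inter
        (isClosed_le continuous_norm continuous_const)
    · simpa using hz.2
  obtain ⟨C, hC⟩ := hcomp.exists_bound_of_continuousOn hk
  have hev : ∀ᶠ R : ℝ in nhdsWithin 1 (Iio 1), R₀ < R ∧ R < 1 :=
    (eventually_nhdsWithin_of_eventually_nhds (eventually_gt_nhds hR₁)).and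
      eventually_mem_nhdsWithin
  have hmem : ∀ {R : ℝ}, R₀ < R → R < 1 → ∀ θ, (R : ℂ) * circ θ ∈ {z : ℂ | R₀ ≤ ‖z‖ ∧ ‖z‖ ≤ 1} := by
    intro R h1 h2 θ
    simp only [mem_ofPred_eq]
    rw [norm_ofReal_mul_circ (hR₀.trans h1.le)]
    exact ⟨h1.le, h2.le⟩
  refine tendsto_integral_filter_of_dominated_convergence (fun θ => C * g θ) ?_ ?_
    (hg.const_mul C) ?_
  · filter_upwards [hev] with R hR
    have hc : Continuous fun θ : ℝ => (R : ℂ) * circ θ := continuous_const.mul continuous_circ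
    refine Continuous.aestronglyMeasurable ((hk.comp_continuous hc (hmem hR.1 hR.2)).mul
      (h.diff.continuousOn.comp_continuous hc fun θ => ?_))
    rw [mem_ball_zero_iff, norm_ofReal_mul_circ (hR₀.trans hR.1.le)]
    exact hR.2
  · filter_upwards [hev] with R hR
    filter_upwards [hgb R (hR₀.trans_lt hR.1) hR.2] with θ hθ
    rw [norm_mul]
    have h1 := hC _ (hmem hR.1 hR.2 θ)
    have h2 := (norm_nonneg _).trans h1
    gcongr
  · filter_upwards [h.lim] with θ hθ
    refine Tendsto.mul ?_ hθ
    have h1 : circ θ ∈ {z : ℂ | R₀ ≤ ‖z‖ ∧ ‖z‖ ≤ 1} := by simp [hR₁.le]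
    refine (hk _ h1).tendsto.comp (tendsto_nhdsWithin_iff.2 ⟨tendsto_ofReal_mul_circ θ, ?_⟩)
    filter_upwards [hev] with R hR using hmem hR.1 hR.2 θ

lemma integral_eq (h : Radial F f) {k : ℂ → ℂ} {R₀ : ℝ} (hR₀ : 0 ≤ R₀) (hR₁ : R₀ < 1)
    (hk : ContinuousOn k {z | R₀ ≤ ‖z‖ ∧ ‖z‖ ≤ 1}) {c : ℂ}
    (hc : ∀ R : ℝ, R₀ < R → R < 1 → Real.circleAverage (fun z => k z * F z) 0 R = c) :
    ∫ θ, k (circ θ) * f θ ∂arc = c := by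
  refine tendsto_nhds_unique (h.tendsto_integral hR₀ hR₁ hk)
    (tendsto_const_nhds.congr' ?_)
  have hev : ∀ᶠ R : ℝ in nhdsWithin 1 (Iio 1), R₀ < R ∧ R < 1 :=
    (eventually_nhdsWithin_of_eventually_nhds (eventually_gt_nhds hR₁)).and
      eventually_mem_nhdsWithin
  filter_upwards [hev] with R hR
  rw [← hc R hR.1 hR.2, circleAverage_eq]

lemma diffContOnCl {F : ℂ → ℂ} (h : DifferentiableOn ℂ F (ball 0 1)) {R : ℝ} (h0 : 0 < R)
    (h1 : R < 1) :
    DiffContOnCl ℂ F (ball 0 |R|) := by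
  rw [abs_of_pos h0]
  refine DifferentiableOn.diffContOnCl (h.mono ?_)
  rw [closure_ball _ h0.ne']
  exact closedBall_subset_ball h1

/-- The mean value property. -/
lemma integral_mul_eq (h : Radial F f) {k : ℂ → ℂ} (hk : DifferentiableOn ℂ k (ball 0 1))
    (hkc : ContinuousOn k (closedBall 0 1)) : ∫ θ, k (circ θ) * f θ ∂arc = k 0 * F 0 := by
  refine h.integral_eq le_rfl zero_lt_one (hkc.mono fun z hz => by simpa using hz.2)
    fun R h0 h1 => ?_
  exact DiffContOnCl.circleAverage (f := fun z => k z * F z) (diffContOnCl (hk.mul h.diff) h0 h1)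

lemma integral_eq_zero_value (h : Radial F f) : ∫ θ, f θ ∂arc = F 0 := by
  simpa using h.integral_mul_eq (k := fun _ => 1) (differentiableOn_const _) continuousOn_const

/-- Cauchy's formula on the boundary. -/
lemma cauchy (h : Radial F f) {y : ℂ} (hy : ‖y‖ < 1) :
    ∫ θ, circ θ / (circ θ - y) * f θ ∂arc = F y := by
  refine h.integral_eq (k := fun z => z / (z - y)) (R₀ := (1 + ‖y‖) / 2) (by positivity)
    (by linarith) ?_ fun R h0 h1 => ?_
  · refine continuousOn_id.div (by fun_prop) fun z hz h0 => ?_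
    rw [sub_eq_zero] at h0
    rw [h0] at hz
    have := hz.1
    linarith
  · have hR : 0 < R := by linarith [norm_nonneg y]
    have := (diffContOnCl h.diff hR h1).circleAverage_smul_div (w := y) (by
      rw [mem_ball_zero_iff, abs_of_pos hR]; linarith)
    simpa using this

lemma mul (h : Radial F f) {k : ℂ → ℂ} (hk : DifferentiableOn ℂ k (ball 0 1))
    (hkc : ContinuousOn k (closedBall 0 1)) : Radial (fun z => k z * F z)
      (fun θ => k (circ θ) * f θ) := by
  obtain ⟨C, hC⟩ := (isCompact_closedBall (0 : ℂ) 1).exists_bound_of_continuousOn hkc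
  obtain ⟨g, hg, hgb⟩ := h.bound
  refine ⟨hk.mul h.diff, ⟨fun θ => C * g θ, hg.const_mul C, fun R h0 h1 => ?_⟩, ?_⟩
  · filter_upwards [hgb R h0 h1] with θ hθ
    have h2 := hC (R * circ θ) (by
      rw [mem_closedBall_zero_iff, norm_ofReal_mul_circ h0.le]; exact h1.le)
    have h3 := (norm_nonneg _).trans h2
    rw [norm_mul]
    gcongr
  · filter_upwards [h.lim] with θ hθ
    refine Tendsto.mul ?_ hθ
    refine (hkc (circ θ) (by simp)).tendsto.comp
      (tendsto_nhdsWithin_iff.2 ⟨tendsto_ofReal_mul_circ θ, ?_⟩)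
    have hev : ∀ᶠ R : ℝ in nhdsWithin 1 (Iio 1), 0 < R ∧ R < 1 :=
      (eventually_nhdsWithin_of_eventually_nhds (eventually_gt_nhds zero_lt_one)).and
        eventually_mem_nhdsWithin
    filter_upwards [hev] with R hR
    rw [mem_closedBall_zero_iff, norm_ofReal_mul_circ hR.1.le]; exact hR.2.le

end Radial

/-- The Taylor series at the origin as a formal power series. -/
noncomputable def tps (F : ℂ → ℂ) : PowerSeries ℂ :=
  PowerSeries.mk fun n => iteratedDeriv n F 0 / (n.factorial : ℂ)

lemma tps_eq_of_hasSum {F : ℂ → ℂ} {c : ℕ → ℂ} {r : ℝ} (hr : 0 < r)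
    (h : ∀ z ∈ ball (0 : ℂ) r, HasSum (fun n => c n * z ^ n) (F z)) : tps F = PowerSeries.mk c := by
  set p := FormalMultilinearSeries.ofScalars ℂ c with hp
  have h1 : ENNReal.ofReal (r / 2) ≤ p.radius := by
    have h2 := (h ((r / 2 : ℝ) : ℂ) (by
      rw [mem_ball_zero_iff, Complex.norm_real, Real.norm_of_nonneg (by positivity)]
      linarith)).summable.tendsto_atTop_zero.norm
    rw [norm_zero] at h2
    refine p.le_radius_of_tendsto (r := ⟨r / 2, by positivity⟩) (l := 0) ?_ |>.trans' ?_
    · refine h2.congr fun n => ?_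
      rw [hp, FormalMultilinearSeries.ofScalars_norm, norm_mul, norm_pow, Complex.norm_real,
        Real.norm_of_nonneg (by positivity)]
      rfl
    · rw [ENNReal.ofReal, Real.toNNReal_of_nonneg (by positivity)]
      exact le_rfl
  have h3 : HasFPowerSeriesOnBall F p 0 (ENNReal.ofReal (r / 2)) := by
    refine ⟨h1, by simpa using hr, fun {y} hy => ?_⟩
    have hy' : ‖y‖ < r / 2 := by
      rw [Metric.eball_ofReal, mem_ball_zero_iff] at hy
      exact hy
    have := h y (by rw [mem_ball_zero_iff]; linarith)
    rw [zero_add]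
    refine this.congr_fun fun n => ?_
    simp [hp, mul_comm]
  have h4 : AnalyticAt ℂ F 0 := ⟨p, _, h3⟩
  have h5 := h4.hasFPowerSeriesAt.eq_formalMultilinearSeries h3.hasFPowerSeriesAt
  ext n
  rw [tps, PowerSeries.coeff_mk, PowerSeries.coeff_mk]
  have := congrArg (fun q => q.coeff n) h5
  simpa [hp] using this

lemma hasSum_tps {F : ℂ → ℂ} (hF : DifferentiableOn ℂ F (ball 0 1)) {z : ℂ} (hz : ‖z‖ < 1) :
    HasSum (fun n => PowerSeries.coeff n (tps F) * z ^ n) (F z) := by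
  have := Complex.hasSum_taylorSeries_on_ball (c := 0) (r := 1) hF
    (z := z) (by simpa using hz)
  refine this.congr_fun fun n => ?_
  simp only [tps, PowerSeries.coeff_mk, sub_zero, smul_eq_mul]
  ring

lemma coeff_zero_tps (F : ℂ → ℂ) : PowerSeries.coeff 0 (tps F) = F 0 := by
  simp [tps]

lemma tps_mul {F H : ℂ → ℂ} (hF : AnalyticAt ℂ F 0) (hH : AnalyticAt ℂ H 0) :
    tps (fun z => F z * H z) = tps F * tps H := by
  ext n
  have : (fun z => F z * H z) = F * H := rfl
  simp only [tps, PowerSeries.coeff_mk, PowerSeries.coeff_mul, this,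
    iteratedDeriv_mul hF.contDiffAt hH.contDiffAt,
    Finset.Nat.sum_antidiagonal_eq_sum_range_succ_mk, Finset.sum_div]
  refine Finset.sum_congr rfl fun i hi => ?_
  rw [Nat.cast_choose _ (by grind)]
  field_simp [Nat.factorial_ne_zero]

lemma tps_deriv (F : ℂ → ℂ) : tps (deriv F) = PowerSeries.derivative ℂ (tps F) := by
  ext n
  rw [PowerSeries.coeff_derivative, tps, tps, PowerSeries.coeff_mk, PowerSeries.coeff_mk,
    ← iteratedDeriv_succ', Nat.factorial_succ]
  have : (n.factorial : ℂ) ≠ 0 := by exact_mod_cast n.factorial_ne_zero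
  have : (n : ℂ) + 1 ≠ 0 := by exact_mod_cast n.succ_ne_zero
  push_cast
  field_simp

lemma tps_eval (p : ℂ[X]) : tps (fun z => p.eval z) = (p : PowerSeries ℂ) := by
  have : tps (fun z => p.eval z) = PowerSeries.mk p.coeff := by
    refine tps_eq_of_hasSum zero_lt_one fun z _ => ?_
    rw [eval_eq_sum_range]
    refine hasSum_sum_of_ne_finset_zero fun n hn => ?_
    rw [coeff_eq_zero_of_natDegree_lt (by simpa using hn), zero_mul]
  rw [this]
  ext n
  simp

/-- Boundary integrals compute Taylor coefficients. -/
lemma Radial.integral_coeff {F : ℂ → ℂ} {f : ℝ → ℂ} (h : Radial F f) (n : ℕ) :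
    ∫ θ, (starRingEnd ℂ) (circ θ) ^ n * f θ ∂arc = PowerSeries.coeff n (tps F) := by
  have h1 : ∀ θ, (starRingEnd ℂ) (circ θ) ^ n * f θ = (circ θ ^ n)⁻¹ * f θ := fun θ => by
    rw [conj_circ, inv_pow]
  simp only [h1]
  refine h.integral_eq (k := fun z => (z ^ n)⁻¹) (R₀ := 1 / 2) (by norm_num) (by norm_num) ?_
    fun R h2 h3 => ?_
  · refine ContinuousOn.inv₀ (by fun_prop) fun z hz h0 => ?_
    have hz0 : z = 0 := eq_zero_of_pow_eq_zero h0
    have := hz.1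
    rw [hz0, norm_zero] at this
    norm_num at this
  · have hR : 0 < R := by linarith
    rw [Real.circleAverage_eq_circleIntegral hR.ne']
    have := DiffContOnCl.circleIntegral_one_div_sub_center_pow_smul hR n
      (by simpa [abs_of_pos hR] using diffContOnCl h.diff hR h3)
    have h4 : (∮ z in C(0, R), (z - 0)⁻¹ • ((z ^ n)⁻¹ * F z)) =
        ∮ z in C(0, R), (1 / (z - 0) ^ (n + 1)) • F z := by
      congr 1
      ext z
      rw [sub_zero, smul_eq_mul, smul_eq_mul, one_div, pow_succ, mul_inv]
      ring
    rw [h4, this, tps, PowerSeries.coeff_mk, smul_eq_mul, smul_eq_mul]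
    field_simp [Complex.two_pi_I_ne_zero]

lemma Radial.const (c : ℂ) : Radial (fun _ => c) (fun _ => c) :=
  ⟨differentiableOn_const _, ⟨fun _ => ‖c‖, integrable_const _, fun _ _ _ => ae_of_all _ fun _ =>
    le_rfl⟩, ae_of_all _ fun _ => tendsto_const_nhds⟩

/-- `D` is an outer function whose squared boundary modulus is the density of `μ`. -/
structure Outer (μ : Measure ℝ) (D : ℂ → ℂ) (D₀ : ℝ) : Prop where
  pos : 0 < D₀
  zero : D 0 = D₀
  radial : Radial D fun θ => D (circ θ)
  memLp : MemLp (fun θ => D (circ θ)) 2 arc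
  ne_zero : ∀ z, ‖z‖ < 1 → D z ≠ 0
  ratio : ∃ g : ℝ → ℝ, MemLp g 2 arc ∧
    ∀ R : ℝ, 0 < R → R < 1 → ∀ᵐ θ ∂arc, ‖D (circ θ) / D (R * circ θ)‖ ≤ g θ
  ae_ne : ∀ᵐ θ ∂arc, D (circ θ) ≠ 0
  integral : ∀ f : ℝ → ℂ, ∫ θ, f θ ∂μ = ∫ θ, ((‖D (circ θ)‖ ^ 2 : ℝ) : ℂ) * f θ ∂arc

namespace Outer

variable {μ : Measure ℝ} {D : ℂ → ℂ} {D₀ : ℝ}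

lemma ip_eq (O : Outer μ D D₀) (p q : ℂ[X]) :
    ip μ p q = ∫ θ, (p.eval (circ θ) * D (circ θ)) *
      (starRingEnd ℂ) (q.eval (circ θ) * D (circ θ)) ∂arc := by
  rw [ip, O.integral]
  congr 1
  ext θ
  rw [← Complex.normSq_eq_norm_sq, ← Complex.mul_conj, map_mul]
  ring

lemma nsq_eq (O : Outer μ D D₀) (p : ℂ[X]) :
    nsq μ p = ∫ θ, ‖p.eval (circ θ) * D (circ θ)‖ ^ 2 ∂arc := by
  have h := ip_self μ p
  rw [O.ip_eq] at h
  have h2 : (fun θ => (p.eval (circ θ) * D (circ θ)) *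
      (starRingEnd ℂ) (p.eval (circ θ) * D (circ θ))) =
      fun θ => ((‖p.eval (circ θ) * D (circ θ)‖ ^ 2 : ℝ) : ℂ) := by
    ext θ
    rw [Complex.mul_conj, Complex.normSq_eq_norm_sq]
  rw [h2, integral_complex_ofReal] at h
  exact_mod_cast h.symm

lemma memLp_mul {f : ℝ → ℂ} (hf : MemLp f 2 arc) {k : ℂ → ℂ} (hk : ContinuousOn k (sphere 0 1)) :
    MemLp (fun θ => k (circ θ) * f θ) 2 arc := by
  obtain ⟨C, -, hC⟩ := exists_bound_circ hk
  refine hf.of_le_mul (c := C) ((continuous_comp_circ hk).aestronglyMeasurable.mul hf.1)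
    (ae_of_all _ fun θ => ?_)
  rw [norm_mul]
  exact mul_le_mul_of_nonneg_right (hC θ) (norm_nonneg _)

lemma memLp_eval (O : Outer μ D D₀) (p : ℂ[X]) :
    MemLp (fun θ => p.eval (circ θ) * D (circ θ)) 2 arc :=
  memLp_mul O.memLp (k := fun z => p.eval z) (by fun_prop)

lemma radial_eval (O : Outer μ D D₀) (p : ℂ[X]) :
    Radial (fun z => p.eval z * D z) fun θ => p.eval (circ θ) * D (circ θ) :=
  O.radial.mul (k := fun z => p.eval z) (by fun_prop) (by fun_prop)

lemma integral_eval (O : Outer μ D D₀) (p : ℂ[X]) :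
    ∫ θ, p.eval (circ θ) * D (circ θ) ∂arc = p.coeff 0 * D₀ := by
  rw [(O.radial_eval p).integral_eq_zero_value, O.zero, coeff_zero_eq_eval_zero]

lemma norm_integral_sq_le {f : ℝ → ℂ} (hf : MemLp f 2 arc) :
    ‖∫ θ, f θ ∂arc‖ ^ 2 ≤ ∫ θ, ‖f θ‖ ^ 2 ∂arc := by
  have := norm_integral_mul_sq_le hf (memLp_const (1 : ℂ))
  simpa using this

lemma low (O : Outer μ D D₀) (p : ℂ[X]) : D₀ ^ 2 * ‖p.coeff 0‖ ^ 2 ≤ nsq μ p := by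
  have := norm_integral_sq_le (O.memLp_eval p)
  rw [O.integral_eval, norm_mul, mul_pow, Complex.norm_real, Real.norm_of_nonneg O.pos.le,
    ← O.nsq_eq] at this
  linarith

lemma summable_taylor (O : Outer μ D D₀) : ∃ e : ℕ → ℂ, e 0 = 1 ∧ ∀ z : ℂ, ‖z‖ < 1 →
    HasSum (fun n => e n * z ^ n) (D₀ / D z) := by
  have hd : DifferentiableOn ℂ (fun z => D₀ / D z) (ball 0 1) :=
    (differentiableOn_const _).div O.radial.diff fun z hz => O.ne_zero z (by simpa using hz)
  refine ⟨fun n => PowerSeries.coeff n (tps fun z => D₀ / D z), ?_, fun z hz => hasSum_tps hd hz⟩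
  have h0 : (D₀ : ℂ) ≠ 0 := by exact_mod_cast O.pos.ne'
  change PowerSeries.coeff 0 (tps fun z => D₀ / D z) = 1
  rw [coeff_zero_tps, O.zero, div_self h0]

lemma tendsto_ratio (O : Outer μ D D₀) :
    Tendsto (fun R : ℝ => ∫ θ, ‖D₀ / D (R * circ θ) * D (circ θ)‖ ^ 2 ∂arc)
      (nhdsWithin 1 (Iio 1)) (nhds (D₀ ^ 2)) := by
  obtain ⟨g, hg, hgb⟩ := O.ratio
  have hev : ∀ᶠ R : ℝ in nhdsWithin 1 (Iio 1), 0 < R ∧ R < 1 :=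
    (eventually_nhdsWithin_of_eventually_nhds (eventually_gt_nhds zero_lt_one)).and
      eventually_mem_nhdsWithin
  have hlim : ∫ _θ : ℝ, D₀ ^ 2 ∂arc = D₀ ^ 2 := by simp
  rw [← hlim]
  refine tendsto_integral_filter_of_dominated_convergence (fun θ => D₀ ^ 2 * g θ ^ 2) ?_ ?_
    (hg.integrable_sq.const_mul _) ?_
  · filter_upwards [hev] with R hR
    have hc : Continuous fun θ : ℝ => (R : ℂ) * circ θ := continuous_const.mul continuous_circ
    have hmem : ∀ θ : ℝ, (R : ℂ) * circ θ ∈ ball (0 : ℂ) 1 := fun θ => by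
      rw [mem_ball_zero_iff, norm_ofReal_mul_circ hR.1.le]; exact hR.2
    have h1 := O.radial.diff.continuousOn.comp_continuous hc hmem
    have h2 : Continuous fun θ : ℝ => (D₀ : ℂ) / D (R * circ θ) :=
      continuous_const.div h1 fun θ => O.ne_zero _ (by simpa using hmem θ)
    exact ((h2.aestronglyMeasurable.mul O.memLp.1).norm.pow 2)
  · filter_upwards [hev] with R hR
    filter_upwards [hgb R hR.1 hR.2] with θ hθ
    rw [Real.norm_of_nonneg (by positivity), div_mul_eq_mul_div, mul_div_assoc, norm_mul, mul_pow,
      Complex.norm_real, Real.norm_of_nonneg O.pos.le]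
    gcongr
  · filter_upwards [O.radial.lim, O.ae_ne] with θ h1 h2
    have h3 := (((tendsto_const_nhds (x := (D₀ : ℂ))).div h1 h2).mul_const (D (circ θ))).norm.pow 2
    rwa [div_mul_cancel₀ _ h2, Complex.norm_real, Real.norm_of_nonneg O.pos.le] at h3

lemma exists_poly (O : Outer μ D D₀) {ε : ℝ} (hε : 0 < ε) :
    ∃ p : ℂ[X], p.coeff 0 = 1 ∧ nsq μ p < D₀ ^ 2 + ε := by
  have hev : ∀ᶠ R : ℝ in nhdsWithin 1 (Iio 1), 0 < R ∧ R < 1 :=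
    (eventually_nhdsWithin_of_eventually_nhds (eventually_gt_nhds zero_lt_one)).and
      eventually_mem_nhdsWithin
  obtain ⟨R, hR, hR0, hR1⟩ := ((O.tendsto_ratio.eventually_lt_const
    (lt_add_of_pos_right (D₀ ^ 2) hε)).and hev).exists
  obtain ⟨e, he0, he⟩ := O.summable_taylor
  set P : ℕ → ℂ[X] := fun N => ∑ n ∈ Finset.range N, C (e n * (R : ℂ) ^ n) * X ^ n with hP
  have hPe : ∀ N z, (P N).eval z = ∑ n ∈ Finset.range N, e n * ((R : ℂ) * z) ^ n := by
    intro N z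
    simp [hP, eval_finsetSum, mul_pow, mul_assoc]
  have hsum : Summable fun n => ‖e n‖ * R ^ n := by
    have := (he R (by rwa [Complex.norm_real, Real.norm_of_nonneg hR0.le])).summable.norm
    simpa [abs_of_pos hR0] using this
  have hbd : ∀ N θ, ‖(P N).eval (circ θ)‖ ≤ ∑' n, ‖e n‖ * R ^ n := by
    intro N θ
    rw [hPe]
    refine (norm_sum_le _ _).trans (le_trans (Finset.sum_le_sum fun n _ => ?_)
      (hsum.sum_le_tsum (Finset.range N) fun n _ => by positivity))
    rw [norm_mul, norm_pow, norm_ofReal_mul_circ hR0.le]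
  have hlim : Tendsto (fun N => nsq μ (P N)) atTop
      (nhds (∫ θ, ‖D₀ / D (R * circ θ) * D (circ θ)‖ ^ 2 ∂arc)) := by
    simp only [O.nsq_eq]
    refine tendsto_integral_of_dominated_convergence
      (fun θ => (∑' n, ‖e n‖ * R ^ n) ^ 2 * ‖D (circ θ)‖ ^ 2)
      (fun N => ((O.memLp_eval (P N)).1.norm.pow 2)) ?_ (fun N => ae_of_all _ fun θ => ?_)
      (ae_of_all _ fun θ => ?_)
    · exact ((memLp_two_iff_integrable_sq_norm O.memLp.1).1 O.memLp).const_mul _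
    · rw [Real.norm_of_nonneg (by positivity), norm_mul, mul_pow]
      have := hbd N θ
      gcongr
    · have h1 := (he (R * circ θ) (by rwa [norm_ofReal_mul_circ hR0.le])).tendsto_sum_nat
      simp only [hPe]
      exact ((h1.mul_const _).norm.pow 2)
  obtain ⟨N, hN, hN1⟩ := ((hlim.eventually_lt_const hR).and (eventually_ge_atTop 1)).exists
  refine ⟨P N, ?_, hN⟩
  rw [coeff_zero_eq_eval_zero, hPe]
  obtain ⟨M, rfl⟩ := Nat.exists_eq_add_of_le' hN1
  rw [Finset.sum_range_succ']
  simp [he0]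

/-- The deviation of `star Φ n * D` from its value at the origin. -/
noncomputable def dev (D : ℂ → ℂ) (D₀ : ℝ) (Φ : ℕ → ℂ[X]) (n : ℕ) (θ : ℝ) : ℂ :=
  (star Φ n).eval (circ θ) * D (circ θ) - D₀

lemma memLp_dev (O : Outer μ D D₀) (Φ : ℕ → ℂ[X]) (n : ℕ) : MemLp (dev D D₀ Φ n) 2 arc :=
  (O.memLp_eval _).sub (memLp_const _)

variable [IsFiniteMeasure μ] {Φ : ℕ → ℂ[X]} {α : ℕ → ℂ}

lemma tendsto_nsq (O : Outer μ D D₀) (S : System μ D₀ Φ α) :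
    Tendsto (fun n => nsq μ (Φ n)) atTop (nhds (D₀ ^ 2)) := by
  refine tendsto_order.2 ⟨fun b hb => Eventually.of_forall fun n => hb.trans_le (S.le_nsq n),
    fun b hb => ?_⟩
  obtain ⟨p, hp0, hp⟩ := O.exists_poly (sub_pos.2 hb)
  filter_upwards [eventually_ge_atTop p.natDegree] with n hn
  refine lt_of_le_of_lt ?_ (hp.trans_eq (by ring))
  have h1 := norm_ip_sq_le μ p (star Φ n)
  have h2 := S.nsq_pos n
  rw [S.ip_star_of_natDegree_le hn, hp0, one_mul, Complex.norm_real, Real.norm_of_nonneg h2.le,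
    S.nsq_star] at h1
  nlinarith

lemma integral_norm_dev_sq (O : Outer μ D D₀) (S : System μ D₀ Φ α) (n : ℕ) :
    ∫ θ, ‖dev D D₀ Φ n θ‖ ^ 2 ∂arc = nsq μ (Φ n) - D₀ ^ 2 := by
  have hL := O.memLp_eval (star Φ n)
  set f : ℝ → ℂ := fun θ => (star Φ n).eval (circ θ) * D (circ θ) with hf
  have hi : Integrable f arc := hL.integrable (by norm_num)
  have h1 : ∀ θ, ‖dev D D₀ Φ n θ‖ ^ 2 = ‖f θ‖ ^ 2 - 2 * D₀ * (f θ).re + D₀ ^ 2 := by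
    intro θ
    rw [dev, ← Complex.normSq_eq_norm_sq, ← Complex.normSq_eq_norm_sq, Complex.normSq_sub]
    simp [hf, Complex.normSq_apply]
    ring
  simp only [h1]
  have hsq : Integrable (fun θ => ‖f θ‖ ^ 2) arc := (memLp_two_iff_integrable_sq_norm hL.1).1 hL
  have hre : Integrable (fun θ => 2 * D₀ * (f θ).re) arc := hi.re.const_mul _
  have hsub : Integrable (fun θ => ‖f θ‖ ^ 2 - 2 * D₀ * (f θ).re) arc := hsq.sub hre
  rw [integral_add hsub (integrable_const _), integral_sub hsq hre, integral_const_mul]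
  have h2 : ∫ θ, (f θ).re ∂arc = D₀ := by
    have := integral_re (𝕜 := ℂ) hi
    simp only [RCLike.re_to_complex] at this
    rw [this, O.integral_eval, S.coeff_zero_star]
    simp
  rw [h2, ← O.nsq_eq, S.nsq_star]
  simp
  ring

lemma norm_integral_dev_le (O : Outer μ D D₀) (S : System μ D₀ Φ α) {f : ℝ → ℂ}
    (hf : MemLp f 2 arc) (n : ℕ) :
    ‖∫ θ, f θ * dev D D₀ Φ n θ ∂arc‖ ^ 2 ≤ (∫ θ, ‖f θ‖ ^ 2 ∂arc) * (nsq μ (Φ n) - D₀ ^ 2) := by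
  rw [← O.integral_norm_dev_sq S n]
  exact norm_integral_mul_sq_le hf (O.memLp_dev Φ n)

lemma tendsto_integral_dev (O : Outer μ D D₀) (S : System μ D₀ Φ α) {f : ℝ → ℂ}
    (hf : MemLp f 2 arc) :
    Tendsto (fun n => ∫ θ, f θ * dev D D₀ Φ n θ ∂arc) atTop (nhds 0) := by
  rw [tendsto_zero_iff_norm_tendsto_zero]
  have h1 : Tendsto (fun n => (∫ θ, ‖f θ‖ ^ 2 ∂arc) * (nsq μ (Φ n) - D₀ ^ 2)) atTop
      (nhds ((∫ θ, ‖f θ‖ ^ 2 ∂arc) * (D₀ ^ 2 - D₀ ^ 2))) :=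
    ((O.tendsto_nsq S).sub_const _).const_mul _
  rw [sub_self, mul_zero] at h1
  have h2 := h1.sqrt
  rw [Real.sqrt_zero] at h2
  exact squeeze_zero (fun n => norm_nonneg _)
    (fun n => Real.le_sqrt_of_sq_le (O.norm_integral_dev_le S hf n)) h2

lemma tendsto_integral_mul (O : Outer μ D D₀) (S : System μ D₀ Φ α) {f : ℝ → ℂ}
    (hf : MemLp f 2 arc) :
    Tendsto (fun n => ∫ θ, f θ * ((star Φ n).eval (circ θ) * D (circ θ)) ∂arc) atTop
      (nhds (D₀ * ∫ θ, f θ ∂arc)) := by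
  have h1 := (O.tendsto_integral_dev S hf).add_const (D₀ * ∫ θ, f θ ∂arc)
  rw [zero_add] at h1
  refine h1.congr fun n => ?_
  have hi1 : Integrable (fun θ => f θ * dev D D₀ Φ n θ) arc :=
    hf.integrable_mul (O.memLp_dev Φ n)
  have hi2 : Integrable (fun θ => D₀ * f θ) arc := (hf.integrable (by norm_num)).const_mul _
  rw [← integral_const_mul, ← integral_add hi1 hi2]
  congr 1
  ext θ
  rw [dev]
  ring

/-- Pointwise control of `star Φ n * D` inside the disc. -/
lemma norm_eval_sub_le (O : Outer μ D D₀) (S : System μ D₀ Φ α) (n : ℕ) {y : ℂ} (hy : ‖y‖ < 1) :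
    ‖(star Φ n).eval y * D y - D₀‖ ^ 2 ≤ (1 - ‖y‖ ^ 2)⁻¹ * (nsq μ (Φ n) - D₀ ^ 2) := by
  have hk : ContinuousOn (fun z : ℂ => z / (z - y)) (sphere 0 1) := by
    refine continuousOn_id.div (by fun_prop) fun z hz h0 => ?_
    rw [sub_eq_zero] at h0
    rw [← h0] at hy
    simp [mem_sphere_zero_iff_norm.1 hz] at hy
  have hkL : MemLp (fun θ => circ θ / (circ θ - y)) 2 arc := by
    have := memLp_mul (memLp_const (1 : ℂ)) hk
    simpa using this
  have h1 := O.norm_integral_dev_le S hkL n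
  have h2 : ∫ θ, circ θ / (circ θ - y) * dev D D₀ Φ n θ ∂arc =
      (star Φ n).eval y * D y - D₀ := by
    have h3 := (O.radial_eval (star Φ n)).cauchy hy
    have h4 := (Radial.const D₀).cauchy hy
    have hi1 : Integrable (fun θ => circ θ / (circ θ - y) *
        ((star Φ n).eval (circ θ) * D (circ θ))) arc :=
      MemLp.integrable_mul (p := 2) (q := 2) hkL (O.memLp_eval _)
    have hi2 : Integrable (fun θ => circ θ / (circ θ - y) * (D₀ : ℂ)) arc :=
      (hkL.integrable (by norm_num)).mul_const _
    rw [← h3, ← h4, ← integral_sub hi1 hi2]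
    congr 1
    ext θ
    rw [dev]; ring
  have h5 : ∫ θ, ‖circ θ / (circ θ - y)‖ ^ 2 ∂arc = (1 - ‖y‖ ^ 2)⁻¹ := by
    have hne : ∀ z : ℂ, ‖z‖ ≤ 1 → 1 - (starRingEnd ℂ) y * z ≠ 0 := by
      intro z hz h0
      have h6 : ‖(starRingEnd ℂ) y * z‖ = 1 := by rw [← sub_eq_zero.1 h0, norm_one]
      rw [norm_mul, RCLike.norm_conj] at h6
      nlinarith [norm_nonneg y, norm_nonneg z]
    have h7 := ((Radial.const 1).mul (k := fun z => (1 - (starRingEnd ℂ) y * z)⁻¹)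
      (DifferentiableOn.inv (by fun_prop) fun z hz => hne z (by simpa using (mem_ball.1 hz).le))
      (ContinuousOn.inv₀ (by fun_prop) fun z hz => hne z (by simpa using hz))).cauchy hy
    have h8 : ∀ θ, circ θ / (circ θ - y) * ((1 - (starRingEnd ℂ) y * circ θ)⁻¹ * 1) =
        ((‖circ θ / (circ θ - y)‖ ^ 2 : ℝ) : ℂ) := by
      intro θ
      rw [← Complex.normSq_eq_norm_sq, ← Complex.mul_conj, mul_one]
      congr 1
      have h9 := circ_ne_zero θ
      have h10 := hne (circ θ) (by simp)
      rw [map_div₀, map_sub, conj_circ]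
      have h11 : (circ θ)⁻¹ - (starRingEnd ℂ) y = (circ θ)⁻¹ * (1 - (starRingEnd ℂ) y * circ θ) := by
        field_simp
      rw [h11, div_mul_eq_div_div, div_self (inv_ne_zero h9), one_div]
    simp only [h8] at h7
    rw [integral_complex_ofReal, mul_one, ← Complex.normSq_eq_conj_mul_self,
      Complex.normSq_eq_norm_sq] at h7
    exact_mod_cast h7
  rwa [h2, h5] at h1

end Outer

namespace Outer

variable {μ : Measure ℝ} {D : ℂ → ℂ} {D₀ : ℝ}

lemma analyticAt (O : Outer μ D D₀) : AnalyticAt ℂ D 0 :=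
  O.radial.diff.analyticAt (ball_mem_nhds 0 one_pos)

lemma coeff_tps_mul_inv (O : Outer μ D D₀) : tps D * (tps D)⁻¹ = 1 := by
  refine PowerSeries.mul_inv_cancel _ ?_
  rw [← PowerSeries.coeff_zero_eq_constantCoeff_apply, coeff_zero_tps, O.zero]
  exact_mod_cast O.pos.ne'

variable [IsFiniteMeasure μ] {Φ : ℕ → ℂ[X]} {α : ℕ → ℂ}

lemma tendsto_coeff_mul (O : Outer μ D D₀) (S : System μ D₀ Φ α) (s : ℕ) :
    Tendsto (fun n => PowerSeries.coeff s ((star Φ n : PowerSeries ℂ) * tps D)) atTop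
      (nhds (if s = 0 then (D₀ : ℂ) else 0)) := by
  have h1 : ∀ n, PowerSeries.coeff s ((star Φ n : PowerSeries ℂ) * tps D) =
      ∫ θ, (starRingEnd ℂ) (circ θ) ^ s * ((star Φ n).eval (circ θ) * D (circ θ)) ∂arc := by
    intro n
    rw [(O.radial_eval (star Φ n)).integral_coeff, tps_mul _ O.analyticAt, tps_eval]
    exact Differentiable.analyticAt (f := fun z => (star Φ n).eval z) (by fun_prop) 0
  have h2 : MemLp (fun θ => (starRingEnd ℂ) (circ θ) ^ s) 2 arc := by
    have := memLp_mul (memLp_const (1 : ℂ)) (k := fun z => (starRingEnd ℂ) z ^ s)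
      (by fun_prop)
    simpa using this
  simp only [h1]
  convert O.tendsto_integral_mul S h2 using 2
  have h3 := (Radial.const 1).integral_coeff s
  simp only [mul_one] at h3
  rw [h3]
  have h4 : tps (fun _ => (1 : ℂ)) = 1 := by simpa using tps_eval 1
  rw [h4, PowerSeries.coeff_one]
  split_ifs <;> simp

lemma tendsto_coeff (O : Outer μ D D₀) (S : System μ D₀ Φ α) (i : ℕ) :
    Tendsto (fun n => (star Φ n).coeff i) atTop
      (nhds (D₀ * PowerSeries.coeff i (tps D)⁻¹)) := by
  have h1 : ∀ n, (star Φ n).coeff i = ∑ p ∈ Finset.HasAntidiagonal.antidiagonal i,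
      PowerSeries.coeff p.1 ((star Φ n : PowerSeries ℂ) * tps D) *
        PowerSeries.coeff p.2 (tps D)⁻¹ := by
    intro n
    rw [← PowerSeries.coeff_mul, mul_assoc, O.coeff_tps_mul_inv, mul_one, Polynomial.coeff_coe]
  simp only [h1]
  have h2 := tendsto_finsetSum (Finset.HasAntidiagonal.antidiagonal i) fun p _ =>
    (O.tendsto_coeff_mul S p.1).mul_const (PowerSeries.coeff p.2 (tps D)⁻¹)
  convert h2 using 2
  rw [Finset.Nat.sum_antidiagonal_eq_sum_range_succ_mk, Finset.sum_range_succ']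
  simp

lemma tendsto_ip_one (O : Outer μ D D₀) (S : System μ D₀ Φ α) (t : ℕ) :
    Tendsto (fun n => ip μ (X ^ t * star Φ n) 1) atTop
      (nhds (D₀ * (starRingEnd ℂ) (PowerSeries.coeff t (tps D)))) := by
  have h2 : MemLp (fun θ => circ θ ^ t * (starRingEnd ℂ) (D (circ θ))) 2 arc :=
    memLp_mul (f := fun θ => (starRingEnd ℂ) (D (circ θ))) O.memLp.star
      (k := fun z => z ^ t) (by fun_prop)
  convert O.tendsto_integral_mul S h2 using 2
  · rw [O.ip_eq]
    congr 1
    ext θ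
    simp
    ring
  · rw [← O.radial.integral_coeff, ← integral_conj]
    simp

lemma ip_X_mul_derivative (S : System μ D₀ Φ α) (s n : ℕ) :
    ip μ (X ^ s * star Φ n) (X * derivative (star Φ n)) =
      ∑ i ∈ Finset.range (s + 1), (starRingEnd ℂ) (i * (star Φ n).coeff i) *
        ip μ (X ^ (s - i) * star Φ n) 1 := by
  set N := max n s with hN
  have h1 : X * derivative (star Φ n) =
      ∑ i ∈ Finset.range (N + 1), ((i : ℂ) * (star Φ n).coeff i) • (X : ℂ[X]) ^ i := by
    ext j
    rw [finsetSum_coeff]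
    simp only [coeff_smul, coeff_X_pow, smul_eq_mul, mul_ite, mul_one, mul_zero]
    rw [Finset.sum_ite_eq (Finset.range (N + 1)) j]
    rcases j with _ | j
    · simp
    · rw [coeff_X_mul, coeff_derivative]
      split_ifs with h
      · push_cast; ring
      · rw [Finset.mem_range] at h
        rw [coeff_eq_zero_of_natDegree_lt (by have := S.natDegree_star n; omega), zero_mul]
  rw [h1, ip_sum_right]
  symm
  refine Finset.sum_subset_zero_on_sdiff (Finset.range_mono (by omega)) (fun i hi => ?_)
    fun i hi => ?_
  · rw [Finset.mem_sdiff, Finset.mem_range, Finset.mem_range] at hi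
    obtain ⟨k, rfl⟩ := Nat.exists_eq_add_of_lt (show s < i by omega)
    rw [ip_smul_right, add_assoc, pow_add, ip_X_pow_mul, ← conj_ip]
    by_cases hk : s + k + 1 ≤ n
    · rw [S.ip_X_pow_star (by omega) (by omega), map_zero, mul_zero]
    · rw [coeff_eq_zero_of_natDegree_lt (by have := S.natDegree_star n; omega)]
      simp
  · rw [Finset.mem_range] at hi
    rw [ip_smul_right]
    congr 1
    have h2 := ip_X_pow_mul (μ := μ) i (X ^ (s - i) * star Φ n) 1
    rw [← h2, mul_one, ← mul_assoc, ← pow_add, Nat.add_sub_cancel' (by omega)]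

lemma tendsto_ip_derivative (O : Outer μ D D₀) (S : System μ D₀ Φ α) {lam : ℕ → ℂ}
    (hlam : PowerSeries.X * PowerSeries.derivative ℂ (tps D) = PowerSeries.mk lam * tps D)
    (s : ℕ) :
    Tendsto (fun n => ip μ (X ^ s * star Φ n) (X * derivative (star Φ n))) atTop
      (nhds (-(starRingEnd ℂ) (lam s) * D₀ ^ 2)) := by
  simp only [ip_X_mul_derivative S]
  have h1 := tendsto_finsetSum (Finset.range (s + 1)) fun i _ =>
    ((Complex.continuous_conj.tendsto _).comp ((O.tendsto_coeff S i).const_mul (i : ℂ))).mul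
      (O.tendsto_ip_one S (s - i))
  suffices h : _ = -(starRingEnd ℂ) (lam s) * (D₀ : ℂ) ^ 2 from h ▸ h1
  have h2 : PowerSeries.X * PowerSeries.derivative ℂ (tps D)⁻¹ * tps D = -PowerSeries.mk lam := by
    rw [PowerSeries.derivative_inv']
    have h3 := O.coeff_tps_mul_inv
    linear_combination (-(tps D)⁻¹ ^ 2 * tps D) * hlam -
      PowerSeries.mk lam * (tps D * (tps D)⁻¹ + 1) * h3
  have h4 := congrArg (PowerSeries.coeff s) h2
  rw [PowerSeries.coeff_mul, Finset.Nat.sum_antidiagonal_eq_sum_range_succ_mk] at h4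
  have h5 : lam s = -∑ i ∈ Finset.range (s + 1), i * PowerSeries.coeff i (tps D)⁻¹ *
      PowerSeries.coeff (s - i) (tps D) := by
    have h6 : ∀ i, PowerSeries.coeff i (PowerSeries.X * PowerSeries.derivative ℂ (tps D)⁻¹) =
        i * PowerSeries.coeff i (tps D)⁻¹ := by
      rintro (_ | i)
      · simp
      · rw [PowerSeries.coeff_succ_X_mul, PowerSeries.coeff_derivative]
        push_cast; ring
    simp only [h6, map_neg, PowerSeries.coeff_mk] at h4
    rw [h4, neg_neg]
  rw [h5, map_neg, map_sum, neg_neg, Finset.sum_mul]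
  refine Finset.sum_congr rfl fun i _ => ?_
  simp
  ring

end Outer

lemma intervalIntegrable_abs_rpow {γ c : ℝ} (hγ : -1 < γ) (hc : 0 ≤ c) :
    IntervalIntegrable (fun x : ℝ => |x| ^ γ) volume (-c) c := by
  have h1 : IntervalIntegrable (fun x : ℝ => |x| ^ γ) volume 0 c := by
    refine (intervalIntegral.intervalIntegrable_rpow' hγ).congr fun x hx => ?_
    rw [uIoc_of_le hc] at hx
    rw [abs_of_pos hx.1]
  refine IntervalIntegrable.trans (b := 0) ?_ h1
  have h2 := (IntervalIntegrable.iff_comp_neg (f := fun x : ℝ => |x| ^ γ)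
    (a := 0) (b := c)).1 h1
  simpa using h2.symm

lemma le_norm_circ_sub {θ φ : ℝ} (h : |θ - φ| ≤ π) : 2 / π * |θ - φ| ≤ ‖circ θ - circ φ‖ := by
  have h1 : circ θ - circ φ = circ φ * (Complex.exp (Complex.I * ((θ - φ : ℝ) : ℂ)) - 1) := by
    have : circ θ = circ φ * circ (θ - φ) := by rw [← circ_add, add_sub_cancel]
    rw [this, circ, circ, mul_comm Complex.I]
    ring
  rw [h1, norm_mul, norm_circ, one_mul, Complex.norm_exp_I_mul_ofReal_sub_one, norm_mul,
    Real.norm_eq_abs, Real.norm_eq_abs, abs_two]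
  have h2 := Real.mul_abs_le_abs_sin (x := (θ - φ) / 2) (by
    rw [abs_div, abs_two]; linarith)
  rw [abs_div, abs_two] at h2
  linarith

lemma measurable_norm_circ_sub_rpow (a : ℂ) (γ : ℝ) :
    Measurable fun θ => ‖circ θ - a‖ ^ γ :=
  ((continuous_circ.measurable.sub_const a).norm).pow_const γ

lemma integrable_norm_circ_sub_rpow {a : ℂ} (ha : ‖a‖ = 1) {γ : ℝ} (hγ : -1 < γ) (hγ0 : γ ≤ 0) :
    Integrable (fun θ => ‖circ θ - a‖ ^ γ) arc := by
  obtain ⟨φ, rfl⟩ := exists_circ_eq ha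
  rw [integrable_arc_iff]
  have hper : Function.Periodic (fun θ => ‖circ θ - circ φ‖ ^ γ) (2 * π) := fun θ => by
    simp only [periodic_circ θ]
  refine hper.intervalIntegrable (t := φ - π) (by positivity) ?_ _ _
  have h1 := (intervalIntegrable_abs_rpow hγ Real.pi_pos.le).comp_sub_right φ
  have e1 : -π + φ = φ - π := by ring
  have e2 : π + φ = φ - π + 2 * π := by ring
  rw [e1, e2] at h1
  refine (h1.const_mul ((2 / π) ^ γ)).mono_fun
    (measurable_norm_circ_sub_rpow _ _).aestronglyMeasurable ?_
  have hne : ∀ᵐ θ ∂(volume.restrict (uIoc (φ - π) (φ - π + 2 * π))), θ ≠ φ := by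
    refine ae_restrict_of_ae ?_
    exact (countable_singleton φ).ae_notMem volume
  filter_upwards [hne, ae_restrict_mem measurableSet_uIoc] with θ h2 h3
  rw [uIoc_of_le (by linarith [Real.pi_pos])] at h3
  rw [Real.norm_of_nonneg (by positivity), Real.norm_of_nonneg (by positivity),
    ← Real.mul_rpow (by positivity) (abs_nonneg _)]
  refine Real.rpow_le_rpow_of_nonpos ?_ (le_norm_circ_sub ?_) hγ0
  · have := abs_pos.2 (sub_ne_zero.2 h2)
    positivity
  · rw [abs_le]
    constructor <;> linarith [h3.1, h3.2]

lemma integrable_prod_norm_rpow {ι : Type*} [Fintype ι] [Nonempty ι] {a : ι → ℂ}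
    (ha : ∀ k, ‖a k‖ = 1) {d : ℝ} (hd : 0 < d) (hda : ∀ i j, i ≠ j → d ≤ ‖a i - a j‖)
    {γ : ι → ℝ} (hγ : ∀ k, -1 < γ k) (hγ0 : ∀ k, γ k ≤ 0) :
    Integrable (fun θ => ∏ k, ‖circ θ - a k‖ ^ γ k) arc := by
  classical
  set B : ℝ := ∏ k, max 1 ((d / 2) ^ γ k) with hB
  have hbd : Integrable (fun θ => ∑ k, B * ‖circ θ - a k‖ ^ γ k) arc :=
    integrable_finsetSum _ fun k _ =>
      (integrable_norm_circ_sub_rpow (ha k) (hγ k) (hγ0 k)).const_mul _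
  refine hbd.mono' ?_ (ae_of_all _ fun θ => ?_)
  · exact (Finset.measurable_fun_prod _ fun k _ =>
      measurable_norm_circ_sub_rpow (a k) (γ k)).aestronglyMeasurable
  rw [Real.norm_of_nonneg (Finset.prod_nonneg fun k _ => by positivity)]
  obtain ⟨k₀, -, hk₀⟩ := Finset.exists_min_image Finset.univ (fun k => ‖circ θ - a k‖)
    Finset.univ_nonempty
  have h1 : ∏ k, ‖circ θ - a k‖ ^ γ k ≤ B * ‖circ θ - a k₀‖ ^ γ k₀ := by
    have h2 : ∀ k, k ≠ k₀ → ‖circ θ - a k‖ ^ γ k ≤ max 1 ((d / 2) ^ γ k) := by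
      intro k hk
      refine le_max_of_le_right (Real.rpow_le_rpow_of_nonpos (by positivity) ?_ (hγ0 k))
      have h3 := hda k k₀ hk
      have h4 := hk₀ k (Finset.mem_univ _)
      have h5 : ‖a k - a k₀‖ ≤ ‖circ θ - a k‖ + ‖circ θ - a k₀‖ := by
        have : a k - a k₀ = -(circ θ - a k) + (circ θ - a k₀) := by ring
        rw [this]
        exact (norm_add_le _ _).trans (by rw [norm_neg])
      linarith
    rw [← Finset.mul_prod_erase Finset.univ _ (Finset.mem_univ k₀), mul_comm]
    refine mul_le_mul_of_nonneg_right ?_ (by positivity)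
    calc _ ≤ ∏ k ∈ Finset.univ.erase k₀, max 1 ((d / 2) ^ γ k) :=
          Finset.prod_le_prod (fun k _ => by positivity) fun k hk => h2 k (Finset.ne_of_mem_erase hk)
      _ ≤ B := by
          rw [hB, ← Finset.mul_prod_erase Finset.univ _ (Finset.mem_univ k₀)]
          exact le_mul_of_one_le_left (Finset.prod_nonneg fun k _ => by positivity)
            (le_max_left _ _)
  refine h1.trans (Finset.single_le_sum (f := fun k => B * ‖circ θ - a k‖ ^ γ k)
    (fun k _ => ?_) (Finset.mem_univ k₀))
  have : 0 ≤ B := Finset.prod_nonneg fun k _ => by positivity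
  positivity

/-- Data of a Szegő function with algebraic singularities `a` of exponents `β` on the circle. -/
structure SzegoData {ι : Type*} (G : ℂ → ℂ) (r : ℝ) (a : ι → ℂ) (β : ι → ℝ) (d : ℝ) : Prop where
  one_lt : 1 < r
  diff : DifferentiableOn ℂ G (ball 0 r)
  zero_im : (G 0).im = 0
  norm_a : ∀ k, ‖a k‖ = 1
  d_pos : 0 < d
  dist_le : ∀ i j, i ≠ j → d ≤ ‖a i - a j‖
  lt_β : ∀ k, -(1 / 2 : ℝ) < β k

/-- The Szegő function. -/
noncomputable def szego {ι : Type*} [Fintype ι] (G : ℂ → ℂ) (a : ι → ℂ) (β : ι → ℝ) (z : ℂ) : ℂ :=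
  Complex.exp (G z) * ∏ k, (1 - (starRingEnd ℂ) (a k) * z) ^ (β k : ℂ)

lemma norm_one_sub_conj_mul {a : ℂ} (ha : ‖a‖ = 1) (z : ℂ) :
    ‖1 - (starRingEnd ℂ) a * z‖ = ‖z - a‖ := by
  have h : 1 - (starRingEnd ℂ) a * z = -(starRingEnd ℂ) a * (z - a) := by
    have : (starRingEnd ℂ) a * a = 1 := by
      rw [← Complex.normSq_eq_conj_mul_self, Complex.normSq_eq_norm_sq, ha]; simp
    linear_combination -this
  rw [h, norm_mul, norm_neg, RCLike.norm_conj, ha, one_mul]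

lemma one_sub_conj_mul_re_pos {a : ℂ} (ha : ‖a‖ = 1) {z : ℂ} (hz : ‖z‖ ≤ 1) (hza : z ≠ a) :
    0 < (1 - (starRingEnd ℂ) a * z).re := by
  have h1 : ‖1 - (starRingEnd ℂ) a * z‖ ≠ 0 := by
    rw [norm_one_sub_conj_mul ha]
    exact norm_ne_zero_iff.2 (sub_ne_zero.2 hza)
  have h2 : ‖(starRingEnd ℂ) a * z‖ ≤ 1 := by rwa [norm_mul, RCLike.norm_conj, ha, one_mul]
  set u := (starRingEnd ℂ) a * z
  have h3 : Complex.normSq u ≤ 1 := by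
    rw [Complex.normSq_eq_norm_sq]; nlinarith [norm_nonneg u]
  rw [Complex.normSq_apply] at h3
  by_contra! h4
  rw [Complex.sub_re, Complex.one_re] at h4
  have h5 : u.im = 0 := by nlinarith [sq_nonneg u.im]
  have h6 : u.re = 1 := by nlinarith
  apply h1
  rw [show u = 1 from Complex.ext h6 h5]
  simp

lemma half_norm_le {a : ℂ} (ha : ‖a‖ = 1) {R : ℝ} (h0 : 0 < R) (h1 : R < 1) (θ : ℝ) :
    ‖circ θ - a‖ / 2 ≤ ‖R * circ θ - a‖ := by
  have h2 : ‖circ θ - a‖ ≤ ‖circ θ - R * circ θ‖ + ‖R * circ θ - a‖ := by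
    simpa using norm_add_le (circ θ - R * circ θ) (R * circ θ - a)
  have h3 : ‖circ θ - R * circ θ‖ = 1 - R := by
    have : circ θ - R * circ θ = ((1 - R : ℝ) : ℂ) * circ θ := by push_cast; ring
    rw [this, norm_ofReal_mul_circ (by linarith)]
  have h4 := norm_sub_norm_le a (R * circ θ)
  rw [ha, norm_ofReal_mul_circ h0.le, norm_sub_rev] at h4
  linarith

lemma norm_sub_le_two {a : ℂ} (ha : ‖a‖ = 1) {R : ℝ} (h0 : 0 < R) (h1 : R < 1) (θ : ℝ) :
    ‖R * circ θ - a‖ ≤ 2 := by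
  have := norm_sub_le (R * circ θ) a
  rw [ha, norm_ofReal_mul_circ h0.le] at this
  linarith

lemma norm_circ_sub_le_two {a : ℂ} (ha : ‖a‖ = 1) (θ : ℝ) : ‖circ θ - a‖ ≤ 2 := by
  have := norm_sub_le (circ θ) a
  rw [ha, norm_circ] at this
  linarith

lemma rpow_le_of_half_le {x y β : ℝ} (hx : 0 < x) (hxy : x / 2 ≤ y) (hy : y ≤ 2) :
    y ^ β ≤ 2 ^ |β| * x ^ min β 0 := by
  have hy0 : 0 < y := by linarith
  rcases le_or_gt 0 β with h | h
  · rw [min_eq_right h, Real.rpow_zero, mul_one, abs_of_nonneg h]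
    exact Real.rpow_le_rpow hy0.le hy h
  · rw [min_eq_left h.le, abs_of_neg h]
    calc y ^ β ≤ (x / 2) ^ β := Real.rpow_le_rpow_of_nonpos (by positivity) hxy h.le
      _ = _ := by
        rw [Real.div_rpow hx.le zero_le_two, Real.rpow_neg zero_le_two]
        field_simp

lemma rpow_div_le_of_half_le {x y β : ℝ} (hx : 0 < x) (hxy : x / 2 ≤ y) (hy : y ≤ 2) :
    x ^ β / y ^ β ≤ 2 ^ |β| * x ^ min β 0 := by
  have hy0 : 0 < y := by linarith
  rcases le_or_gt 0 β with h | h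
  · rw [min_eq_right h, Real.rpow_zero, mul_one, abs_of_nonneg h, div_le_iff₀ (by positivity),
      ← Real.mul_rpow zero_le_two hy0.le]
    exact Real.rpow_le_rpow hx.le (by linarith) h
  · rw [min_eq_left h.le, abs_of_neg h, div_eq_mul_inv, mul_comm, ← Real.rpow_neg hy0.le]
    refine mul_le_mul_of_nonneg_right ?_ (by positivity)
    exact Real.rpow_le_rpow hy0.le hy (by linarith)

namespace SzegoData

variable {ι : Type*} {G : ℂ → ℂ} {r : ℝ} {a : ι → ℂ} {β : ι → ℝ} {d : ℝ}

lemma continuousOn (hS : SzegoData G r a β d) : ContinuousOn G (closedBall 0 1) :=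
  hS.diff.continuousOn.mono (closedBall_subset_ball hS.one_lt)

lemma continuousAt (hS : SzegoData G r a β d) {z : ℂ} (hz : ‖z‖ ≤ 1) : ContinuousAt G z :=
  hS.diff.continuousOn.continuousAt (isOpen_ball.mem_nhds (by
    rw [mem_ball_zero_iff]; exact hz.trans_lt hS.one_lt))

lemma exists_bound (hS : SzegoData G r a β d) :
    ∃ C : ℝ, 0 < C ∧ ∀ z, ‖z‖ ≤ 1 → ‖Complex.exp (G z)‖ ≤ C ∧ ‖Complex.exp (-G z)‖ ≤ C := by
  obtain ⟨B, hB⟩ := (isCompact_closedBall (0 : ℂ) 1).exists_bound_of_continuousOn hS.continuousOn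
  refine ⟨Real.exp B, Real.exp_pos _, fun z hz => ?_⟩
  have h1 := hB z (by simpa using hz)
  have h2 := (Complex.abs_re_le_norm (G z)).trans h1
  rw [abs_le] at h2
  rw [Complex.norm_exp, Complex.norm_exp, Real.exp_le_exp, Real.exp_le_exp, Complex.neg_re]
  constructor <;> linarith [h2.1, h2.2]

lemma ae_ne [Countable ι] (a : ι → ℂ) : ∀ᵐ θ ∂arc, ∀ k, circ θ ≠ a k :=
  ae_all_iff.2 fun k => ae_circ_ne (a k)

lemma ne_of_norm_lt (hS : SzegoData G r a β d) {z : ℂ} (hz : ‖z‖ < 1) (k : ι) : z ≠ a k := by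
  rintro rfl
  exact hz.ne (hS.norm_a k)

variable [Fintype ι]

lemma norm_szego (hS : SzegoData G r a β d) (z : ℂ) :
    ‖szego G a β z‖ = ‖Complex.exp (G z)‖ * ∏ k, ‖z - a k‖ ^ β k := by
  rw [szego, norm_mul, norm_prod]
  congr 1
  refine Finset.prod_congr rfl fun k _ => ?_
  rw [Complex.norm_cpow_real, norm_one_sub_conj_mul (hS.norm_a k)]

lemma szego_ne_zero (hS : SzegoData G r a β d) {z : ℂ} (hz : ∀ k, z ≠ a k) :
    szego G a β z ≠ 0 := by
  rw [← norm_ne_zero_iff, hS.norm_szego]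
  refine mul_ne_zero (norm_ne_zero_iff.2 (Complex.exp_ne_zero _))
    (Finset.prod_ne_zero_iff.2 fun k _ => ?_)
  have : 0 < ‖z - a k‖ := norm_pos_iff.2 (sub_ne_zero.2 (hz k))
  positivity

lemma continuousAt_szego (hS : SzegoData G r a β d) {z : ℂ} (hz : ‖z‖ ≤ 1) (hza : ∀ k, z ≠ a k) :
    ContinuousAt (szego G a β) z := by
  refine (hS.continuousAt hz).cexp.mul (tendsto_finsetProd _ fun k _ => ?_)
  refine ContinuousAt.cpow (by fun_prop) continuousAt_const ?_
  exact Or.inl (one_sub_conj_mul_re_pos (hS.norm_a k) hz (hza k))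

lemma differentiableOn_szego (hS : SzegoData G r a β d) :
    DifferentiableOn ℂ (szego G a β) (ball 0 1) := by
  refine (hS.diff.mono (ball_subset_ball hS.one_lt.le)).cexp.mul
    (DifferentiableOn.fun_finsetProd fun k _ => ?_)
  refine DifferentiableOn.cpow (by fun_prop) (differentiableOn_const _) fun z hz => ?_
  rw [mem_ball_zero_iff] at hz
  exact Or.inl (one_sub_conj_mul_re_pos (hS.norm_a k) hz.le (hS.ne_of_norm_lt hz k))

lemma szego_zero (hS : SzegoData G r a β d) : szego G a β 0 = (Real.exp (G 0).re : ℝ) := by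
  rw [szego]
  simp only [mul_zero, sub_zero, Complex.one_cpow, Finset.prod_const_one, mul_one]
  rw [Complex.ofReal_exp]
  congr 1
  exact Complex.ext (by simp) (by simp [hS.zero_im])

/-- The envelope of the Szegő function. -/
noncomputable def env (a : ι → ℂ) (β : ι → ℝ) (θ : ℝ) : ℝ :=
  ∏ k, 2 ^ |β k| * ‖circ θ - a k‖ ^ min (β k) 0

lemma env_nonneg (a : ι → ℂ) (β : ι → ℝ) (θ : ℝ) : 0 ≤ env a β θ :=
  Finset.prod_nonneg fun _ _ => by positivity

lemma memLp_env [Nonempty ι] (hS : SzegoData G r a β d) : MemLp (env a β) 2 arc := by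
  rw [memLp_two_iff_integrable_sq]
  · have h1 : (fun θ => env a β θ ^ 2) =
        fun θ => (∏ k, (2 ^ |β k| : ℝ)) ^ 2 * ∏ k, ‖circ θ - a k‖ ^ (2 * min (β k) 0) := by
      ext θ
      rw [env, Finset.prod_mul_distrib, mul_pow]
      congr 1
      rw [← Finset.prod_pow]
      refine Finset.prod_congr rfl fun k _ => ?_
      rw [← Real.rpow_natCast, ← Real.rpow_mul (norm_nonneg _), mul_comm (min _ _)]
      norm_num
    rw [h1]
    refine (integrable_prod_norm_rpow hS.norm_a hS.d_pos hS.dist_le (fun k => ?_)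
      fun k => ?_).const_mul _
    · have := hS.lt_β k
      rcases min_choice (β k) 0 with h | h <;> rw [h] <;> linarith
    · linarith [min_le_right (β k) 0]
  · exact (Finset.measurable_fun_prod _ fun k _ =>
      (measurable_norm_circ_sub_rpow (a k) _).const_mul _).aestronglyMeasurable

lemma norm_szego_le (hS : SzegoData G r a β d) : ∃ C : ℝ, 0 < C ∧
    ∀ θ : ℝ, (∀ k, circ θ ≠ a k) → ‖szego G a β (circ θ)‖ ≤ C * env a β θ ∧
      ∀ R : ℝ, 0 < R → R < 1 → ‖szego G a β (R * circ θ)‖ ≤ C * env a β θ ∧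
        ‖szego G a β (circ θ) / szego G a β (R * circ θ)‖ ≤ C ^ 2 * env a β θ := by
  obtain ⟨C, hC, hCb⟩ := hS.exists_bound
  refine ⟨C, hC, fun θ hθ => ?_⟩
  have hpos : ∀ k, 0 < ‖circ θ - a k‖ := fun k => norm_pos_iff.2 (sub_ne_zero.2 (hθ k))
  refine ⟨?_, fun R h0 h1 => ⟨?_, ?_⟩⟩
  · rw [hS.norm_szego]
    refine mul_le_mul (hCb _ (by simp)).1 ?_ (Finset.prod_nonneg fun _ _ => by positivity) hC.le
    exact Finset.prod_le_prod (fun _ _ => by positivity) fun k _ =>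
      rpow_le_of_half_le (hpos k) (by linarith [hpos k]) (norm_circ_sub_le_two (hS.norm_a k) θ)
  · rw [hS.norm_szego]
    refine mul_le_mul (hCb _ (by rw [norm_ofReal_mul_circ h0.le]; exact h1.le)).1 ?_
      (Finset.prod_nonneg fun _ _ => by positivity) hC.le
    exact Finset.prod_le_prod (fun _ _ => by positivity) fun k _ =>
      rpow_le_of_half_le (hpos k) (half_norm_le (hS.norm_a k) h0 h1 θ)
        (norm_sub_le_two (hS.norm_a k) h0 h1 θ)
  · rw [norm_div, hS.norm_szego, hS.norm_szego, mul_div_mul_comm, ← Finset.prod_div_distrib]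
    have h2 : ‖Complex.exp (G (circ θ))‖ / ‖Complex.exp (G (R * circ θ))‖ ≤ C ^ 2 := by
      have h3 := (hCb (circ θ) (by simp)).1
      have h4 := (hCb (R * circ θ) (by rw [norm_ofReal_mul_circ h0.le]; exact h1.le)).2
      rw [Complex.exp_neg, norm_inv] at h4
      rw [div_eq_mul_inv, sq]
      gcongr
    refine mul_le_mul h2 ?_ (Finset.prod_nonneg fun _ _ => by positivity) (by positivity)
    exact Finset.prod_le_prod (fun _ _ => by positivity) fun k _ =>
      rpow_div_le_of_half_le (hpos k) (half_norm_le (hS.norm_a k) h0 h1 θ)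
        (norm_sub_le_two (hS.norm_a k) h0 h1 θ)

lemma measurable_szego (hS : SzegoData G r a β d) : Measurable fun θ => szego G a β (circ θ) := by
  have h1 : Continuous fun θ => G (circ θ) :=
    continuous_comp_circ (hS.continuousOn.mono sphere_subset_closedBall)
  refine h1.measurable.cexp.mul (Finset.measurable_fun_prod _ fun k _ => ?_)
  have h2 : Continuous fun θ => 1 - (starRingEnd ℂ) (a k) * circ θ :=
    continuous_const.sub (continuous_const.mul continuous_circ)
  exact h2.measurable.pow_const _

/-- The orthogonality measure. -/
noncomputable def meas (G : ℂ → ℂ) (a : ι → ℂ) (β : ι → ℝ) : Measure ℝ :=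
  arc.withDensity fun θ => ENNReal.ofReal (‖szego G a β (circ θ)‖ ^ 2)

variable [Nonempty ι]

lemma memLp_szego (hS : SzegoData G r a β d) : MemLp (fun θ => szego G a β (circ θ)) 2 arc := by
  obtain ⟨C, hC, hCb⟩ := hS.norm_szego_le
  refine (hS.memLp_env).of_le_mul (c := C) hS.measurable_szego.aestronglyMeasurable ?_
  filter_upwards [ae_ne a] with θ hθ
  rw [Real.norm_of_nonneg (env_nonneg a β θ)]
  exact (hCb θ hθ).1

lemma isFiniteMeasure (hS : SzegoData G r a β d) : IsFiniteMeasure (meas G a β) :=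
  isFiniteMeasure_withDensity_ofReal
    ((memLp_two_iff_integrable_sq_norm hS.memLp_szego.1).1 hS.memLp_szego).2

lemma outer (hS : SzegoData G r a β d) :
    Outer (meas G a β) (szego G a β) (Real.exp (G 0).re) := by
  obtain ⟨C, hC, hCb⟩ := hS.norm_szego_le
  refine ⟨Real.exp_pos _, hS.szego_zero, ⟨hS.differentiableOn_szego, ⟨fun θ => C * env a β θ,
    (hS.memLp_env.integrable (by norm_num)).const_mul _, fun R h0 h1 => ?_⟩, ?_⟩, hS.memLp_szego,
    fun z hz => hS.szego_ne_zero fun k => hS.ne_of_norm_lt hz k,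
    ⟨fun θ => C ^ 2 * env a β θ, hS.memLp_env.const_mul _, fun R h0 h1 => ?_⟩, ?_, fun f => ?_⟩
  · filter_upwards [ae_ne a] with θ hθ
    exact ((hCb θ hθ).2 R h0 h1).1
  · filter_upwards [ae_ne a] with θ hθ
    exact (hS.continuousAt_szego (by simp) hθ).tendsto.comp (tendsto_ofReal_mul_circ θ)
  · filter_upwards [ae_ne a] with θ hθ
    exact ((hCb θ hθ).2 R h0 h1).2
  · filter_upwards [ae_ne a] with θ hθ
    exact hS.szego_ne_zero hθ
  · rw [meas, integral_withDensity_eq_integral_toReal_smul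
      (hS.measurable_szego.norm.pow_const 2).ennreal_ofReal
      (ae_of_all _ fun _ => ENNReal.ofReal_lt_top)]
    congr 1
    ext θ
    rw [ENNReal.toReal_ofReal (by positivity), Complex.real_smul]

end SzegoData

lemma tps_congr {F H : ℂ → ℂ} (h : F =ᶠ[nhds 0] H) : tps F = tps H := by
  ext n
  simp only [tps, PowerSeries.coeff_mk, h.iteratedDeriv_eq n]

lemma hasSum_tps_of_radius {F : ℂ → ℂ} {r : ℝ} (hF : DifferentiableOn ℂ F (ball 0 r)) {z : ℂ}
    (hz : ‖z‖ < r) : HasSum (fun n => PowerSeries.coeff n (tps F) * z ^ n) (F z) := by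
  have := Complex.hasSum_taylorSeries_on_ball (c := 0) (r := r) hF (z := z) (by simpa using hz)
  refine this.congr_fun fun n => ?_
  simp only [tps, PowerSeries.coeff_mk, sub_zero, smul_eq_mul]
  ring

namespace SzegoData

variable {ι : Type*} {G : ℂ → ℂ} {r : ℝ} {a : ι → ℂ} {β : ι → ℝ} {d : ℝ}

/-- Taylor coefficients of `z * G' z`. -/
noncomputable def logCoeff (G : ℂ → ℂ) (n : ℕ) : ℂ := n * PowerSeries.coeff n (tps G)

lemma hasSum_logCoeff (hS : SzegoData G r a β d) {z : ℂ} (hz : ‖z‖ < r) :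
    HasSum (fun n => logCoeff G n * z ^ n) (z * deriv G z) := by
  have h1 := hasSum_tps_of_radius (hS.diff.deriv isOpen_ball) hz
  rw [tps_deriv] at h1
  have h2 := (hasSum_nat_add_iff (f := fun n => logCoeff G n * z ^ n) (g := z * deriv G z) 1).1 (by
    refine (h1.mul_left z).congr_fun fun n => ?_
    rw [logCoeff, PowerSeries.coeff_derivative]
    push_cast; ring)
  simpa [logCoeff] using h2

lemma laurentSeries (hS : SzegoData G r a β d) :
    LaurentSeries' (fun z => z * deriv G z - (starRingEnd ℂ) (z * deriv G z)) (logCoeff G) := by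
  refine ⟨by simp [logCoeff], ?_, fun θ => ?_⟩
  · obtain ⟨q, hq1, hqr⟩ := exists_between hS.one_lt
    have hq0 : 0 < q := by linarith
    have h1 := (hS.hasSum_logCoeff (z := (q : ℂ)) (by
      rwa [Complex.norm_real, Real.norm_of_nonneg hq0.le])).summable.tendsto_atTop_zero
    obtain ⟨B, hB⟩ := (Metric.isBounded_range_of_tendsto _ h1).exists_norm_le
    have h2 : ∀ n, ‖logCoeff G n‖ ≤ B * (1 / q) ^ n := by
      intro n
      have := hB _ ⟨n, rfl⟩
      rw [norm_mul, norm_pow, Complex.norm_real, Real.norm_of_nonneg hq0.le] at this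
      rw [one_div, inv_pow, ← div_eq_mul_inv, le_div_iff₀ (by positivity)]
      exact this
    have hq2 : ‖1 / q‖ < 1 := by
      rw [Real.norm_of_nonneg (by positivity), div_lt_one hq0]; exact hq1
    have h3 := ((summable_pow_mul_geometric_of_norm_lt_one 1 hq2).add
      (summable_pow_mul_geometric_of_norm_lt_one 0 hq2)).mul_left B
    refine Summable.of_nonneg_of_le (fun n => by positivity) (fun n => ?_) h3
    have := mul_le_mul_of_nonneg_right (h2 n) (by positivity : (0 : ℝ) ≤ n + 1)
    refine this.trans_eq ?_
    ring
  · have h1 := hS.hasSum_logCoeff (z := circ θ) (by simpa using hS.one_lt)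
    have h2 : HasSum (fun n => (starRingEnd ℂ) (logCoeff G n * circ θ ^ n))
        ((starRingEnd ℂ) (circ θ * deriv G (circ θ))) := Complex.hasSum_conj'.2 h1
    exact h1.sub h2

variable [Fintype ι]

lemma hasDerivAt_szego {z : ℂ} (hG : DifferentiableAt ℂ G z)
    (hz : ∀ k, 1 - (starRingEnd ℂ) (a k) * z ∈ Complex.slitPlane) :
    HasDerivAt (szego G a β) ((deriv G z - ∑ k, β k * (starRingEnd ℂ) (a k) /
      (1 - (starRingEnd ℂ) (a k) * z)) * szego G a β z) z := by
  classical
  have h1 : ∀ k ∈ Finset.univ, HasDerivAt (fun z => (1 - (starRingEnd ℂ) (a k) * z) ^ (β k : ℂ))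
      (β k * (1 - (starRingEnd ℂ) (a k) * z) ^ ((β k : ℂ) - 1) * -(starRingEnd ℂ) (a k)) z := by
    intro k _
    refine HasDerivAt.cpow_const ?_ (hz k)
    simpa using ((hasDerivAt_id z).const_mul ((starRingEnd ℂ) (a k))).const_sub 1
  have h2 := hG.hasDerivAt.cexp.mul (HasDerivAt.fun_finsetProd h1)
  refine h2.congr_deriv ?_
  have h3 : ∀ k, (∏ j ∈ Finset.univ.erase k, (1 - (starRingEnd ℂ) (a j) * z) ^ (β j : ℂ)) •
      (β k * (1 - (starRingEnd ℂ) (a k) * z) ^ ((β k : ℂ) - 1) * -(starRingEnd ℂ) (a k)) =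
      -(β k * (starRingEnd ℂ) (a k) / (1 - (starRingEnd ℂ) (a k) * z)) *
        ∏ j, (1 - (starRingEnd ℂ) (a j) * z) ^ (β j : ℂ) := by
    intro k
    have h4 : 1 - (starRingEnd ℂ) (a k) * z ≠ 0 := Complex.slitPlane_ne_zero (hz k)
    rw [← Finset.mul_prod_erase Finset.univ _ (Finset.mem_univ k), Complex.cpow_sub _ _ h4, Complex.cpow_one,
      smul_eq_mul]
    ring
  simp only [h3]
  rw [← Finset.sum_mul, Finset.sum_neg_distrib, szego]
  ring

lemma X_mul_derivative_tps (hS : SzegoData G r a β d) :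
    PowerSeries.X * PowerSeries.derivative ℂ (tps (szego G a β)) =
      PowerSeries.mk (fun s => if s = 0 then 0 else
        logCoeff G s - ∑ k, β k * (starRingEnd ℂ) (a k) ^ s) * tps (szego G a β) := by
  set L : ℂ → ℂ := fun z => deriv G z - ∑ k, β k * (starRingEnd ℂ) (a k) /
    (1 - (starRingEnd ℂ) (a k) * z) with hL
  have hne : ∀ z, ‖z‖ < 1 → ∀ k, 0 < (1 - (starRingEnd ℂ) (a k) * z).re := fun z hz k =>
    one_sub_conj_mul_re_pos (hS.norm_a k) hz.le (hS.ne_of_norm_lt hz k)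
  have hGd : DifferentiableOn ℂ (deriv G) (ball 0 r) := hS.diff.deriv isOpen_ball
  have hLd : DifferentiableOn ℂ L (ball 0 1) := by
    refine (hGd.mono (ball_subset_ball hS.one_lt.le)).sub
      (DifferentiableOn.fun_sum fun k _ => ?_)
    refine (differentiableOn_const _).div (by fun_prop) fun z hz h0 => ?_
    have := hne z (by simpa using hz) k
    rw [h0] at this
    simp at this
  have h1 : deriv (szego G a β) =ᶠ[nhds 0] fun z => L z * szego G a β z := by
    filter_upwards [ball_mem_nhds (0 : ℂ) one_pos] with z hz
    rw [mem_ball_zero_iff] at hz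
    refine (hasDerivAt_szego (hS.diff.differentiableAt (isOpen_ball.mem_nhds ?_))
      fun k => Or.inl (hne z hz k)).deriv
    rw [mem_ball_zero_iff]
    exact hz.trans hS.one_lt
  have h2 : tps L = PowerSeries.mk fun n => (n + 1) * PowerSeries.coeff (n + 1) (tps G) -
      ∑ k, β k * (starRingEnd ℂ) (a k) ^ (n + 1) := by
    refine tps_eq_of_hasSum zero_lt_one fun z hz => ?_
    rw [mem_ball_zero_iff] at hz
    have h3 := hasSum_tps_of_radius hGd (hz.trans hS.one_lt)
    rw [tps_deriv] at h3
    have h4 : ∀ k ∈ Finset.univ, HasSum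
        (fun n : ℕ => β k * (starRingEnd ℂ) (a k) * ((starRingEnd ℂ) (a k) * z) ^ n)
        (β k * (starRingEnd ℂ) (a k) / (1 - (starRingEnd ℂ) (a k) * z)) := by
      intro k _
      rw [div_eq_mul_inv]
      have h5 : ‖(starRingEnd ℂ) (a k) * z‖ < 1 := by
        rwa [norm_mul, RCLike.norm_conj, hS.norm_a, one_mul]
      exact (hasSum_geometric_of_norm_lt_one h5).mul_left _
    refine (h3.sub (hasSum_sum h4)).congr_fun fun n => ?_
    rw [PowerSeries.coeff_derivative, sub_mul, Finset.sum_mul]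
    congr 1
    · ring
    · refine Finset.sum_congr rfl fun k _ => ?_
      ring
  rw [← tps_deriv, tps_congr h1, tps_mul (hLd.analyticAt (ball_mem_nhds 0 one_pos))
    (hS.differentiableOn_szego.analyticAt (ball_mem_nhds 0 one_pos)), ← mul_assoc, h2]
  congr 1
  ext s
  rcases s with _ | s
  · simp
  · rw [PowerSeries.coeff_succ_X_mul, PowerSeries.coeff_mk, PowerSeries.coeff_mk, logCoeff]
    simp

lemma tendsto_ip [Nonempty ι] (hS : SzegoData G r a β d) {Φ : ℕ → ℂ[X]} {α : ℕ → ℂ}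
    (S : System (meas G a β) (Real.exp (G 0).re) Φ α) (s : ℕ) :
    Tendsto (fun n => ip (meas G a β) (X ^ s * star Φ n) (X * derivative (star Φ n))) atTop
      (nhds ((if s = 0 then 0 else ∑ k, β k * a k ^ s - (starRingEnd ℂ) (logCoeff G s)) *
        (Real.exp (G 0).re : ℂ) ^ 2)) := by
  have := hS.isFiniteMeasure
  have h := hS.outer.tendsto_ip_derivative S hS.X_mul_derivative_tps s
  convert h using 3
  split_ifs
  · simp
  · simp

end SzegoData

lemma hasDerivAt_circ (θ : ℝ) : HasDerivAt circ (circ θ * Complex.I) θ := by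
  have h : HasDerivAt (fun x : ℝ => (x : ℂ) * Complex.I) Complex.I θ := by
    simpa using (Complex.ofRealCLM.hasDerivAt (x := θ)).mul_const Complex.I
  exact h.cexp

lemma hasDerivAt_eval_circ (p : ℂ[X]) (θ : ℝ) :
    HasDerivAt (fun θ => p.eval (circ θ)) (Complex.I * (X * derivative p).eval (circ θ)) θ := by
  have h := (p.hasDerivAt (circ θ)).scomp θ (hasDerivAt_circ θ)
  refine h.congr_deriv ?_
  rw [smul_eq_mul, eval_mul, eval_X]
  ring

lemma hasDerivAt_eval_mul_conj (p q : ℂ[X]) (θ : ℝ) :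
    HasDerivAt (fun θ => p.eval (circ θ) * (starRingEnd ℂ) (q.eval (circ θ)))
      (Complex.I * ((X * derivative p).eval (circ θ) * (starRingEnd ℂ) (q.eval (circ θ)) -
        p.eval (circ θ) * (starRingEnd ℂ) ((X * derivative q).eval (circ θ)))) θ := by
  have h : HasDerivAt (fun θ => (starRingEnd ℂ) (q.eval (circ θ)))
      ((starRingEnd ℂ) (Complex.I * (X * derivative q).eval (circ θ))) θ :=
    (hasDerivAt_eval_circ q θ).star
  refine ((hasDerivAt_eval_circ p θ).mul h).congr_deriv ?_
  rw [map_mul, Complex.conj_I]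
  ring

lemma conj_mul_self_of_norm_one {a : ℂ} (ha : ‖a‖ = 1) : (starRingEnd ℂ) a * a = 1 := by
  rw [← Complex.normSq_eq_conj_mul_self, Complex.normSq_eq_norm_sq, ha]; simp

namespace SzegoData

variable {ι : Type*} {G : ℂ → ℂ} {r : ℝ} {a : ι → ℂ} {β : ι → ℝ} {d : ℝ}

/-- The logarithmic derivative of the analytic part of the weight. -/
noncomputable def logD (G : ℂ → ℂ) (z : ℂ) : ℂ :=
  z * deriv G z - (starRingEnd ℂ) (z * deriv G z)

lemma continuousOn_logD (hS : SzegoData G r a β d) : ContinuousOn (logD G) (sphere 0 1) := by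
  have h1 : ContinuousOn (deriv G) (sphere 0 1) :=
    (hS.diff.deriv isOpen_ball).continuousOn.mono
      (sphere_subset_closedBall.trans (closedBall_subset_ball hS.one_lt))
  have h2 : ContinuousOn (fun z => z * deriv G z) (sphere 0 1) := continuousOn_id.mul h1
  exact h2.sub (Complex.continuous_conj.comp_continuousOn h2)

variable [Fintype ι]

lemma hasDerivAt_weight (hS : SzegoData G r a β d) {θ : ℝ} (hθ : ∀ k, circ θ ≠ a k) :
    HasDerivAt (fun θ => ((‖szego G a β (circ θ)‖ ^ 2 : ℝ) : ℂ))
      (Complex.I * (logD G (circ θ) + ∑ k, β k * ((circ θ + a k) / (circ θ - a k))) *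
        ((‖szego G a β (circ θ)‖ ^ 2 : ℝ) : ℂ)) θ := by
  have h1 := (hasDerivAt_szego (a := a) (β := β) (z := circ θ)
    (hS.diff.differentiableAt (isOpen_ball.mem_nhds (by simpa using hS.one_lt)))
    fun k => Or.inl (one_sub_conj_mul_re_pos (hS.norm_a k) (by simp) (hθ k))).scomp θ
      (hasDerivAt_circ θ)
  have e1 : (fun θ => ((‖szego G a β (circ θ)‖ ^ 2 : ℝ) : ℂ)) =
      fun θ => (szego G a β ∘ circ) θ * (starRingEnd ℂ) ((szego G a β ∘ circ) θ) := by
    ext θ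
    rw [Complex.mul_conj, Complex.normSq_eq_norm_sq]
    rfl
  have e2 := congrFun e1 θ
  rw [e1, e2]
  refine (h1.mul h1.star).congr_deriv ?_
  have key : ∀ k, Complex.I * ((circ θ + a k) / (circ θ - a k)) =
      -(circ θ * Complex.I * ((starRingEnd ℂ) (a k) / (1 - (starRingEnd ℂ) (a k) * circ θ)) +
      (starRingEnd ℂ) (circ θ * Complex.I * ((starRingEnd ℂ) (a k) /
        (1 - (starRingEnd ℂ) (a k) * circ θ)))) := by
    intro k
    have h2 := conj_mul_self_of_norm_one (hS.norm_a k)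
    have h3 := conj_circ_mul θ
    have h4 : circ θ - a k ≠ 0 := sub_ne_zero.2 (hθ k)
    have h5 : a k ≠ 0 := right_ne_zero_of_mul_eq_one h2
    have h6 := circ_ne_zero θ
    have h7 : (starRingEnd ℂ) (a k) = (a k)⁻¹ := eq_inv_of_mul_eq_one_left h2
    simp only [map_mul, map_div₀, map_sub, map_one, Complex.conj_conj, Complex.conj_I]
    rw [h7, conj_circ]
    have h8 : a k - circ θ ≠ 0 := by rw [← neg_sub]; exact neg_ne_zero.2 h4
    have e3 : 1 - (a k)⁻¹ * circ θ = (a k - circ θ) / a k := by field_simp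
    have e4 : 1 - a k * (circ θ)⁻¹ = (circ θ - a k) / circ θ := by field_simp
    rw [e3, e4]
    field_simp
    ring
  have key2 : Complex.I * ∑ k, β k * ((circ θ + a k) / (circ θ - a k)) =
      -(circ θ * Complex.I * (∑ k, β k * (starRingEnd ℂ) (a k) /
        (1 - (starRingEnd ℂ) (a k) * circ θ)) +
      (starRingEnd ℂ) (circ θ * Complex.I * ∑ k, β k * (starRingEnd ℂ) (a k) /
        (1 - (starRingEnd ℂ) (a k) * circ θ))) := by
    rw [Finset.mul_sum, Finset.mul_sum, map_sum, ← Finset.sum_add_distrib,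
      ← Finset.sum_neg_distrib]
    refine Finset.sum_congr rfl fun k _ => ?_
    rw [mul_left_comm, key, mul_div_assoc, mul_left_comm (circ θ * Complex.I) (β k : ℂ),
      map_mul _ (β k : ℂ), Complex.conj_ofReal]
    ring
  rw [mul_add, key2, logD]
  set Z := ∑ k, β k * (starRingEnd ℂ) (a k) / (1 - (starRingEnd ℂ) (a k) * circ θ)
  simp only [smul_eq_mul, ← starRingEnd_apply, map_mul, map_sub, Complex.conj_I, Function.comp_apply]
  ring

lemma continuous_mul_weight (hS : SzegoData G r a β d) {f : ℝ → ℂ} (hf : Continuous f)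
    {F : ι → ℂ → ℂ} (hF : ∀ k, Continuous (F k)) (hfF : ∀ k θ, f θ = (circ θ - a k) * F k (circ θ)) :
    Continuous fun θ => f θ * ((‖szego G a β (circ θ)‖ ^ 2 : ℝ) : ℂ) := by
  classical
  rw [continuous_iff_continuousAt]
  intro θ₀
  by_cases h : ∀ k, circ θ₀ ≠ a k
  · have h1 : ContinuousAt (fun θ => szego G a β (circ θ)) θ₀ :=
      ContinuousAt.comp (f := circ) (hS.continuousAt_szego (by simp) h) continuous_circ.continuousAt
    exact hf.continuousAt.mul (Complex.continuous_ofReal.continuousAt.comp (h1.norm.pow 2))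
  · push Not at h
    obtain ⟨k, hk⟩ := h
    have h0 : f θ₀ * ((‖szego G a β (circ θ₀)‖ ^ 2 : ℝ) : ℂ) = 0 := by
      rw [hfF k, hk, sub_self, zero_mul, zero_mul]
    rw [ContinuousAt, h0, tendsto_zero_iff_norm_tendsto_zero]
    have h1 : ∀ θ, ‖f θ * ((‖szego G a β (circ θ)‖ ^ 2 : ℝ) : ℂ)‖ =
        ‖circ θ - a k‖ ^ (1 + 2 * β k) * (‖F k (circ θ)‖ * (‖Complex.exp (G (circ θ))‖ *
          ∏ j ∈ Finset.univ.erase k, ‖circ θ - a j‖ ^ β j) ^ 2) := by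
      intro θ
      rw [hfF k, norm_mul, norm_mul, Complex.norm_real, Real.norm_of_nonneg (by positivity),
        hS.norm_szego, ← Finset.mul_prod_erase Finset.univ _ (Finset.mem_univ k)]
      rcases eq_or_ne (circ θ) (a k) with h2 | h2
      · have : 1 + 2 * β k ≠ 0 := by have := hS.lt_β k; linarith
        rw [h2, sub_self, norm_zero, Real.zero_rpow this]
        simp
      · have : 0 < ‖circ θ - a k‖ := norm_pos_iff.2 (sub_ne_zero.2 h2)
        rw [Real.rpow_add this, Real.rpow_one, mul_comm 2 (β k), Real.rpow_mul this.le,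
          Real.rpow_two]
        ring
    simp only [h1]
    have h2 : Tendsto (fun θ => ‖circ θ - a k‖ ^ (1 + 2 * β k)) (nhds θ₀) (nhds 0) := by
      have h3 : 0 < 1 + 2 * β k := by have := hS.lt_β k; linarith
      have h4 : Continuous fun θ => ‖circ θ - a k‖ ^ (1 + 2 * β k) :=
        (continuous_circ.sub continuous_const).norm.rpow_const fun _ => Or.inr h3.le
      have h5 := h4.tendsto θ₀
      rwa [hk, sub_self, norm_zero, Real.zero_rpow h3.ne'] at h5
    have h3 : Tendsto (fun θ => ‖F k (circ θ)‖ * (‖Complex.exp (G (circ θ))‖ *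
          ∏ j ∈ Finset.univ.erase k, ‖circ θ - a j‖ ^ β j) ^ 2) (nhds θ₀)
        (nhds (‖F k (circ θ₀)‖ * (‖Complex.exp (G (circ θ₀))‖ *
          ∏ j ∈ Finset.univ.erase k, ‖circ θ₀ - a j‖ ^ β j) ^ 2)) := by
      refine ((((hF k).comp continuous_circ).norm).tendsto θ₀).mul (Tendsto.pow (Tendsto.mul ?_
        (tendsto_finsetProd _ fun j hj => ?_)) 2)
      · have h4 : ContinuousAt (fun θ => G (circ θ)) θ₀ :=
          ContinuousAt.comp (f := circ) (hS.continuousAt (by simp)) continuous_circ.continuousAt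
        exact h4.cexp.norm
      · have h5 : ‖circ θ₀ - a j‖ ≠ 0 := by
          rw [hk]
          have := hS.dist_le k j (Finset.ne_of_mem_erase hj).symm
          have := hS.d_pos
          linarith
        have h6 : Continuous fun θ => ‖circ θ - a j‖ :=
          (continuous_circ.sub continuous_const).norm
        exact h6.continuousAt.rpow_const (Or.inl h5)
    simpa using h2.mul h3

lemma integrable_mul_weight [Nonempty ι] (hS : SzegoData G r a β d) {f : ℝ → ℂ}
    (hf : Continuous f) {C : ℝ} (hC : ∀ θ, ‖f θ‖ ≤ C) :
    Integrable (fun θ => f θ * ((‖szego G a β (circ θ)‖ ^ 2 : ℝ) : ℂ)) arc :=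
  ((memLp_two_iff_integrable_sq_norm hS.memLp_szego.1).1 hS.memLp_szego).ofReal.bdd_mul
    hf.aestronglyMeasurable (ae_of_all _ hC)

end SzegoData

lemma SzegoData.partsFormula {m : ℕ} [Nonempty (Fin m)] {G : ℂ → ℂ} {r : ℝ} {a : Fin m → ℂ}
    {β : Fin m → ℝ} {d : ℝ} (hS : SzegoData G r a β d) :
    PartsFormula (SzegoData.meas G a β) (SzegoData.logD G) a β := by
  have := hS.isFiniteMeasure
  refine ⟨hS.continuousOn_logD, fun p₁ q₁ p₂ q₂ F hF hfF => ?_⟩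
  set f : ℂ → ℂ := fun z => p₁.eval z * (starRingEnd ℂ) (q₁.eval z) -
      p₂.eval z * (starRingEnd ℂ) (q₂.eval z) with hf
  set e : ℂ → ℂ := fun z => (X * derivative p₁).eval z * (starRingEnd ℂ) (q₁.eval z) -
      p₁.eval z * (starRingEnd ℂ) ((X * derivative q₁).eval z) -
      ((X * derivative p₂).eval z * (starRingEnd ℂ) (q₂.eval z) -
      p₂.eval z * (starRingEnd ℂ) ((X * derivative q₂).eval z)) with he
  set V : ℝ → ℂ := fun θ => ((‖szego G a β (circ θ)‖ ^ 2 : ℝ) : ℂ) with hV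
  have hfc : Continuous f := by fun_prop
  have hec : Continuous e := by fun_prop
  set T : ℂ → ℂ := fun z => e z + SzegoData.logD G z * f z + ∑ k, β k * ((z + a k) * F k z) with hT
  have hTc : ContinuousOn T (sphere 0 1) := by
    refine (hec.continuousOn.add (hS.continuousOn_logD.mul hfc.continuousOn)).add ?_
    have : Continuous fun z => ∑ k, β k * ((z + a k) * F k z) := by fun_prop
    exact this.continuousOn
  have hderiv : ∀ θ, (∀ k, circ θ ≠ a k) → HasDerivAt (fun θ => f (circ θ) * V θ)
      (Complex.I * T (circ θ) * V θ) θ := by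
    intro θ hθ
    have h1 := ((hasDerivAt_eval_mul_conj p₁ q₁ θ).sub (hasDerivAt_eval_mul_conj p₂ q₂ θ)).mul
      (hS.hasDerivAt_weight hθ)
    refine h1.congr_deriv ?_
    have h2 : ∑ k, β k * ((circ θ + a k) * F k (circ θ)) =
        f (circ θ) * ∑ k, β k * ((circ θ + a k) / (circ θ - a k)) := by
      rw [Finset.mul_sum]
      refine Finset.sum_congr rfl fun k _ => ?_
      have h3 : circ θ - a k ≠ 0 := sub_ne_zero.2 (hθ k)
      have h4 : f (circ θ) = (circ θ - a k) * F k (circ θ) := hfF k θ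
      rw [h4]
      field_simp
    simp only [hT, h2]
    simp only [he, hf, hV, Pi.sub_apply]
    ring
  have hcount : {θ : ℝ | ∃ k, circ θ = a k}.Countable := by
    have : {θ : ℝ | ∃ k, circ θ = a k} = ⋃ k, {θ | circ θ = a k} := by ext; simp
    rw [this]
    exact countable_iUnion fun k => countable_circ_eq (a k)
  obtain ⟨C, -, hC⟩ := exists_bound_circ hTc
  have hTi : Integrable (fun θ => T (circ θ) * V θ) arc :=
    hS.integrable_mul_weight (continuous_comp_circ hTc) hC
  have hTi2 : Integrable (fun θ => Complex.I * T (circ θ) * V θ) arc := by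
    simpa only [mul_assoc] using hTi.const_mul Complex.I
  have hFTC := MeasureTheory.integral_eq_of_hasDerivAt_off_countable
    (fun θ => f (circ θ) * V θ) (fun θ => Complex.I * T (circ θ) * V θ) (a := 0) (b := 2 * π) hcount
    (hS.continuous_mul_weight (f := fun θ => f (circ θ)) (hfc.comp continuous_circ) hF
      hfF).continuousOn
    (fun θ hθ => hderiv θ fun k hk => hθ.2 ⟨k, hk⟩) (integrable_arc_iff.1 hTi2)
  have hper : circ (2 * π) = circ 0 := by simpa using periodic_circ 0
  have hzero : ∫ θ, T (circ θ) ∂(SzegoData.meas G a β) = 0 := by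
    rw [hS.outer.integral]
    have h1 : ∫ θ, Complex.I * T (circ θ) * V θ ∂arc = 0 := by
      rw [integral_arc, hFTC]
      simp [hV, hper]
    simp only [mul_assoc] at h1
    rw [integral_const_mul] at h1
    have h2 := (mul_eq_zero.1 h1).resolve_left Complex.I_ne_zero
    rw [← h2]
    congr 1
    ext θ
    rw [mul_comm]
  rw [← hzero]
  have hi : ∀ {k : ℂ → ℂ}, ContinuousOn k (sphere 0 1) →
      Integrable (fun θ => k (circ θ)) (SzegoData.meas G a β) := fun hk => integrable_comp_circ hk _
  have hI1 : Integrable (fun θ => e (circ θ)) (SzegoData.meas G a β) := hi hec.continuousOn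
  have hI2 : Integrable (fun θ => SzegoData.logD G (circ θ) * f (circ θ)) (SzegoData.meas G a β) :=
    hi (k := fun z => SzegoData.logD G z * f z) (hS.continuousOn_logD.mul hfc.continuousOn)
  have hI3 : ∀ k ∈ Finset.univ, Integrable (fun θ => β k * ((circ θ + a k) * F k (circ θ)))
      (SzegoData.meas G a β) := fun k _ => hi (k := fun z => β k * ((z + a k) * F k z))
        (Continuous.continuousOn (by have := hF k; fun_prop))
  have hI12 : Integrable (fun θ => e (circ θ) + SzegoData.logD G (circ θ) * f (circ θ))
    (SzegoData.meas G a β) := hI1.add hI2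
  simp only [hT]
  rw [integral_add hI12 (integrable_finsetSum _ hI3), integral_add hI1 hI2,
    integral_finsetSum _ hI3]
  simp only [integral_const_mul]
  congr 2
  simp only [ip, he]
  have hp : ∀ p q : ℂ[X], Integrable (fun θ => p.eval (circ θ) *
      (starRingEnd ℂ) (q.eval (circ θ))) (SzegoData.meas G a β) := fun p q =>
    hi (k := fun z => p.eval z * (starRingEnd ℂ) (q.eval z)) (by fun_prop)
  have hp2 : ∀ p q : ℂ[X], Integrable (fun θ => (X * derivative p).eval (circ θ) *
      (starRingEnd ℂ) (q.eval (circ θ)) - p.eval (circ θ) *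
      (starRingEnd ℂ) ((X * derivative q).eval (circ θ))) (SzegoData.meas G a β) := fun p q =>
    (hp _ _).sub (hp _ _)
  rw [integral_sub (hp2 _ _) (hp2 _ _), integral_sub (hp _ _) (hp _ _),
    integral_sub (hp _ _) (hp _ _)]

lemma circleAverage_annulus {f : ℂ → ℂ} {R : ℝ} (hR : 1 ≤ R)
    (hf : ∀ z : ℂ, 1 ≤ ‖z‖ → ‖z‖ ≤ R → DifferentiableAt ℂ f z) :
    Real.circleAverage f 0 1 = Real.circleAverage f 0 R := by
  rw [Real.circleAverage_eq_circleIntegral one_ne_zero,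
    Real.circleAverage_eq_circleIntegral (by positivity),
    Complex.circleIntegral_sub_center_inv_smul_eq_of_differentiable_on_annulus_off_countable
      zero_lt_one hR countable_empty]
  · intro z hz
    simp only [Set.mem_sdiff, mem_closedBall_zero_iff, mem_ball_zero_iff, not_lt] at hz
    exact (hf z hz.2 hz.1).continuousAt.continuousWithinAt
  · intro z hz
    simp only [Set.mem_sdiff, mem_closedBall_zero_iff, mem_ball_zero_iff, not_le, mem_empty_iff_false,
      not_false_iff, and_true] at hz
    exact hf z hz.2.le hz.1.le

/-- Fourier series of a function on the circle with absolutely summable coefficients. -/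
lemma hasSum_fourier_circ {L : ℂ → ℂ} (hL : Continuous fun θ => L (circ θ)) {c : ℤ → ℂ}
    (hc : ∀ n, c n = ∫ θ, circ θ ^ (-n) * L (circ θ) ∂arc) (hs : Summable c) (θ : ℝ) :
    HasSum (fun n => c n * circ θ ^ n) (L (circ θ)) := by
  have hT : Fact (0 < 2 * π) := ⟨by positivity⟩
  have hper : Function.Periodic (fun θ => L (circ θ)) (2 * π) := fun θ => by
    simp only [periodic_circ θ]
  have hfour : ∀ (n : ℤ) (x : ℝ), fourier n (x : AddCircle (2 * π)) = circ x ^ n := by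
    intro n x
    rw [fourier_coe_apply, circ, ← Complex.exp_int_mul]
    congr 1
    push_cast
    field_simp
  set f : C(AddCircle (2 * π), ℂ) := ⟨hper.lift, by
    exact continuous_coinduced_dom.2 hL⟩ with hf
  have hfc : ∀ x : ℝ, f (x : AddCircle (2 * π)) = L (circ x) := fun x => hper.lift_coe x
  have hcoef : ∀ n, fourierCoeff f n = c n := by
    intro n
    rw [fourierCoeff_eq_intervalIntegral _ _ 0, hc, integral_arc, zero_add, one_div]
    simp only [hfour, hfc, smul_eq_mul]
  have h := has_pointwise_sum_fourier_series_of_summable (f := f)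
    (by rwa [show fourierCoeff f = c from funext hcoef]) (θ : AddCircle (2 * π))
  simpa only [hcoef, hfour, hfc, smul_eq_mul] using h

/-- A function holomorphic near the unit circle and real there is twice the real part of a
function holomorphic in a larger disc. -/
lemma exists_two_re_eq {U : Set ℂ} (hU : IsOpen U) (hs : sphere (0 : ℂ) 1 ⊆ U) {L : ℂ → ℂ}
    (hL : DifferentiableOn ℂ L U) (hreal : ∀ z, ‖z‖ = 1 → (L z).im = 0) :
    ∃ (G : ℂ → ℂ) (r : ℝ), 1 < r ∧ DifferentiableOn ℂ G (ball 0 r) ∧ (G 0).im = 0 ∧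
      ∀ z, ‖z‖ = 1 → 2 * (G z).re = (L z).re := by
  obtain ⟨ε, hε, hεU⟩ := (isCompact_sphere (0 : ℂ) 1).exists_thickening_subset_open hU hs
  set R := 1 + ε / 2 with hR
  have hR1 : 1 < R := by linarith
  have hmem : ∀ z : ℂ, 1 ≤ ‖z‖ → ‖z‖ ≤ R → z ∈ U := by
    intro z h1 h2
    have h0 : (‖z‖ : ℂ) ≠ 0 := by exact_mod_cast (by linarith : ‖z‖ ≠ 0)
    refine hεU (mem_thickening_iff.2 ⟨(‖z‖ : ℂ)⁻¹ * z, ?_, ?_⟩)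
    · rw [mem_sphere_zero_iff_norm, norm_mul, norm_inv, Complex.norm_real, norm_norm,
        inv_mul_cancel₀ (by linarith)]
    · have h3 : z - (‖z‖ : ℂ)⁻¹ * z = ((‖z‖ - 1 : ℝ) : ℂ) * ((‖z‖ : ℂ)⁻¹ * z) := by
        push_cast
        field_simp
      rw [dist_eq_norm, h3, norm_mul, Complex.norm_real, Real.norm_of_nonneg (by linarith),
        norm_mul, norm_inv, Complex.norm_real, norm_norm, inv_mul_cancel₀ (by linarith)]
      linarith
  have hd : ∀ z : ℂ, 1 ≤ ‖z‖ → ‖z‖ ≤ R → DifferentiableAt ℂ L z := fun z h1 h2 =>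
    hL.differentiableAt (hU.mem_nhds (hmem z h1 h2))
  have hLc : Continuous fun θ => L (circ θ) := continuous_comp_circ (hL.continuousOn.mono hs)
  set c : ℤ → ℂ := fun n => ∫ θ, circ θ ^ (-n) * L (circ θ) ∂arc with hc
  have hconj : ∀ n, c (-n) = (starRingEnd ℂ) (c n) := by
    intro n
    rw [hc]
    simp only
    rw [← integral_conj]
    refine integral_congr_ae (ae_of_all _ fun θ => ?_)
    simp only [map_mul, map_zpow₀, conj_circ, neg_neg]
    rw [Complex.conj_eq_iff_im.2 (hreal _ (norm_circ θ)), zpow_neg, inv_zpow, inv_inv]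
  obtain ⟨C, hC⟩ := (isCompact_sphere (0 : ℂ) R).exists_bound_of_continuousOn
    (f := L) fun z hz => (hd z (by rw [mem_sphere_zero_iff_norm.1 hz]; exact hR1.le)
      (mem_sphere_zero_iff_norm.1 hz).le).continuousAt.continuousWithinAt
  have hbound : ∀ n : ℕ, ‖c n‖ ≤ C * (R⁻¹) ^ n := by
    intro n
    have h1 : c n = Real.circleAverage (fun z => z ^ (-(n : ℤ)) * L z) 0 1 := by
      rw [circleAverage_eq]; simp [hc]
    rw [h1, circleAverage_annulus hR1.le, circleAverage_eq]
    · refine (norm_integral_le_of_norm_le_const (C := C * (R⁻¹) ^ n) (ae_of_all _ fun θ => ?_)).trans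
        (by simp)
      rw [norm_mul, zpow_neg, zpow_natCast, norm_inv, norm_pow,
        norm_ofReal_mul_circ (by linarith), inv_pow, mul_comm]
      gcongr
      exact hC _ (by rw [mem_sphere_zero_iff_norm, norm_ofReal_mul_circ (by linarith)])
    · intro z h1 h2
      have h0 : z ≠ 0 := norm_pos_iff.1 (by linarith)
      exact (differentiableAt_zpow.2 (Or.inl h0)).mul (hd z h1 h2)
  have hq : R⁻¹ < 1 := inv_lt_one_of_one_lt₀ hR1
  have hgeo : Summable fun n : ℕ => C * (R⁻¹) ^ n :=
    (summable_geometric_of_lt_one (by positivity) hq).mul_left C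
  have hsum : Summable c := by
    refine Summable.of_nat_of_neg (Summable.of_norm_bounded hgeo hbound)
      (Summable.of_norm_bounded hgeo fun n => ?_)
    rw [hconj, RCLike.norm_conj]
    exact hbound n
  obtain ⟨r, hr1, hrR⟩ := exists_between hR1
  have hdiff : DifferentiableOn ℂ (fun z => ∑' n : ℕ, c n * z ^ n) (ball 0 r) := by
    refine Complex.differentiableOn_tsum_of_summable_norm (u := fun n => C * (R⁻¹ * r) ^ n)
      ((summable_geometric_of_lt_one (by positivity) ?_).mul_left C) (fun n => by fun_prop)
      isOpen_ball fun n z hz => ?_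
    · rw [inv_mul_lt_iff₀ (by linarith)]; linarith
    · rw [norm_mul, norm_pow, mul_pow, ← mul_assoc]
      have h2 : ‖z‖ ≤ r := (mem_ball_zero_iff.1 hz).le
      exact mul_le_mul (hbound n) (pow_le_pow_left₀ (norm_nonneg _) h2 n) (by positivity)
        ((norm_nonneg _).trans (hbound n))
  have hc0 : (c 0).im = 0 := by
    have := hconj 0
    rw [neg_zero] at this
    exact Complex.conj_eq_iff_im.1 this.symm
  refine ⟨fun z => ∑' n : ℕ, c n * z ^ n - c 0 / 2, r, hr1, hdiff.sub_const _, ?_, ?_⟩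
  · simp only
    rw [tsum_eq_single 0 fun n hn => by simp [hn]]
    rw [Complex.sub_im]
    simp [hc0]
  · intro z hz
    obtain ⟨θ, rfl⟩ := exists_circ_eq hz
    have h1 : HasSum (fun n : ℕ => c n * circ θ ^ n) (∑' n : ℕ, c n * circ θ ^ n) := by
      refine (Summable.of_norm_bounded hgeo fun n => ?_).hasSum
      simpa using hbound n
    have h2 := (hasSum_fourier_circ hLc (c := c) (fun n => rfl) hsum θ).nat_add_neg
    have h3 := h1.add (h1.mapL (Complex.conjCLE : ℂ →L[ℝ] ℂ))
    have h4 := h2.unique (h3.congr_fun fun n => by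
      simp [hconj, conj_circ])
    have h5 := congrArg Complex.re h4
    simp at h5
    rw [Complex.sub_re]
    have h6 : (c 0 / 2).re = (c 0).re / 2 := by simp
    rw [h6]
    linarith

/-- The exterior factorisation of a positive analytic weight. -/
lemma exists_exp_two_re_eq {ρ : ℝ} (hρ0 : 0 < ρ) (hρ1 : ρ < 1) {w : ℂ → ℂ}
    (hw_an : AnalyticOn ℂ w {z : ℂ | ρ < ‖z‖ ∧ ‖z‖ < 1 / ρ})
    (hw_pos : ∀ z : ℂ, ‖z‖ = 1 → 0 < (w z).re ∧ (w z).im = 0) :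
    ∃ (G : ℂ → ℂ) (r : ℝ), 1 < r ∧ DifferentiableOn ℂ G (ball 0 r) ∧ (G 0).im = 0 ∧
      ∀ z, ‖z‖ = 1 → Real.exp (2 * (G z).re) = (w z).re := by
  have hA : IsOpen {z : ℂ | ρ < ‖z‖ ∧ ‖z‖ < 1 / ρ} :=
    (isOpen_lt continuous_const continuous_norm).inter (isOpen_lt continuous_norm continuous_const)
  have hU := hw_an.continuousOn.isOpen_inter_preimage hA Complex.isOpen_slitPlane
  have hreal : ∀ z : ℂ, ‖z‖ = 1 → w z = ((w z).re : ℂ) := fun z hz =>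
    Complex.ext rfl (by simp [(hw_pos z hz).2])
  obtain ⟨G, r, hr, hG, hG0, h⟩ := exists_two_re_eq hU (L := fun z => Complex.log (w z)) (by
    intro z hz
    have hz1 := mem_sphere_zero_iff_norm.1 hz
    refine ⟨⟨by rw [hz1]; exact hρ1, by rw [hz1, lt_div_iff₀ hρ0]; linarith⟩, ?_⟩
    exact Or.inl (hw_pos z hz1).1)
    (fun z hz => ((hw_an.differentiableOn.differentiableAt (hA.mem_nhds hz.1)).clog
      hz.2).differentiableWithinAt)
    (fun z hz => by
      rw [hreal z hz, ← Complex.ofReal_log (hw_pos z hz).1.le, Complex.ofReal_im])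
  refine ⟨G, r, hr, hG, hG0, fun z hz => ?_⟩
  rw [h z hz, Complex.log_re, hreal z hz, Complex.norm_real, Complex.ofReal_re,
    Real.norm_of_nonneg (hw_pos z hz).1.le, Real.exp_log (hw_pos z hz).1]

/-- The squared phase of a complex number. -/
noncomputable def sqPhase (x : ℂ) : ℂ := x / (starRingEnd ℂ) x

lemma sqPhase_mul (x y : ℂ) : sqPhase (x * y) = sqPhase x * sqPhase y := by
  simp only [sqPhase, map_mul]
  exact mul_div_mul_comm _ _ _ _

lemma sqPhase_ofReal {x : ℝ} (hx : x ≠ 0) : sqPhase x = 1 := by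
  rw [sqPhase, Complex.conj_ofReal, div_self (by exact_mod_cast hx)]

lemma norm_sqPhase_sub_one {x : ℂ} (hx : x ≠ 0) : ‖sqPhase x - 1‖ = 2 * |x.im| / ‖x‖ := by
  have h : (starRingEnd ℂ) x ≠ 0 := by simpa using hx
  rw [sqPhase, div_sub_one h, norm_div, RCLike.norm_conj, Complex.sub_conj, norm_mul,
    Complex.norm_I, mul_one, Complex.norm_real, Real.norm_eq_abs, abs_mul, abs_two]

lemma continuousAt_sqPhase {x : ℂ} (hx : x ≠ 0) : ContinuousAt sqPhase x :=
  continuousAt_id.div Complex.continuous_conj.continuousAt (by simpa using hx)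

lemma norm_sqPhase_sub_one_le {x : ℂ} {t : ℝ} (ht : 0 < t) (hx : ‖x - t‖ ≤ t / 2) :
    ‖sqPhase x - 1‖ ≤ 4 * (‖x - t‖ / t) := by
  have h1 : t / 2 ≤ ‖x‖ := by
    have := norm_sub_norm_le (t : ℂ) x
    rw [norm_sub_rev, Complex.norm_real, Real.norm_of_nonneg ht.le] at this
    linarith
  have h0 : x ≠ 0 := norm_pos_iff.1 (by linarith)
  have h2 : |x.im| ≤ ‖x - t‖ := by simpa using Complex.abs_im_le_norm (x - t)
  rw [norm_sqPhase_sub_one h0, div_le_iff₀ (by linarith)]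
  calc 2 * |x.im| ≤ 4 * (‖x - t‖ / t) * (t / 2) := by
        rw [show 4 * (‖x - t‖ / t) * (t / 2) = 2 * ‖x - t‖ by field_simp; ring]
        linarith
    _ ≤ _ := by gcongr

/-- The Szegő function without the singular factor at `a k`. -/
noncomputable def szegoErase {ι : Type*} [Fintype ι] [DecidableEq ι] (G : ℂ → ℂ) (a : ι → ℂ)
    (β : ι → ℝ) (k : ι) (z : ℂ) : ℂ :=
  Complex.exp (G z) * ∏ j ∈ Finset.univ.erase k, (1 - (starRingEnd ℂ) (a j) * z) ^ (β j : ℂ)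

namespace SzegoData

variable {ι : Type*} {G : ℂ → ℂ} {r : ℝ} {a : ι → ℂ} {β : ι → ℝ} {d : ℝ} [Fintype ι] [DecidableEq ι]

lemma szego_eq_mul (G : ℂ → ℂ) (a : ι → ℂ) (β : ι → ℝ) (k : ι) (z : ℂ) :
    szego G a β z = (1 - (starRingEnd ℂ) (a k) * z) ^ (β k : ℂ) * szegoErase G a β k z := by
  rw [szego, szegoErase, ← Finset.mul_prod_erase _ _ (Finset.mem_univ k)]
  ring

omit [Fintype ι] [DecidableEq ι] in
lemma injective (hS : SzegoData G r a β d) : Function.Injective a := by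
  intro i j hij
  by_contra h
  have := hS.dist_le i j h
  rw [hij, sub_self, norm_zero] at this
  linarith [hS.d_pos]

lemma continuousAt_szegoErase (hS : SzegoData G r a β d) (k : ι) :
    ContinuousAt (szegoErase G a β k) (a k) := by
  refine (hS.continuousAt (hS.norm_a k).le).cexp.mul (tendsto_finsetProd _ fun j hj => ?_)
  refine ContinuousAt.cpow (by fun_prop) continuousAt_const ?_
  exact Or.inl (one_sub_conj_mul_re_pos (hS.norm_a j) (hS.norm_a k).le
    fun h => (Finset.mem_erase.1 hj).1 (hS.injective h).symm)

lemma szegoErase_ne_zero (hS : SzegoData G r a β d) (k : ι) : szegoErase G a β k (a k) ≠ 0 := by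
  refine mul_ne_zero (Complex.exp_ne_zero _) (Finset.prod_ne_zero_iff.2 fun j hj h => ?_)
  rw [Complex.cpow_eq_zero_iff] at h
  have := one_sub_conj_mul_re_pos (hS.norm_a j) (hS.norm_a k).le
    fun h => (Finset.mem_erase.1 hj).1 (hS.injective h).symm
  rw [h.1] at this
  simp at this

lemma szego_radial (hS : SzegoData G r a β d) (k : ι) {t : ℝ} (ht : 0 < t) :
    szego G a β (((1 - t : ℝ) : ℂ) * a k) =
      ((t ^ β k : ℝ) : ℂ) * szegoErase G a β k (((1 - t : ℝ) : ℂ) * a k) := by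
  rw [szego_eq_mul G a β k]
  congr 1
  have h : (starRingEnd ℂ) (a k) * a k = 1 := conj_mul_self_of_norm_one (hS.norm_a k)
  have h2 : 1 - (starRingEnd ℂ) (a k) * (((1 - t : ℝ) : ℂ) * a k) = (t : ℂ) := by
    push_cast
    linear_combination (-1 + (t : ℂ)) * h
  rw [h2, Complex.ofReal_cpow ht.le]

/-- The phase of the reversed orthogonal polynomials at a singular point is opposite to that of the
regularised Szegő function. -/
lemma sqPhase_mul_eq_one [Nonempty ι] (hS : SzegoData G r a β d) {Φ : ℕ → ℂ[X]} {α : ℕ → ℂ}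
    (S : System (meas G a β) (Real.exp (G 0).re) Φ α) (k : ι) {C M' : ℝ} (hC0 : 0 ≤ C)
    (hC : ∀ n : ℕ, nsq (meas G a β) (Φ n) - Real.exp (G 0).re ^ 2 ≤ C / (n + 1)) {U : ℂ}
    (hU : Tendsto (fun n => sqPhase ((star Φ n).eval (a k))) atTop (nhds (sqPhase U)))
    (hM' : ∀ n : ℕ, ‖(star Φ n).eval (a k)‖ ≤ M' * ((n : ℝ) + 1) ^ (β k))
    (hP : ∀ K : ℝ, 0 < K → Tendsto (fun n : ℕ => ((star Φ n).eval (((1 - K / n : ℝ) : ℂ) * a k) /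
      (star Φ n).eval (a k)).im) atTop (nhds 0)) :
    sqPhase U * sqPhase (szegoErase G a β k (a k)) = 1 := by
  have := hS.isFiniteMeasure
  set D₀ := Real.exp (G 0).re with hD₀
  have hD : 0 < D₀ := Real.exp_pos _
  set H := szegoErase G a β k with hH
  set u := fun n => (star Φ n).eval (a k) with hu
  have hu0 : ∀ n, u n ≠ 0 := fun n => S.eval_star_ne_zero n (hS.norm_a k)
  have key : ∀ K : ℝ, 0 < K → C / (K * D₀ ^ 2) ≤ 1 / 4 →
      ‖sqPhase U * sqPhase (H (a k)) - 1‖ ≤ 4 * √(C / (K * D₀ ^ 2)) := by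
    intro K hK hKC
    set x := fun n : ℕ => (star Φ n).eval (((1 - K / n : ℝ) : ℂ) * a k) with hx
    set y := fun n : ℕ => ((1 - K / n : ℝ) : ℂ) * a k with hy
    set P := fun n => x n / u n with hPd
    have hty : Tendsto y atTop (nhds (a k)) := by
      have h1 : Tendsto (fun n : ℕ => ((1 - K / n : ℝ) : ℂ)) atTop (nhds ((1 - 0 : ℝ) : ℂ)) :=
        (Complex.continuous_ofReal.tendsto _).comp
          ((tendsto_const_div_atTop_nhds_zero_nat K).const_sub 1)
      simpa [hy] using h1.mul_const (a k)
    have htH : Tendsto (fun n => H (y n)) atTop (nhds (H (a k))) :=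
      (hS.continuousAt_szegoErase k).tendsto.comp hty
    have hlarge : ∀ᶠ n : ℕ in atTop, K < n := by
      obtain ⟨N, hN⟩ := exists_nat_gt K
      filter_upwards [eventually_ge_atTop N] with n hn
      exact hN.trans_le (by exact_mod_cast hn)
    have hz : ∀ᶠ n : ℕ in atTop, ‖x n * szego G a β (y n) - D₀‖ / D₀ ≤ √(C / (K * D₀ ^ 2)) := by
      filter_upwards [hlarge] with n hn
      have hn0 : (0 : ℝ) < n := hK.trans hn
      have hKn : K / n < 1 := (div_lt_one hn0).2 hn
      have hKn0 : 0 < K / n := by positivity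
      have hyn : ‖y n‖ = 1 - K / n := by
        rw [hy, norm_mul, hS.norm_a k, mul_one, Complex.norm_real, Real.norm_of_nonneg (by linarith)]
      have h1 := hS.outer.norm_eval_sub_le S n (y := y n) (by rw [hyn]; linarith)
      refine Real.le_sqrt_of_sq_le ?_
      rw [div_pow, ← div_div, div_le_div_iff_of_pos_right (by positivity)]
      refine h1.trans ?_
      rw [hyn]
      have h2 : K / n ≤ 1 - (1 - K / n) ^ 2 := by nlinarith
      calc (1 - (1 - K / n) ^ 2)⁻¹ * (nsq (meas G a β) (Φ n) - D₀ ^ 2)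
          ≤ (1 - (1 - K / n) ^ 2)⁻¹ * (C / (n + 1)) := by
            refine mul_le_mul_of_nonneg_left (hC n) (inv_nonneg.2 (hKn0.le.trans h2))
        _ ≤ (K / n)⁻¹ * (C / n) := by gcongr; linarith
        _ = C / K := by field_simp
    have he : √(C / (K * D₀ ^ 2)) ≤ 1 / 2 := by
      rw [show (1 / 2 : ℝ) = √(1 / 4) by
        rw [show (1 / 4 : ℝ) = (1 / 2) ^ 2 by norm_num, Real.sqrt_sq (by norm_num)]]
      exact Real.sqrt_le_sqrt hKC
    have hxb : ∀ᶠ n : ℕ in atTop, D₀ / 2 ≤ ‖x n * szego G a β (y n)‖ := by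
      filter_upwards [hz] with n hn
      have h1 : ‖x n * szego G a β (y n) - D₀‖ ≤ D₀ / 2 := by
        have := hn.trans he
        rw [div_le_iff₀ hD] at this
        linarith
      have h2 := norm_sub_norm_le (D₀ : ℂ) (x n * szego G a β (y n))
      rw [norm_sub_rev, Complex.norm_real, Real.norm_of_nonneg hD.le] at h2
      linarith
    have hfac : ∀ᶠ n : ℕ in atTop, szego G a β (y n) = (((K / n) ^ β k : ℝ) : ℂ) * H (y n) := by
      filter_upwards [hlarge] with n hn
      exact hS.szego_radial k (div_pos hK (hK.trans hn))
    have hPlow : ∃ c : ℝ, 0 < c ∧ ∀ᶠ n : ℕ in atTop, c ≤ ‖P n‖ := by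
      have hM0 : 0 < M' := by
        have h1 := hM' 0
        have h2 := norm_pos_iff.2 (hu0 0)
        simp only [Nat.cast_zero, zero_add, Real.one_rpow, mul_one] at h1
        exact h2.trans_le h1
      set B := ‖H (a k)‖ + 1 with hB
      have hB0 : 0 < B := by positivity
      have hHB : ∀ᶠ n in atTop, ‖H (y n)‖ ≤ B :=
        htH.norm.eventually_le_const (by linarith)
      refine ⟨D₀ / 2 / (K ^ β k * B * (M' * 2 ^ |β k|)), by positivity, ?_⟩
      filter_upwards [hxb, hfac, hHB, hlarge, eventually_ge_atTop 1] with n h1 h2 h3 h4 h5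
      have hn0 : (0 : ℝ) < n := hK.trans h4
      have hn1 : (1 : ℝ) ≤ n := by exact_mod_cast h5
      rw [norm_div, div_le_div_iff₀ (by positivity) (norm_pos_iff.2 (hu0 n))]
      have h6 : ‖u n‖ ≤ M' * 2 ^ |β k| * (n : ℝ) ^ β k := by
        refine (hM' n).trans ?_
        rw [mul_assoc]
        gcongr
        rw [← div_le_iff₀ (by positivity), ← Real.div_rpow (by positivity) hn0.le]
        have h7 : (1 : ℝ) ≤ (n + 1) / n := by rw [le_div_iff₀ hn0]; linarith
        have h8 : ((n : ℝ) + 1) / n ≤ 2 := by rw [div_le_iff₀ hn0]; linarith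
        exact (Real.rpow_le_rpow_of_exponent_le h7 (le_abs_self _)).trans
          (Real.rpow_le_rpow (by positivity) h8 (abs_nonneg _))
      rw [h2, norm_mul, norm_mul, Complex.norm_real, Real.norm_of_nonneg (by positivity),
        Real.div_rpow hK.le hn0.le] at h1
      have hnb : 0 < (n : ℝ) ^ β k := by positivity
      calc D₀ / 2 * ‖u n‖ ≤ (‖x n‖ * (K ^ β k / (n : ℝ) ^ β k * ‖H (y n)‖)) *
            (M' * 2 ^ |β k| * (n : ℝ) ^ β k) := by gcongr
        _ ≤ (‖x n‖ * (K ^ β k / (n : ℝ) ^ β k * B)) * (M' * 2 ^ |β k| * (n : ℝ) ^ β k) := by gcongr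
        _ = ‖x n‖ * (K ^ β k * B * (M' * 2 ^ |β k|)) := by field_simp
    obtain ⟨c, hc, hcP⟩ := hPlow
    have hPlim : Tendsto (fun n => sqPhase (P n)) atTop (nhds 1) := by
      rw [tendsto_iff_norm_sub_tendsto_zero]
      have h1 : Tendsto (fun n => 2 * |(P n).im| / c) atTop (nhds 0) := by
        have := (((hP K hK).abs).const_mul 2).div_const c
        rwa [abs_zero, mul_zero, zero_div] at this
      refine squeeze_zero' (Eventually.of_forall fun n => norm_nonneg _) ?_ h1
      filter_upwards [hcP] with n hn
      rw [norm_sqPhase_sub_one (norm_pos_iff.1 (hc.trans_le hn))]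
      gcongr
    have hlim : Tendsto (fun n => sqPhase (x n * szego G a β (y n))) atTop
        (nhds (sqPhase U * sqPhase (H (a k)))) := by
      have h1 := (hPlim.mul hU).mul
        ((continuousAt_sqPhase (hS.szegoErase_ne_zero k)).tendsto.comp htH)
      rw [one_mul] at h1
      refine h1.congr' ?_
      filter_upwards [hfac, hlarge] with n h2 h3
      have h4 : x n = P n * u n := (div_mul_cancel₀ _ (hu0 n)).symm
      have h5 : 0 < (K / n) ^ β k := Real.rpow_pos_of_pos (div_pos hK (hK.trans h3)) _
      rw [h2, h4, sqPhase_mul, sqPhase_mul, sqPhase_mul, sqPhase_ofReal h5.ne', one_mul]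
      rfl
    refine le_of_tendsto (hlim.sub_const 1).norm ?_
    filter_upwards [hz] with n hn
    refine (norm_sqPhase_sub_one_le hD ?_).trans (by gcongr)
    have := hn.trans he
    rw [div_le_iff₀ hD] at this
    linarith
  have hlim0 : Tendsto (fun K : ℝ => C / (K * D₀ ^ 2)) atTop (nhds 0) :=
    tendsto_const_nhds.div_atTop (tendsto_id.atTop_mul_const (by positivity))
  have hlim1 : Tendsto (fun K : ℝ => 4 * √(C / (K * D₀ ^ 2))) atTop (nhds 0) := by
    simpa using hlim0.sqrt.const_mul 4
  have hle := ge_of_tendsto hlim1 (b := ‖sqPhase U * sqPhase (H (a k)) - 1‖) (by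
    filter_upwards [eventually_gt_atTop 0, hlim0.eventually_le_const (by norm_num : (0 : ℝ) < 1 / 4)]
      with K h1 h2 using key K h1 h2)
  exact sub_eq_zero.1 (norm_le_zero_iff.1 hle)

end SzegoData

namespace SzegoData

variable {m : ℕ} {G : ℂ → ℂ} {r : ℝ} {a : Fin m → ℂ} {β : Fin m → ℝ} {d : ℝ}

/-- The asymptotics of the Verblunsky coefficients. -/
lemma exists_norm_alpha_add_le [Nonempty (Fin m)] (hS : SzegoData G r a β d) {Φ : ℕ → ℂ[X]}
    {α : ℕ → ℂ} (S : System (meas G a β) (Real.exp (G 0).re) Φ α) :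
    ∃ C : ℝ, 0 < C ∧ ∃ N : ℕ, ∀ n : ℕ, N ≤ n →
      ‖α n + (n : ℂ)⁻¹ * ∑ k, (β k : ℂ) / sqPhase (szegoErase G a β k (a k)) * (a k ^ (n + 1))⁻¹‖ ≤
        C / (n : ℝ) ^ 2 := by
  have := hS.isFiniteMeasure
  have hh := hS.outer.tendsto_nsq S
  obtain ⟨A, hA0, hA⟩ := S.exists_norm_alpha_le hS.partsFormula hS.norm_a hS.injective
  obtain ⟨K, hK0, N, hK⟩ := S.exists_norm_alpha_add_phase_le hS.partsFormula hS.laurentSeries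
    hS.norm_a hS.injective hh (hS.tendsto_ip S)
  have hh0 := nsq_nonneg (meas G a β) (Φ 0)
  have hrate : ∀ n : ℕ, nsq (meas G a β) (Φ n) - Real.exp (G 0).re ^ 2 ≤
      2 * (nsq (meas G a β) (Φ 0) * A ^ 2) / (n + 1) := fun n =>
    (le_abs_self _).trans (norm_sub_le_of_tendsto (N := 0) (by positivity)
      (fun n _ => S.norm_nsq_sub_le hA n) hh n (Nat.zero_le n))
  choose U M M' N' hU hM hUM hM' hP using fun k =>
    S.exists_asymptotics hS.norm_a hS.injective hS.lt_β hA0 hA hK0 hK k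
  set ϑ := fun k => sqPhase (szegoErase G a β k (a k)) with hϑ
  have hinv : ∀ k, sqPhase (U k) = (ϑ k)⁻¹ := by
    intro k
    refine eq_inv_of_mul_eq_one_left
      (hS.sqPhase_mul_eq_one S k (by positivity) hrate ?_ (hM' k) (hP k))
    rw [tendsto_iff_norm_sub_tendsto_zero]
    refine squeeze_zero' (Eventually.of_forall fun n => norm_nonneg _)
      (eventually_atTop.2 ⟨N' k, fun n hn => hUM k n hn⟩) ?_
    have := (tendsto_one_div_add_atTop_nhds_zero_nat (𝕜 := ℝ)).const_mul (M k)
    rw [mul_zero] at this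
    exact this.congr fun n => by ring
  set B := ∑ k, |β k| * M k with hB
  have hB0 : 0 ≤ B := Finset.sum_nonneg fun k _ => mul_nonneg (abs_nonneg _) (hM k)
  refine ⟨K + B + 1, by positivity, max (max N 1) (∑ k, N' k), fun n hn => ?_⟩
  have hn1 : 1 ≤ n := ((le_max_right _ _).trans (le_max_left _ _)).trans hn
  have hnN : N ≤ n := ((le_max_left _ _).trans (le_max_left _ _)).trans hn
  have hnN' : ∀ k, N' k ≤ n := fun k =>
    (Finset.single_le_sum (fun _ _ => Nat.zero_le _) (Finset.mem_univ k)).trans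
      ((le_max_right _ _).trans hn)
  have hn0 : (0 : ℝ) < n := by exact_mod_cast hn1
  have hnc : (n : ℂ) ≠ 0 := by exact_mod_cast hn0.ne'
  have h1 : ‖∑ k, (β k : ℂ) / ϑ k * (a k ^ (n + 1))⁻¹ -
      ∑ k, (β k : ℂ) * System.phase Φ (a k) n‖ ≤ B / (n + 1) := by
    rw [← Finset.sum_sub_distrib, hB, Finset.sum_div]
    refine (norm_sum_le _ _).trans (Finset.sum_le_sum fun k _ => ?_)
    have h2 : (β k : ℂ) / ϑ k * (a k ^ (n + 1))⁻¹ - β k * System.phase Φ (a k) n =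
        -(β k * (a k ^ (n + 1))⁻¹ *
          ((star Φ n).eval (a k) / (starRingEnd ℂ) ((star Φ n).eval (a k)) -
            U k / (starRingEnd ℂ) (U k))) := by
      have h3 : U k / (starRingEnd ℂ) (U k) = (ϑ k)⁻¹ := hinv k
      rw [h3, System.phase]
      ring
    rw [h2, norm_neg, norm_mul, norm_mul, norm_inv, norm_pow, hS.norm_a, one_pow, inv_one, mul_one,
      Complex.norm_real, Real.norm_eq_abs, mul_div_assoc]
    exact mul_le_mul_of_nonneg_left (hUM k n (hnN' k)) (abs_nonneg _)
  have h2 : ‖n * α n + ∑ k, (β k : ℂ) / ϑ k * (a k ^ (n + 1))⁻¹‖ ≤ (K + B) / (n + 1) := by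
    rw [add_div]
    refine le_trans ?_ (add_le_add (hK n hnN) h1)
    refine le_trans (le_of_eq ?_) (norm_add_le _ _)
    congr 1
    ring
  have h3 : α n + (n : ℂ)⁻¹ * ∑ k, (β k : ℂ) / ϑ k * (a k ^ (n + 1))⁻¹ =
      (n : ℂ)⁻¹ * (n * α n + ∑ k, (β k : ℂ) / ϑ k * (a k ^ (n + 1))⁻¹) := by
    rw [mul_add, ← mul_assoc, inv_mul_cancel₀ hnc, one_mul]
  rw [h3, norm_mul, norm_inv, Complex.norm_natCast]
  calc (n : ℝ)⁻¹ * _ ≤ (n : ℝ)⁻¹ * ((K + B + 1) / n) := by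
        gcongr
        exact h2.trans (div_le_div₀ (by positivity) (by linarith) hn0 (by linarith))
    _ = _ := by field_simp

end SzegoData

/-- The Schwarz integral formula. -/
lemma Radial.schwarz {F : ℂ → ℂ} {f : ℝ → ℂ} (h : Radial F f) (hf : Integrable f arc)
    (h0 : (F 0).im = 0) {y : ℂ} (hy : ‖y‖ < 1) :
    ∫ θ, ((2 * (f θ).re : ℝ) : ℂ) * ((circ θ + y) / (circ θ - y)) ∂arc = 2 * F y := by
  have hne : ∀ θ, circ θ - y ≠ 0 := fun θ h => by
    rw [sub_eq_zero] at h
    rw [← h, norm_circ] at hy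
    exact lt_irrefl _ hy
  have hne' : ∀ z : ℂ, ‖z‖ ≤ 1 → 1 - (starRingEnd ℂ) y * z ≠ 0 := fun z hz h => by
    rw [sub_eq_zero] at h
    have h1 := congrArg norm h
    rw [norm_one, norm_mul, RCLike.norm_conj] at h1
    nlinarith [norm_nonneg y, norm_nonneg z]
  have hk : ContinuousOn (fun z : ℂ => z / (z - y)) (sphere 0 1) := by
    refine continuousOn_id.div (by fun_prop) fun z hz h0 => ?_
    rw [sub_eq_zero] at h0
    rw [← h0, mem_sphere_zero_iff_norm.1 hz] at hy
    exact lt_irrefl _ hy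
  have hk2 : ContinuousOn (fun z : ℂ => 1 / (1 - (starRingEnd ℂ) y * z)) (closedBall 0 1) :=
    continuousOn_const.div (by fun_prop) fun z hz => hne' z (by simpa using hz)
  have hk2s : ContinuousOn (fun z : ℂ => 1 / (1 - (starRingEnd ℂ) y * z)) (sphere 0 1) :=
    hk2.mono sphere_subset_closedBall
  obtain ⟨C, -, hC⟩ := exists_bound_circ hk
  obtain ⟨C', -, hC'⟩ := exists_bound_circ hk2s
  have hi1 : Integrable (fun θ => circ θ / (circ θ - y) * f θ) arc :=
    hf.bdd_mul (continuous_comp_circ hk).aestronglyMeasurable (ae_of_all _ hC)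
  have hi2 : Integrable (fun θ => 1 / (1 - (starRingEnd ℂ) y * circ θ) * f θ) arc :=
    hf.bdd_mul (continuous_comp_circ hk2s).aestronglyMeasurable (ae_of_all _ hC')
  have hconj : ∀ {g : ℝ → ℂ}, Integrable g arc →
      Integrable (fun θ => (starRingEnd ℂ) (g θ)) arc := fun hg =>
    (Complex.conjCLE : ℂ →L[ℝ] ℂ).integrable_comp hg
  have e : ∀ θ, ((2 * (f θ).re : ℝ) : ℂ) * ((circ θ + y) / (circ θ - y)) =
      2 * (circ θ / (circ θ - y) * f θ) +
        2 * (starRingEnd ℂ) (1 / (1 - (starRingEnd ℂ) y * circ θ) * f θ) -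
        (f θ + (starRingEnd ℂ) (f θ)) := by
    intro θ
    have h1 := hne θ
    have h2 : (starRingEnd ℂ) (1 / (1 - (starRingEnd ℂ) y * circ θ)) = circ θ / (circ θ - y) := by
      simp only [map_div₀, map_one, map_sub, map_mul, Complex.conj_conj, conj_circ]
      field_simp
    have h3 : (circ θ + y) / (circ θ - y) = 2 * (circ θ / (circ θ - y)) - 1 := by
      field_simp
      ring
    rw [map_mul, h2, h3, Complex.add_conj]
    have h4 : ((2 * (f θ).re : ℝ) : ℂ) = f θ + (starRingEnd ℂ) (f θ) := (Complex.add_conj _).symm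
    linear_combination (2 * (circ θ / (circ θ - y))) * h4
  simp only [e]
  have h2 := h.integral_mul_eq (k := fun z => 1 / (1 - (starRingEnd ℂ) y * z))
    ((differentiableOn_const _).div (by fun_prop) fun z hz => hne' z (mem_ball_zero_iff.1 hz).le) hk2
  have hA : Integrable (fun θ => 2 * (circ θ / (circ θ - y) * f θ) +
      2 * (starRingEnd ℂ) (1 / (1 - (starRingEnd ℂ) y * circ θ) * f θ)) arc :=
    (hi1.const_mul 2).add ((hconj hi2).const_mul 2)
  have hB : Integrable (fun θ => f θ + (starRingEnd ℂ) (f θ)) arc := hf.add (hconj hf)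
  rw [integral_sub hA hB,
    integral_add (hi1.const_mul 2) ((hconj hi2).const_mul 2), integral_add hf (hconj hf),
    integral_const_mul, integral_const_mul, integral_conj, integral_conj, h.cauchy hy, h2,
    h.integral_eq_zero_value]
  simp only [mul_zero, sub_zero, div_one, one_mul]
  rw [Complex.conj_eq_iff_im.2 h0]
  ring

lemma abs_log_le {c x : ℝ} (hc : 0 < c) (h1 : c / 2 ≤ x) (h2 : x ≤ 2) :
    |Real.log x| ≤ Real.log 2 + 2 * c ^ (-(1 / 2) : ℝ) := by
  have hx : 0 < x := by linarith
  have hl : 0 ≤ Real.log 2 := Real.log_nonneg one_le_two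
  have hc' : 0 < c ^ (-(1 / 2) : ℝ) := Real.rpow_pos_of_pos hc _
  have h3 := Real.log_le_log hx h2
  have h4 := Real.log_le_log (by linarith) h1
  have h5 := Real.log_le_sub_one_of_pos hc'
  rw [Real.log_rpow hc] at h5
  rw [Real.log_div hc.ne' two_ne_zero] at h4
  rw [abs_le]
  constructor <;> linarith

/-- The logarithm of the Szegő function. -/
noncomputable def logSzego {ι : Type*} [Fintype ι] (G : ℂ → ℂ) (a : ι → ℂ) (β : ι → ℝ) (z : ℂ) : ℂ :=
  G z + ∑ k, β k * Complex.log (1 - (starRingEnd ℂ) (a k) * z)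

namespace SzegoData

variable {ι : Type*} [Fintype ι] {G : ℂ → ℂ} {r : ℝ} {a : ι → ℂ} {β : ι → ℝ} {d : ℝ}

omit [Fintype ι] in
lemma one_sub_ne_zero (hS : SzegoData G r a β d) {z : ℂ} {k : ι} (hz : z ≠ a k) :
    1 - (starRingEnd ℂ) (a k) * z ≠ 0 := by
  rw [← norm_ne_zero_iff, norm_one_sub_conj_mul (hS.norm_a k)]
  exact norm_ne_zero_iff.2 (sub_ne_zero.2 hz)

lemma exp_logSzego (hS : SzegoData G r a β d) {z : ℂ} (hz : ∀ k, z ≠ a k) :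
    Complex.exp (logSzego G a β z) = szego G a β z := by
  rw [logSzego, szego, Complex.exp_add, Complex.exp_sum]
  congr 1
  refine Finset.prod_congr rfl fun k _ => ?_
  rw [Complex.cpow_def_of_ne_zero (hS.one_sub_ne_zero (hz k)), mul_comm]

lemma logSzego_zero_im (hS : SzegoData G r a β d) : (logSzego G a β 0).im = 0 := by
  simp [logSzego, hS.zero_im]

lemma exists_norm_logSzego_le (hS : SzegoData G r a β d) : ∃ g : ℝ → ℝ, Integrable g arc ∧
    ∀ θ, (∀ k, circ θ ≠ a k) → ‖logSzego G a β (circ θ)‖ ≤ g θ ∧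
      ∀ R : ℝ, 0 < R → R < 1 → ‖logSzego G a β (R * circ θ)‖ ≤ g θ := by
  obtain ⟨B, hB⟩ := (isCompact_closedBall (0 : ℂ) 1).exists_bound_of_continuousOn hS.continuousOn
  refine ⟨fun θ => B + ∑ k, |β k| * (Real.log 2 + 2 * ‖circ θ - a k‖ ^ (-(1 / 2) : ℝ) + π), ?_,
    fun θ hθ => ?_⟩
  · refine (integrable_const _).add (integrable_finsetSum _ fun k _ => ?_)
    refine ((Integrable.add (integrable_const _) ?_).add (integrable_const _)).const_mul _
    exact (integrable_norm_circ_sub_rpow (hS.norm_a k) (by norm_num) (by norm_num)).const_mul 2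
  · have key : ∀ z : ℂ, ‖z‖ ≤ 1 → (∀ k, ‖circ θ - a k‖ / 2 ≤ ‖z - a k‖ ∧ ‖z - a k‖ ≤ 2) →
        ‖logSzego G a β z‖ ≤
          B + ∑ k, |β k| * (Real.log 2 + 2 * ‖circ θ - a k‖ ^ (-(1 / 2) : ℝ) + π) := by
      intro z hz1 hz2
      refine (norm_add_le _ _).trans (add_le_add (hB z (by simpa using hz1))
        ((norm_sum_le _ _).trans (Finset.sum_le_sum fun k _ => ?_)))
      rw [norm_mul, Complex.norm_real, Real.norm_eq_abs]
      refine mul_le_mul_of_nonneg_left ?_ (abs_nonneg _)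
      refine (Complex.norm_le_abs_re_add_abs_im _).trans (add_le_add ?_ ?_)
      · rw [Complex.log_re, norm_one_sub_conj_mul (hS.norm_a k)]
        exact abs_log_le (norm_pos_iff.2 (sub_ne_zero.2 (hθ k))) (hz2 k).1 (hz2 k).2
      · rw [Complex.log_im]
        exact Complex.abs_arg_le_pi _
    refine ⟨key _ (by simp) fun k => ⟨by linarith [norm_nonneg (circ θ - a k)],
      norm_circ_sub_le_two (hS.norm_a k) θ⟩, fun R h0 h1 => key _ ?_ fun k =>
        ⟨half_norm_le (hS.norm_a k) h0 h1 θ, norm_sub_le_two (hS.norm_a k) h0 h1 θ⟩⟩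
    rw [norm_ofReal_mul_circ h0.le]
    exact h1.le

lemma measurable_logSzego (hS : SzegoData G r a β d) :
    Measurable fun θ => logSzego G a β (circ θ) := by
  have h1 : Continuous fun θ => G (circ θ) :=
    continuous_comp_circ (hS.continuousOn.mono sphere_subset_closedBall)
  refine h1.measurable.add (Finset.measurable_fun_sum _ fun k _ => ?_)
  have h2 : Continuous fun θ => 1 - (starRingEnd ℂ) (a k) * circ θ :=
    continuous_const.sub (continuous_const.mul continuous_circ)
  exact (Complex.measurable_log.comp h2.measurable).const_mul _

lemma integrable_logSzego (hS : SzegoData G r a β d) :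
    Integrable (fun θ => logSzego G a β (circ θ)) arc := by
  obtain ⟨g, hg, hgb⟩ := hS.exists_norm_logSzego_le
  refine hg.mono' hS.measurable_logSzego.aestronglyMeasurable ?_
  filter_upwards [ae_ne a] with θ hθ using (hgb θ hθ).1

lemma radial_logSzego (hS : SzegoData G r a β d) :
    Radial (logSzego G a β) fun θ => logSzego G a β (circ θ) := by
  obtain ⟨g, hg, hgb⟩ := hS.exists_norm_logSzego_le
  refine ⟨?_, ⟨g, hg, fun R h0 h1 => ?_⟩, ?_⟩
  · refine (hS.diff.mono (ball_subset_ball hS.one_lt.le)).add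
      (DifferentiableOn.fun_sum fun k _ => (DifferentiableOn.clog (by fun_prop) fun z hz => ?_).const_mul _)
    rw [mem_ball_zero_iff] at hz
    exact Or.inl (one_sub_conj_mul_re_pos (hS.norm_a k) hz.le (hS.ne_of_norm_lt hz k))
  · filter_upwards [ae_ne a] with θ hθ using (hgb θ hθ).2 R h0 h1
  · filter_upwards [ae_ne a] with θ hθ
    have : ContinuousAt (logSzego G a β) (circ θ) := by
      refine (hS.continuousAt (by simp)).add (tendsto_finsetSum _ fun k _ => ?_)
      refine ContinuousAt.mul continuousAt_const (ContinuousAt.clog (by fun_prop) ?_)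
      exact Or.inl (one_sub_conj_mul_re_pos (hS.norm_a k) (by simp) (hθ k))
    exact this.tendsto.comp (tendsto_ofReal_mul_circ θ)

lemma exp_integral_eq_szego (hS : SzegoData G r a β d) {y : ℂ} (hy : ‖y‖ < 1) :
    Complex.exp ((1 / 2) * ∫ θ, ((2 * (logSzego G a β (circ θ)).re : ℝ) : ℂ) *
      ((circ θ + y) / (circ θ - y)) ∂arc) = szego G a β y := by
  rw [hS.radial_logSzego.schwarz hS.integrable_logSzego hS.logSzego_zero_im hy,
    ← hS.exp_logSzego fun k => hS.ne_of_norm_lt hy k]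
  congr 1
  ring

lemma exp_integral_eq_inv_conj_szego (hS : SzegoData G r a β d) {y : ℂ} (hy : 1 < ‖y‖) :
    Complex.exp ((1 / 2) * ∫ θ, ((2 * (logSzego G a β (circ θ)).re : ℝ) : ℂ) *
      ((circ θ + y) / (circ θ - y)) ∂arc) =
      ((starRingEnd ℂ) (szego G a β ((starRingEnd ℂ) y)⁻¹))⁻¹ := by
  have h0 : y ≠ 0 := norm_pos_iff.1 (by linarith)
  rw [← hS.exp_integral_eq_szego (y := ((starRingEnd ℂ) y)⁻¹) (by
    rw [norm_inv, RCLike.norm_conj]; exact inv_lt_one_of_one_lt₀ hy), ← Complex.exp_conj,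
    ← Complex.exp_neg, map_mul, ← integral_conj, ← mul_neg, ← integral_neg]
  congr 2
  · simp [Complex.conj_ofNat]
  · refine integral_congr_ae (ae_of_all _ fun θ => ?_)
    have h1 : circ θ - y ≠ 0 := fun h => by
      rw [sub_eq_zero] at h
      rw [← h, norm_circ] at hy
      exact lt_irrefl _ hy
    have h2 : y - circ θ ≠ 0 := fun h => h1 (by linear_combination -h)
    have h3 := circ_ne_zero θ
    simp only [map_mul, Complex.conj_ofReal, map_div₀, map_add, map_sub, map_inv₀,
      Complex.conj_conj, conj_circ]
    rw [← mul_neg]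
    congr 1
    rw [inv_sub_inv h3 h0, inv_add_inv h3 h0]
    field_simp
    ring

end SzegoData

lemma sqPhase_exp (u : ℂ) : sqPhase (Complex.exp u) = Complex.exp ((2 * u.im : ℝ) * Complex.I) := by
  rw [sqPhase, ← Complex.exp_conj, ← Complex.exp_sub, Complex.sub_conj]

lemma arg_one_sub_circ {θ : ℝ} (h0 : 0 < θ) (h1 : θ < π) :
    Complex.arg (1 - circ θ) = (θ - π) / 2 := by
  have hs : 0 < 2 * Real.sin (θ / 2) :=
    mul_pos two_pos (Real.sin_pos_of_pos_of_lt_pi (by linarith) (by linarith))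
  have h : 1 - circ θ = ((2 * Real.sin (θ / 2) : ℝ) : ℂ) *
      (Complex.cos ((θ - π) / 2 : ℝ) + Complex.sin ((θ - π) / 2 : ℝ) * Complex.I) := by
    have e : (θ - π) / 2 = θ / 2 - π / 2 := by ring
    have hc : circ θ = Complex.cos θ + Complex.sin θ * Complex.I := Complex.exp_mul_I θ
    have hθ : (θ : ℂ) = 2 * ((θ / 2 : ℝ) : ℂ) := by push_cast; ring
    rw [← Complex.ofReal_cos, ← Complex.ofReal_sin, e, Real.cos_sub_pi_div_two,
      Real.sin_sub_pi_div_two, hc, hθ, Complex.cos_two_mul, Complex.sin_two_mul]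
    have h2 := Complex.sin_sq_add_cos_sq ((θ / 2 : ℝ) : ℂ)
    push_cast at h2 ⊢
    linear_combination (-2) * h2
  rw [h, Complex.arg_mul_cos_add_sin_mul_I hs ⟨by linarith, by linarith⟩]

lemma sqPhase_one_sub_circ_cpow {θ : ℝ} (h0 : 0 < θ) (h1 : θ < π) (β : ℝ) :
    sqPhase ((1 - circ θ) ^ (β : ℂ)) = Complex.exp ((β * (θ - π) : ℝ) * Complex.I) := by
  have ha := arg_one_sub_circ h0 h1
  have hne : 1 - circ θ ≠ 0 := fun h => by
    rw [h, Complex.arg_zero] at ha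
    linarith
  rw [Complex.cpow_def_of_ne_zero hne, sqPhase_exp, Complex.im_mul_ofReal, Complex.log_im, ha]
  congr 3
  ring

lemma eq_of_eqOn_of_mem_closure {D E : ℂ → ℂ} {s T : Set ℂ} {z : ℂ} (hD : ContinuousOn D s)
    (hTs : T ⊆ s) (hzs : z ∈ s) (hzT : z ∈ closure T) (hE : ContinuousAt E z)
    (h : ∀ y ∈ T, D y = E y) : D z = E z := by
  have hne : (nhdsWithin z T).NeBot := mem_closure_iff_nhdsWithin_neBot.1 hzT
  refine tendsto_nhds_unique ((hD z hzs).mono hTs).tendsto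
    ((hE.continuousWithinAt (s := T)).tendsto.congr' ?_)
  filter_upwards [self_mem_nhdsWithin] with y hy using (h y hy).symm

lemma mem_closure_one_lt_norm {z : ℂ} (hz : ‖z‖ = 1) : z ∈ closure {y : ℂ | 1 < ‖y‖} := by
  have h : {y : ℂ | 1 < ‖y‖} = (closedBall 0 1)ᶜ := by
    ext y
    simp
  rw [h, closure_compl, interior_closedBall _ one_ne_zero]
  simp [hz]

namespace SzegoData

variable {m : ℕ} {G : ℂ → ℂ} {r : ℝ} {a : Fin m → ℂ} {β : Fin m → ℝ} {d : ℝ}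

lemma norm_szego_sq (hS : SzegoData G r a β d) (z : ℂ) :
    ‖szego G a β z‖ ^ 2 = Real.exp (2 * (G z).re) * ∏ k, ‖z - a k‖ ^ (2 * β k) := by
  rw [hS.norm_szego, mul_pow, Complex.norm_exp, ← Real.exp_nat_mul, ← Finset.prod_pow]
  congr 1
  refine Finset.prod_congr rfl fun k _ => ?_
  rw [← Real.rpow_mul_natCast (norm_nonneg _), mul_comm]
  norm_num

lemma log_norm_szego_sq (hS : SzegoData G r a β d) {z : ℂ} (hz : ∀ k, z ≠ a k) :
    Real.log (‖szego G a β z‖ ^ 2) = 2 * (logSzego G a β z).re := by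
  rw [← hS.exp_logSzego hz, Complex.norm_exp, Real.log_pow, Real.log_exp]
  norm_num

lemma exponent_eq (hS : SzegoData G r a β d) {W : ℂ → ℝ}
    (hW : ∀ z, ‖z‖ = 1 → W z = ‖szego G a β z‖ ^ 2) (y : ℂ) :
    ((4 * π : ℝ)⁻¹ : ℂ) * ∫ θ in (0:ℝ)..(2 * π), (Real.log (W (circ θ)) : ℂ) *
      ((circ θ + y) / (circ θ - y)) =
    (1 / 2) * ∫ θ, ((2 * (logSzego G a β (circ θ)).re : ℝ) : ℂ) *
      ((circ θ + y) / (circ θ - y)) ∂arc := by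
  have h : ∫ θ, ((2 * (logSzego G a β (circ θ)).re : ℝ) : ℂ) * ((circ θ + y) / (circ θ - y)) ∂arc =
      ∫ θ, (Real.log (W (circ θ)) : ℂ) * ((circ θ + y) / (circ θ - y)) ∂arc := by
    refine integral_congr_ae ?_
    filter_upwards [ae_ne a] with θ hθ
    rw [hW _ (norm_circ θ), hS.log_norm_szego_sq hθ]
  rw [h, integral_arc, Complex.real_smul]
  push_cast
  ring

lemma scattering_eq (hS : SzegoData G r a β d) {ρ : ℝ} (hρ0 : 0 < ρ) (hρ1 : ρ < 1) {Di De : ℂ → ℂ}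
    (hDi : ∀ z, ‖z‖ < 1 → Di z = szego G a β z)
    (hDe : ∀ z : ℂ, 1 < ‖z‖ → De z = ((starRingEnd ℂ) (szego G a β ((starRingEnd ℂ) z)⁻¹))⁻¹)
    (hDi_c : ContinuousOn Di
      ({z : ℂ | ‖z‖ < 1/ρ} \ ⋃ k, (fun t : ℝ => (t : ℂ) * a k) '' Set.Ico 1 (1/ρ)))
    (hDe_c : ContinuousOn De
      ({z : ℂ | ρ < ‖z‖} \ ⋃ k, (fun t : ℝ => (t : ℂ) * a k) '' Set.Ioc ρ 1))
    {z : ℂ} (hz : ‖z‖ = 1) (hza : ∀ k, z ≠ a k) : Di z * De z = sqPhase (szego G a β z) := by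
  have hρ : 1 < 1 / ρ := by rw [lt_div_iff₀ hρ0]; linarith
  have hnorm : ∀ (t : ℝ) k, 0 < t → ‖(t : ℂ) * a k‖ = t := fun t k ht => by
    rw [norm_mul, hS.norm_a, mul_one, Complex.norm_real, Real.norm_eq_abs, abs_of_pos ht]
  have hone : ∀ (t : ℝ) k, 0 < t → (t : ℂ) * a k ≠ z := fun t k ht h => by
    have h1 := hnorm t k ht
    rw [h, hz] at h1
    rw [← h1, Complex.ofReal_one, one_mul] at h
    exact hza k h.symm
  have h1 : Di z = szego G a β z := by
    refine eq_of_eqOn_of_mem_closure (T := ball 0 1) hDi_c ?_ ?_ ?_ (hS.continuousAt_szego hz.le hza)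
      fun y hy => hDi y (mem_ball_zero_iff.1 hy)
    · intro y hy
      rw [mem_ball_zero_iff] at hy
      refine ⟨hy.trans hρ, fun h => ?_⟩
      obtain ⟨k, t, ht, rfl⟩ := mem_iUnion.1 h
      rw [hnorm t k (by linarith [ht.1])] at hy
      linarith [ht.1]
    · refine ⟨by simpa [hz] using hρ, fun h => ?_⟩
      obtain ⟨k, t, ht, h⟩ := mem_iUnion.1 h
      exact hone t k (by linarith [ht.1]) h
    · rw [closure_ball _ one_ne_zero]
      simp [hz]
  have hzz : ((starRingEnd ℂ) z)⁻¹ = z := by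
    rw [inv_eq_of_mul_eq_one_left]
    rw [Complex.mul_conj', hz]
    norm_num
  have h2 : De z = ((starRingEnd ℂ) (szego G a β z))⁻¹ := by
    have hz0 : (starRingEnd ℂ) z ≠ 0 := fun h => by
      rw [map_eq_zero] at h
      simp [h] at hz
    have hE : ContinuousAt
        (fun z : ℂ => ((starRingEnd ℂ) (szego G a β ((starRingEnd ℂ) z)⁻¹))⁻¹) z := by
      have h3 : ContinuousAt (szego G a β) ((starRingEnd ℂ) z)⁻¹ := by
        rw [hzz]
        exact hS.continuousAt_szego hz.le hza
      have h4 : ContinuousAt (fun z : ℂ => ((starRingEnd ℂ) z)⁻¹) z :=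
        Complex.continuous_conj.continuousAt.inv₀ hz0
      have h5 : ContinuousAt (fun z : ℂ => szego G a β ((starRingEnd ℂ) z)⁻¹) z :=
        ContinuousAt.comp (f := fun z : ℂ => ((starRingEnd ℂ) z)⁻¹) h3 h4
      refine ContinuousAt.inv₀ (Complex.continuous_conj.continuousAt.comp h5) ?_
      rw [hzz]
      exact (_root_.map_ne_zero _).2 (hS.szego_ne_zero hza)
    rw [eq_of_eqOn_of_mem_closure (T := {y : ℂ | 1 < ‖y‖}) hDe_c ?_ ?_
      (mem_closure_one_lt_norm hz) hE hDe]
    · simp only [hzz]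
    · intro y (hy : 1 < ‖y‖)
      refine ⟨hρ1.trans hy, fun h => ?_⟩
      obtain ⟨k, t, ht, rfl⟩ := mem_iUnion.1 h
      rw [hnorm t k (by linarith [ht.1])] at hy
      linarith [ht.2]
    · refine ⟨by simpa [hz] using hρ1, fun h => ?_⟩
      obtain ⟨k, t, ht, h⟩ := mem_iUnion.1 h
      exact hone t k (by linarith [ht.1]) h
  rw [h1, h2, sqPhase, div_eq_mul_inv]

lemma eq_sqPhase_szegoErase (hS : SzegoData G r a β d) {δ : ℝ} (hδ0 : 0 < δ) (hδd : δ ≤ d)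
    {S f : ℂ → ℂ} {k : Fin m} (hf : ContinuousOn f (ball (a k) δ))
    (hfS : ∀ z ∈ ball (a k) δ, 0 < Complex.arg (z / a k) →
      f z = Complex.exp (((π * β k : ℝ) : ℂ) * Complex.I) * S z)
    (hSc : ∀ z, ‖z‖ = 1 → (∀ k, z ≠ a k) → S z = sqPhase (szego G a β z)) :
    f (a k) = sqPhase (szegoErase G a β k (a k)) := by
  have ha0 : a k ≠ 0 := norm_ne_zero_iff.1 (by rw [hS.norm_a]; exact one_ne_zero)
  have ht : Tendsto (fun θ => a k * circ θ) (nhdsWithin 0 (Ioi 0)) (nhds (a k)) := by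
    have h : ContinuousAt (fun θ => a k * circ θ) 0 :=
      (continuous_const.mul continuous_circ).continuousAt
    have h' := h.tendsto
    simp only [circ, Complex.ofReal_zero, zero_mul, Complex.exp_zero, mul_one] at h'
    exact h'.mono_left nhdsWithin_le_nhds
  have hb : ball (a k) δ ∈ nhds (a k) := ball_mem_nhds _ hδ0
  have h1 : Tendsto (fun θ => f (a k * circ θ)) (nhdsWithin 0 (Ioi 0)) (nhds (f (a k))) :=
    (hf.continuousAt hb).tendsto.comp ht
  have h2 : Tendsto (fun θ : ℝ => Complex.exp ((β k * θ : ℝ) * Complex.I) *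
      sqPhase (szegoErase G a β k (a k * circ θ))) (nhdsWithin 0 (Ioi 0))
      (nhds (1 * sqPhase (szegoErase G a β k (a k)))) := by
    refine Tendsto.mul ?_ (((continuousAt_sqPhase (hS.szegoErase_ne_zero k)).tendsto.comp
      (hS.continuousAt_szegoErase k).tendsto).comp ht)
    have h : Continuous fun θ : ℝ => Complex.exp ((β k * θ : ℝ) * Complex.I) := by fun_prop
    have h' := h.tendsto 0
    simp only [mul_zero, Complex.ofReal_zero, zero_mul, Complex.exp_zero] at h'
    exact h'.mono_left nhdsWithin_le_nhds
  rw [one_mul] at h2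
  refine tendsto_nhds_unique h1 (h2.congr' ?_)
  filter_upwards [ht hb, self_mem_nhdsWithin,
    nhdsWithin_le_nhds (Iio_mem_nhds Real.pi_pos)] with θ hθb (hθ0 : 0 < θ) (hθπ : θ < π)
  have hθb' : a k * circ θ ∈ ball (a k) δ := hθb
  have harg : Complex.arg (circ θ) = θ := by
    rw [circ, Complex.arg_exp_mul_I, toIocMod_eq_self]
    exact ⟨by linarith, by linarith⟩
  have hne : ∀ j, a k * circ θ ≠ a j := by
    intro j h
    by_cases hjk : j = k
    · subst hjk
      rw [mul_eq_left₀ ha0] at h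
      rw [h, Complex.arg_one] at harg
      exact hθ0.ne harg
    · rw [h, mem_ball, dist_eq_norm] at hθb'
      linarith [hS.dist_le j k hjk]
  have hconj : (starRingEnd ℂ) (a k) * (a k * circ θ) = circ θ := by
    rw [← mul_assoc, conj_mul_self_of_norm_one (hS.norm_a k), one_mul]
  rw [hfS _ hθb' (by rw [mul_div_cancel_left₀ _ ha0, harg]; exact hθ0),
    hSc _ (by rw [norm_mul, hS.norm_a, norm_circ, one_mul]) hne, szego_eq_mul G a β k, sqPhase_mul,
    hconj, sqPhase_one_sub_circ_cpow hθ0 hθπ, ← mul_assoc, ← Complex.exp_add]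
  congr 2
  push_cast
  ring

lemma system [Nonempty (Fin m)] (hS : SzegoData G r a β d) {W : ℂ → ℝ}
    (hW : ∀ z, ‖z‖ = 1 → W z = ‖szego G a β z‖ ^ 2) {Φ : ℕ → ℂ[X]} {α : ℕ → ℂ}
    (hΦmonic : ∀ n, (Φ n).Monic) (hΦdeg : ∀ n, (Φ n).natDegree = n)
    (hΦorth : ∀ n : ℕ, ∀ j < n, (∫ θ in (0:ℝ)..(2 * π),
      (Φ n).eval (circ θ) * (starRingEnd ℂ) (circ θ) ^ j * (W (circ θ) : ℂ)) = 0)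
    (hα : ∀ n : ℕ, α n = -(starRingEnd ℂ) ((Φ (n + 1)).eval 0)) :
    System (meas G a β) (Real.exp (G 0).re) Φ α where
  pos := Real.exp_pos _
  low := hS.outer.low
  monic := hΦmonic
  deg := hΦdeg
  orth n j hj := by
    rw [ip, hS.outer.integral, integral_arc]
    refine smul_eq_zero_of_right _ ((intervalIntegral.integral_congr fun θ _ => ?_).trans
      (hΦorth n j hj))
    simp only [hW _ (norm_circ θ), eval_pow, eval_X, map_pow]
    ring
  coeff_zero n := by rw [hα, coeff_zero_eq_eval_zero]

end SzegoData
end OPUC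

theorem stmt5
    (ρ : ℝ) (hρ0 : 0 < ρ) (hρ1 : ρ < 1)
    (m : ℕ) (hm : 0 < m)
    (a : Fin m → ℂ) (ha : ∀ k, ‖a k‖ = 1) (ha' : Function.Injective a)
    (β : Fin m → ℝ) (hβ : ∀ k, -(1/2 : ℝ) < β k)
    (w : ℂ → ℂ)
    (hw_an : AnalyticOn ℂ w {z : ℂ | ρ < ‖z‖ ∧ ‖z‖ < 1/ρ})
    (hw_ne : ∀ z : ℂ, ρ < ‖z‖ → ‖z‖ < 1/ρ → w z ≠ 0)
    (hw_pos : ∀ z : ℂ, ‖z‖ = 1 → 0 < (w z).re ∧ (w z).im = 0)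
    (W : ℂ → ℝ)
    (hW : ∀ z : ℂ, ‖z‖ = 1 → W z = (w z).re * ∏ k, ‖z - a k‖ ^ (2 * β k))
    (Φ : ℕ → Polynomial ℂ)
    (hΦmonic : ∀ n, (Φ n).Monic) (hΦdeg : ∀ n, (Φ n).natDegree = n)
    (hΦorth : ∀ n : ℕ, ∀ j < n,
      (∫ θ in (0:ℝ)..(2 * π),
        (Φ n).eval (Complex.exp (θ * Complex.I)) *
          (starRingEnd ℂ) (Complex.exp (θ * Complex.I)) ^ j *
          (W (Complex.exp (θ * Complex.I)) : ℂ)) = 0)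
    (Di De : ℂ → ℂ)
    (hDi_def : ∀ z : ℂ, ‖z‖ < 1 → Di z =
      Complex.exp (((4 * π : ℝ)⁻¹ : ℂ) * ∫ θ in (0:ℝ)..(2 * π),
        (Real.log (W (Complex.exp (θ * Complex.I))) : ℂ) *
          ((Complex.exp (θ * Complex.I) + z) / (Complex.exp (θ * Complex.I) - z))))
    (hDe_def : ∀ z : ℂ, 1 < ‖z‖ → De z =
      Complex.exp (((4 * π : ℝ)⁻¹ : ℂ) * ∫ θ in (0:ℝ)..(2 * π),
        (Real.log (W (Complex.exp (θ * Complex.I))) : ℂ) *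
          ((Complex.exp (θ * Complex.I) + z) / (Complex.exp (θ * Complex.I) - z))))
    (hDi_an : AnalyticOn ℂ Di
      ({z : ℂ | ‖z‖ < 1/ρ} \ ⋃ k, (fun t : ℝ => (t : ℂ) * a k) '' Set.Ico 1 (1/ρ)))
    (hDe_an : AnalyticOn ℂ De
      ({z : ℂ | ρ < ‖z‖} \ ⋃ k, (fun t : ℝ => (t : ℂ) * a k) '' Set.Ioc ρ 1))
    (δ : ℝ) (hδ0 : 0 < δ) (hδρ : δ < 1 - ρ)
    (hδa : ∀ i j : Fin m, i ≠ j → 3 * δ < ‖a i - a j‖)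
    (Sk : Fin m → ℂ → ℂ)
    (hSk_an : ∀ k, AnalyticOn ℂ (Sk k) (Metric.ball (a k) δ))
    (hSk_plus : ∀ k, ∀ z ∈ Metric.ball (a k) δ, 0 < Complex.arg (z / a k) →
      Sk k z = Complex.exp (((π * β k : ℝ) : ℂ) * Complex.I) * (Di z * De z))
    (hSk_minus : ∀ k, ∀ z ∈ Metric.ball (a k) δ, Complex.arg (z / a k) < 0 →
      Sk k z = Complex.exp (-((π * β k : ℝ) : ℂ) * Complex.I) * (Di z * De z))
    (ϑ : Fin m → ℂ) (hϑ : ∀ k, ϑ k = Sk k (a k))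
    (α : ℕ → ℂ) (hα : ∀ n : ℕ, α n = -(starRingEnd ℂ) ((Φ (n + 1)).eval 0)) :
    ∃ C : ℝ, 0 < C ∧ ∃ N : ℕ, ∀ n : ℕ, N ≤ n →
      ‖α n + ((n : ℂ))⁻¹ * ∑ k, (β k : ℂ) / ϑ k * ((a k) ^ (n + 1))⁻¹‖ ≤ C / (n : ℝ) ^ 2 := by
  obtain ⟨G, r, hr, hG, hG0, hGw⟩ := OPUC.exists_exp_two_re_eq hρ0 hρ1 hw_an hw_pos
  have hS : OPUC.SzegoData G r a β (3 * δ) :=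
    ⟨hr, hG, hG0, ha, by linarith, fun i j hij => (hδa i j hij).le, hβ⟩
  have hne : Nonempty (Fin m) := ⟨⟨0, hm⟩⟩
  have hW' : ∀ z, ‖z‖ = 1 → W z = ‖OPUC.szego G a β z‖ ^ 2 := fun z hz => by
    rw [hW z hz, hS.norm_szego_sq, hGw z hz]
  have hDi : ∀ z, ‖z‖ < 1 → Di z = OPUC.szego G a β z := fun z hz => by
    rw [hDi_def z hz, ← hS.exp_integral_eq_szego hz, ← hS.exponent_eq hW' z]
    rfl
  have hDe : ∀ z : ℂ, 1 < ‖z‖ → De z =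
      ((starRingEnd ℂ) (OPUC.szego G a β ((starRingEnd ℂ) z)⁻¹))⁻¹ := fun z hz => by
    rw [hDe_def z hz, ← hS.exp_integral_eq_inv_conj_szego hz, ← hS.exponent_eq hW' z]
    rfl
  have hϑ' : ∀ k, ϑ k = OPUC.sqPhase (OPUC.szegoErase G a β k (a k)) := fun k => by
    rw [hϑ]
    exact hS.eq_sqPhase_szegoErase hδ0 (by linarith) (hSk_an k).continuousOn (hSk_plus k)
      fun z hz hza => hS.scattering_eq hρ0 hρ1 hDi hDe hDi_an.continuousOn hDe_an.continuousOn hz hza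
  simp only [hϑ']
  exact hS.exists_norm_alpha_add_le (hS.system hW' hΦmonic hΦdeg hΦorth hα)
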